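/- (Mather's connecting theorem) Let φ ∈ 𝒫¹, i.e. φ = φ_n ∘ ⋯ ∘ φ₁ is a finite composition of lifts of positive monotone twist maps of the cylinder. Let u₋, u₊ : ℝ → ℝ be Lipschitz functions with u±(x+1) = u±(x) and u₋ < u₊, whose graphs Γ₋, Γ₊ ⊂ ℝ² are each invariant under φ. Suppose the region B = {(x, y) : u₋(x) ≤ y ≤ u₊(x)} is φ-invariant and is a Birkhoff region of instability: every φ-invariant and T-invariant graph of a continuous 1-periodic function contained in B equals Γ₋ or Γ₊. Suppose further there exist irrational numbers ω₋ < ω₊ such that for every p ∈ Γ₋ the limit of (π₁(φⁿ(p)) − π₁(p))/n as n → ∞ equals ω₋, and for every p ∈ Γ₊ it equals ω₊, where π₁ is the first-coordinate projection. Then there exists a point p ∈ B whose orbit is α-asymptotic to Γ₋ and ω-asymptotic to Γ₊: dist(φⁿ(p), Γ₊) → 0 and dist(φ⁻ⁿ(p), Γ₋) → 0 as n → ∞. -/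

import Mathlib

open Filter Topology

noncomputable section

abbrev V2 : Type := ℝ × ℝ

/-- The unit translation `T(x, y) = (x+1, y)` of the lifted cylinder. -/
def Tmap : V2 → V2 := fun p => (p.1 + 1, p.2)

/-- A lift of a positive monotone twist map of the cylinder: a C¹ diffeomorphism of ℝ²
commuting with `T`, isotopic to the identity (through homeomorphisms of the cylinder),
with everywhere positive twist `∂X/∂y > 0`, and exact symplectic. -/
def IsPosTwistLift (φ : V2 → V2) : Prop :=
  ContDiff ℝ 1 φ ∧ Function.Bijective φ ∧ ContDiff ℝ 1 (Function.invFun φ) ∧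
  (∀ p, φ (Tmap p) = Tmap (φ p)) ∧
  (∃ H : ℝ → V2 → V2, Continuous (fun q : ℝ × V2 => H q.1 q.2) ∧
    H 0 = id ∧ H 1 = φ ∧
    ∀ t, IsHomeomorph (H t) ∧ ∀ p, H t (Tmap p) = Tmap (H t p)) ∧
  (∀ p, 0 < fderiv ℝ (fun q => (φ q).1) p (0, 1)) ∧
  (∃ S : V2 → ℝ, ContDiff ℝ 1 S ∧ (∀ p, S (Tmap p) = S p) ∧
    ∀ p, fderiv ℝ S p (1, 0) = (φ p).2 * fderiv ℝ (fun q => (φ q).1) p (1, 0) - p.2 ∧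
      fderiv ℝ S p (0, 1) = (φ p).2 * fderiv ℝ (fun q => (φ q).1) p (0, 1))

/-- `φ ∈ 𝒫¹`: `φ` is a finite composition of lifts of positive monotone twist maps. -/
def MemP1 (φ : V2 → V2) : Prop :=
  ∃ l : List (V2 → V2), l ≠ [] ∧ (∀ f ∈ l, IsPosTwistLift f) ∧
    φ = l.foldr (· ∘ ·) id


/-- Lipschitz condition with a real constant. -/
def Lip (Λ : ℝ) (η : ℝ → ℝ) : Prop := ∀ x x', |η x' - η x| ≤ Λ * |x' - x|

lemma Lip.continuous {Λ : ℝ} {η : ℝ → ℝ} (h : Lip Λ η) : Continuous η := by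
  have : LipschitzWith Λ.toNNReal η := by
    refine LipschitzWith.of_dist_le_mul fun x y => ?_
    rw [Real.dist_eq, Real.dist_eq]
    exact (h y x).trans (mul_le_mul_of_nonneg_right (Real.le_coe_toNNReal Λ) (abs_nonneg _))
  exact this.continuous

lemma Lip.mono {Λ Λ' : ℝ} {η : ℝ → ℝ} (h : Lip Λ η) (hΛ : Λ ≤ Λ') : Lip Λ' η := fun x x' =>
  (h x x').trans (mul_le_mul_of_nonneg_right hΛ (abs_nonneg _))

lemma Lip.nonneg {Λ : ℝ} {η : ℝ → ℝ} (h : Lip Λ η) : 0 ≤ Λ := by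
  have := h 0 1
  norm_num at this
  exact (abs_nonneg _).trans this

/-- A function with locally small increments is antitone. -/
lemma antitone_of_local {f : ℝ → ℝ}
    (h : ∀ ε > 0, ∃ δ > 0, ∀ x x', x ≤ x' → x' - x ≤ δ → f x' ≤ f x + ε * (x' - x)) :
    Antitone f := by
  intro a b hab
  refine le_of_forall_pos_le_add fun e he => ?_
  obtain ⟨δ, hδ, H⟩ := h (e / (b - a + 1)) (div_pos he (by linarith))
  obtain ⟨n, hn⟩ := exists_nat_gt ((b - a) / δ)
  have hn0 : (0 : ℝ) < n := lt_of_le_of_lt (div_nonneg (by linarith) hδ.le) hn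
  have key : ∀ k : ℕ, f (a + k * ((b - a) / n)) ≤ f a + e / (b - a + 1) * (k * ((b - a) / n)) := by
    intro k
    induction k with
    | zero => simp
    | succ k ih =>
      have hs : 0 ≤ (b - a) / n := div_nonneg (by linarith) hn0.le
      have h2 : (b - a) / n ≤ δ := by
        rw [div_le_iff₀ hn0]
        rw [div_lt_iff₀ hδ] at hn
        linarith
      have := H (a + k * ((b - a) / n)) (a + (k + 1 : ℕ) * ((b - a) / n))
        (by push_cast; linarith) (by push_cast; linarith)
      push_cast at this ⊢
      nlinarith
  have := key n
  have e1 : (n : ℝ) * ((b - a) / n) = b - a := by field_simp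
  rw [e1] at this
  have e2 : e / (b - a + 1) * (b - a) ≤ e := by
    rw [div_mul_eq_mul_div, div_le_iff₀ (by linarith)]
    nlinarith
  have e3 : a + (b - a) = b := by ring
  rw [e3] at this
  linarith

lemma Lip_of_local {f : ℝ → ℝ} {r K : ℝ} (hr : 0 < r)
    (h : ∀ x x', |x' - x| ≤ r → f x' ≤ f x + K * |x' - x|) : Lip K f := by
  have h1 : Antitone fun x => f x - K * x := by
    refine antitone_of_local fun ε hε => ⟨r, hr, fun x x' hx hx' => ?_⟩
    have := h x x' (by rw [abs_of_nonneg] <;> linarith)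
    rw [abs_of_nonneg (by linarith)] at this
    have : 0 ≤ ε * (x' - x) := mul_nonneg hε.le (by linarith)
    linarith
  have h2 : Antitone fun x => - f x - K * x := by
    refine antitone_of_local fun ε hε => ⟨r, hr, fun x x' hx hx' => ?_⟩
    have := h x' x (by rw [abs_sub_comm, abs_of_nonneg] <;> linarith)
    rw [abs_sub_comm, abs_of_nonneg (by linarith)] at this
    have : 0 ≤ ε * (x' - x) := mul_nonneg hε.le (by linarith)
    linarith
  have key : ∀ x x', x ≤ x' → |f x' - f x| ≤ K * |x' - x| := by
    intro x x' hx
    have a1 := h1 hx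
    have a2 := h2 hx
    simp only at a1 a2
    rw [abs_of_nonneg (show 0 ≤ x' - x by linarith), abs_le]
    constructor <;> linarith
  intro x x'
  rcases le_total x x' with hx | hx
  · exact key x x' hx
  · rw [abs_sub_comm, abs_sub_comm x']
    exact key x' x hx

/-- The Lax–Oleinik operator structure attached to an exact symplectic map. -/
structure IsLaxOleinik (φ : V2 → V2) (T : (ℝ → ℝ) → ℝ → ℝ) : Prop where
  shift : ∀ η, (∃ Λ, Lip Λ η) → T (fun x => η (x + 1)) = fun X => T η (X + 1)
  main : ∀ Λ : ℝ, ∃ (R Λ' : ℝ) (r : ℝ → ℝ), (∀ ε > 0, 0 < r ε) ∧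
    ∀ η, Lip Λ η → Lip Λ' (T η) ∧ ∀ X, ∃ x y Y, |x - X| ≤ R ∧ φ (x, y) = (X, Y) ∧
      (∀ ε > 0, ∀ᶠ x' in 𝓝 x, η x + y * (x' - x) - ε * |x' - x| ≤ η x') ∧
      ∀ ζ, (∃ Λ, Lip Λ ζ) → ∀ ε > 0, ∀ X', |X' - X| ≤ r ε →
        T ζ X' ≤ ζ x - η x + T η X + Y * (X' - X) + ε * |X' - X|

/-- The analytic data of a twist map with generating function. -/
structure TwistData (f : V2 → V2) (S : V2 → ℝ) : Prop where
  cf : ContDiff ℝ 1 f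
  cS : ContDiff ℝ 1 S
  inv : ∃ g : V2 → V2, Continuous g ∧ Function.LeftInverse g f ∧ Function.RightInverse g f
  fT : ∀ p, f (Tmap p) = Tmap (f p)
  ST : ∀ p, S (Tmap p) = S p
  pos : ∀ p, 0 < fderiv ℝ (fun q => (f q).1) p (0, 1)
  eq1 : ∀ p, fderiv ℝ S p (1, 0) = (f p).2 * fderiv ℝ (fun q => (f q).1) p (1, 0) - p.2
  eq2 : ∀ p, fderiv ℝ S p (0, 1) = (f p).2 * fderiv ℝ (fun q => (f q).1) p (0, 1)

lemma periodic_int {F : V2 → ℝ} (hT : ∀ p, F (Tmap p) = F p) (n : ℤ) (x y : ℝ) :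
    F (x + n, y) = F (x, y) := by
  have : Function.Periodic (fun x => F (x, y)) 1 := fun x => hT (x, y)
  have := this.int_mul n x
  simpa using this

lemma periodic_bdd {F : V2 → ℝ} (hc : Continuous F) (hT : ∀ p, F (Tmap p) = F p) (Λ : ℝ) :
    ∃ C, ∀ x y, |y| ≤ Λ → |F (x, y)| ≤ C := by
  obtain ⟨C, hC⟩ := ((isCompact_Icc (a := (0 : ℝ)) (b := 1)).prod
    (isCompact_Icc (a := -Λ) (b := Λ))).exists_bound_of_continuousOn hc.continuousOn
  refine ⟨C, fun x y hy => ?_⟩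
  have := hC (Int.fract x, y) ⟨⟨Int.fract_nonneg x, (Int.fract_lt_one x).le⟩, abs_le.1 hy⟩
  rw [← periodic_int hT ⌊x⌋, Int.fract_add_floor] at this
  exact this

namespace TwistData

variable {f : V2 → V2} {S : V2 → ℝ} (h : TwistData f S)
include h

lemma cX : ContDiff ℝ 1 fun q => (f q).1 := contDiff_fst.comp h.cf

lemma fd (p : V2) : HasFDerivAt (fun q => (f q).1) (fderiv ℝ (fun q => (f q).1) p) p :=
  (h.cX.differentiable one_ne_zero p).hasFDerivAt

lemma fdS (p : V2) : HasFDerivAt S (fderiv ℝ S p) p :=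
  (h.cS.differentiable one_ne_zero p).hasFDerivAt

lemma dy (x y : ℝ) : HasDerivAt (fun y => (f (x, y)).1)
    (fderiv ℝ (fun q => (f q).1) (x, y) (0, 1)) y := by
  have h1 : HasDerivAt (fun y : ℝ => ((x, y) : V2)) (0, 1) y :=
    (hasDerivAt_const y x).prodMk (hasDerivAt_id y)
  exact (h.fd (x, y)).comp_hasDerivAt y h1

lemma dyS (x y : ℝ) : HasDerivAt (fun y => S (x, y)) (fderiv ℝ S (x, y) (0, 1)) y := by
  have h1 : HasDerivAt (fun y : ℝ => ((x, y) : V2)) (0, 1) y :=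
    (hasDerivAt_const y x).prodMk (hasDerivAt_id y)
  exact (h.fdS (x, y)).comp_hasDerivAt y h1

lemma mono (x : ℝ) : StrictMono fun y => (f (x, y)).1 :=
  strictMono_of_hasDerivAt_pos (fun y => h.dy x y) fun y => h.pos (x, y)

lemma X_add_one (x y : ℝ) : (f (x + 1, y)).1 = (f (x, y)).1 + 1 :=
  congrArg Prod.fst (h.fT (x, y))

lemma X_add_int (n : ℤ) (x y : ℝ) : (f (x + n, y)).1 = (f (x, y)).1 + n := by
  have := periodic_int (F := fun p => (f p).1 - p.1)
    (fun p => by rw [h.fT p]; simp only [Tmap]; ring) n x y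
  simp only at this
  linarith

lemma Y_add_int (n : ℤ) (x y : ℝ) : (f (x + n, y)).2 = (f (x, y)).2 :=
  periodic_int (F := fun p => (f p).2) (fun p => by rw [h.fT p]; simp only [Tmap]) n x y

lemma S_add_int (n : ℤ) (x y : ℝ) : S (x + n, y) = S (x, y) := periodic_int h.ST n x y

lemma contX : Continuous fun p : V2 => (f p).1 := h.cX.continuous

lemma bddX (Λ : ℝ) : ∃ R, ∀ x y, |y| ≤ Λ → |x - (f (x, y)).1| ≤ R :=
  periodic_bdd (F := fun p => p.1 - (f p).1) (continuous_fst.sub h.contX)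
    (fun p => by rw [h.fT p]; simp only [Tmap]; ring) Λ

lemma bddY (Λ : ℝ) : ∃ C, ∀ x y, |y| ≤ Λ → |(f (x, y)).2| ≤ C :=
  periodic_bdd (F := fun p => (f p).2) (continuous_snd.comp h.cf.continuous)
    (fun p => by rw [h.fT p]; simp only [Tmap]) Λ

lemma fiber_ordConnected (X0 : ℝ) : Set.OrdConnected {x : ℝ | ∃ y, (f (x, y)).1 = X0} := by
  obtain ⟨g, gc, gl, gr⟩ := h.inv
  have : {x : ℝ | ∃ y, (f (x, y)).1 = X0} = (fun Y : ℝ => (g (X0, Y)).1) '' Set.univ := by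
    ext x
    constructor
    · rintro ⟨y, rfl⟩
      exact ⟨(f (x, y)).2, trivial, by simp [gl (x, y)]⟩
    · rintro ⟨Y, -, rfl⟩
      exact ⟨(g (X0, Y)).2, by simp [gr (X0, Y)]⟩
  rw [this]
  refine IsPreconnected.ordConnected (isPreconnected_univ.image _ ?_)
  exact (continuous_fst.comp (gc.comp (by fun_prop))).continuousOn

lemma exists_fiber (X0 y : ℝ) : ∃ x, (f (x, y)).1 = X0 := by
  have hc : Continuous fun x => (f (x, y)).1 := h.contX.comp (by fun_prop)
  obtain ⟨n, hn⟩ := exists_int_lt (X0 - (f (0, y)).1)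
  obtain ⟨m, hm⟩ := exists_int_gt (X0 - (f (0, y)).1)
  have h1 := h.X_add_int n 0 y
  have h2 := h.X_add_int m 0 y
  rw [zero_add] at h1 h2
  obtain ⟨x, hx⟩ := mem_range_of_exists_le_of_exists_ge hc (c := X0)
    ⟨n, by linarith⟩ ⟨m, by linarith⟩
  exact ⟨x, hx⟩

/-- First order variation of the generating function along the fibre. -/
lemma fiber_variation (x y ε : ℝ) (hε : 0 < ε) : ∀ᶠ x' in 𝓝 x, ∃ y',
    (f (x', y')).1 = (f (x, y)).1 ∧ |S (x', y') - S (x, y) + y * (x' - x)| ≤ ε * |x' - x| := by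
  set α := fderiv ℝ (fun q => (f q).1) (x, y) (1, 0) with hα
  set β := fderiv ℝ (fun q => (f q).1) (x, y) (0, 1) with hβ
  have hβ0 : 0 < β := h.pos (x, y)
  set Y := (f (x, y)).2 with hY
  set C := 2 * |α| / β + 1 with hC
  have hC1 : 1 ≤ C := by
    have : 0 ≤ 2 * |α| / β := by positivity
    linarith
  obtain ⟨κ, hκ, hκ1, hκ2⟩ : ∃ κ > 0, κ * C ≤ β / 2 ∧ κ * C * (1 + |Y|) ≤ ε := by
    refine ⟨min (β / 2) (ε / (1 + |Y|)) / C, by positivity, ?_, ?_⟩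
    · rw [div_mul_cancel₀ _ (by positivity)]
      exact min_le_left _ _
    · rw [div_mul_cancel₀ _ (by positivity)]
      calc _ ≤ ε / (1 + |Y|) * (1 + |Y|) := by gcongr; exact min_le_right _ _
        _ = ε := div_mul_cancel₀ _ (by positivity)
  have lin : ∀ (L : V2 →L[ℝ] ℝ) (s t : ℝ), L (s, t) = s * L (1, 0) + t * L (0, 1) := by
    intro L s t
    have : ((s, t) : V2) = s • (1, 0) + t • (0, 1) := by simp
    rw [this, map_add, map_smul, map_smul]
    simp
  have e1 := (h.fd (x, y)).isLittleO.def hκ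
  have e2 := (h.fdS (x, y)).isLittleO.def hκ
  obtain ⟨δ, hδ, H⟩ := Metric.eventually_nhds_iff.1 (e1.and e2)
  have : ∀ᶠ x' in 𝓝 x, |x' - x| < δ / C := by
    have := Metric.ball_mem_nhds x (show 0 < δ / C by positivity)
    filter_upwards [this] with x' hx'
    rwa [Metric.mem_ball, Real.dist_eq] at hx'
  filter_upwards [this] with x' hx'
  set t := x' - x with ht
  have hCt : C * |t| < δ := by
    rw [lt_div_iff₀ (by positivity)] at hx'
    linarith
  have bd : ∀ v, |v| ≤ C * |t| →
      |(f (x', y + v)).1 - (f (x, y)).1 - (t * α + v * β)| ≤ κ * (C * |t|) ∧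
      |S (x', y + v) - S (x, y) - (t * (Y * α - y) + v * (Y * β))| ≤ κ * (C * |t|) := by
    intro v hv
    have hn : ‖((x', y + v) : V2) - (x, y)‖ ≤ C * |t| := by
      rw [Prod.norm_def]
      simp only [Prod.fst_sub, Prod.snd_sub, Real.norm_eq_abs, add_sub_cancel_left]
      exact max_le (by nlinarith [abs_nonneg t]) hv
    have hd : dist ((x', y + v) : V2) (x, y) < δ := by
      rw [dist_eq_norm]
      linarith
    obtain ⟨a, b⟩ := H hd
    have hsub : ((x', y + v) : V2) - (x, y) = (t, v) := by simp [ht]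
    rw [hsub] at a b hn
    rw [lin] at a b
    have q1 := h.eq1 (x, y)
    have q2 := h.eq2 (x, y)
    simp only at q1 q2
    rw [q1, q2] at b
    simp only [Real.norm_eq_abs] at a b
    exact ⟨a.trans (by gcongr), b.trans (by gcongr)⟩
  have hct : 0 ≤ C * |t| := by positivity
  have hβC : β * (C * |t|) = 2 * |α| * |t| + β * |t| := by
    rw [hC]; field_simp
  have hta : |t * α| = |α| * |t| := by rw [abs_mul, mul_comm]
  have hκt : κ * (C * |t|) ≤ β / 2 * |t| := by
    rw [← mul_assoc]; gcongr
  have h0 : 0 ≤ |α| * |t| := by positivity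
  have h0' : 0 ≤ β * |t| := by positivity
  have iv : ∃ v ∈ Set.Icc (-(C * |t|)) (C * |t|), (f (x', y + v)).1 = (f (x, y)).1 := by
    have hc : ContinuousOn (fun v => (f (x', y + v)).1) (Set.Icc (-(C * |t|)) (C * |t|)) :=
      (h.contX.comp (by fun_prop)).continuousOn
    refine intermediate_value_Icc (by linarith) hc ⟨?_, ?_⟩
    · have := (bd (-(C * |t|)) (by rw [abs_neg, abs_of_nonneg hct])).1
      have := (abs_le.1 this).2
      have := (abs_le.1 hta.le).2
      nlinarith
    · have := (bd (C * |t|) (by rw [abs_of_nonneg hct])).1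
      have := (abs_le.1 this).1
      have := (abs_le.1 hta.le).1
      nlinarith
  obtain ⟨v, hv, hvX⟩ := iv
  refine ⟨y + v, hvX, ?_⟩
  obtain ⟨a, b⟩ := bd v (abs_le.2 hv)
  rw [hvX, sub_self, zero_sub, abs_neg] at a
  have : S (x', y + v) - S (x, y) + y * t =
      (S (x', y + v) - S (x, y) - (t * (Y * α - y) + v * (Y * β))) + Y * (t * α + v * β) := by ring
  rw [this]
  calc _ ≤ _ := abs_add_le _ _
    _ ≤ κ * (C * |t|) + |Y| * (κ * (C * |t|)) := by
      rw [abs_mul]; gcongr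
    _ = κ * C * (1 + |Y|) * |t| := by ring
    _ ≤ _ := by gcongr

end TwistData

/-- Along a fibre over an interval the generating function has derivative `-y`. -/
lemma TwistData.fiber_le {f : V2 → V2} {S : V2 → ℝ} (h : TwistData f S) {X0 a b : ℝ} (_hab : a ≤ b)
    {y : ℝ → ℝ} (hy : ∀ s ∈ Set.Icc a b, (f (s, y s)).1 = X0) :
    ∀ s ∈ Set.Icc a b,
      HasDerivWithinAt (fun s => S (s, y s)) (- y s) (Set.Icc a b) s := by
  intro s hs
  rw [hasDerivWithinAt_iff_isLittleO, Asymptotics.isLittleO_iff]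
  intro ε hε
  filter_upwards [(h.fiber_variation s (y s) ε hε).filter_mono nhdsWithin_le_nhds,
    self_mem_nhdsWithin] with x' hx' hx'm
  obtain ⟨y', h1, h2⟩ := hx'
  have : y' = y x' := (h.mono x').injective (by rw [h1, hy s hs, hy x' hx'm])
  subst this
  rw [Real.norm_eq_abs, Real.norm_eq_abs, smul_eq_mul]
  convert h2 using 2
  ring

namespace TwistData
variable {f : V2 → V2} {S : V2 → ℝ} (h : TwistData f S)
include h

lemma exists_fiber_fun {X0 a b ya yb : ℝ} (ha : (f (a, ya)).1 = X0) (hb : (f (b, yb)).1 = X0) :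
    ∃ y : ℝ → ℝ, ∀ s ∈ Set.Icc a b, (f (s, y s)).1 = X0 := by
  have : ∀ s, ∃ y, s ∈ Set.Icc a b → (f (s, y)).1 = X0 := by
    intro s
    by_cases hs : s ∈ Set.Icc a b
    · obtain ⟨y, hy⟩ := (h.fiber_ordConnected X0).out ⟨ya, ha⟩ ⟨yb, hb⟩ hs
      exact ⟨y, fun _ => hy⟩
    · exact ⟨0, fun h => absurd h hs⟩
  choose y hy using this
  exact ⟨y, hy⟩

/-- Points of a fibre with a large ordinate can be improved. -/
lemma improve {Λ : ℝ} {η : ℝ → ℝ} (hη : Lip Λ η) (x y : ℝ) :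
    ∃ x' y', (f (x', y')).1 = (f (x, y)).1 ∧ |y'| ≤ Λ ∧
      η x' + S (x', y') ≤ η x + S (x, y) := by
  have hΛ := hη.nonneg
  rcases lt_or_ge Λ y with hy | hy
  · set X0 := (f (x, y)).1 with hX0
    have hc : Continuous fun s => (f (s, Λ)).1 := h.contX.comp (by fun_prop)
    have h1 : (f (x, Λ)).1 < X0 := h.mono x hy
    obtain ⟨n, hn⟩ := exists_nat_gt (X0 - (f (x, Λ)).1)
    have h2 := h.X_add_int n x Λ
    set P : Set ℝ := Set.Icc x (x + n) ∩ {s | X0 ≤ (f (s, Λ)).1} with hP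
    have hPc : IsCompact P := isCompact_Icc.inter_right (isClosed_le continuous_const hc)
    have hPn : P.Nonempty := by
      refine ⟨x + n, ⟨by simp, le_rfl⟩, ?_⟩
      simp only [Set.mem_ofPred_eq]
      push_cast at h2
      linarith
    obtain ⟨b, hb, hbmin⟩ := hPc.exists_isLeast hPn
    have hlt : ∀ s, x ≤ s → s < b → (f (s, Λ)).1 < X0 := by
      intro s hs hsb
      by_contra hcon
      push Not at hcon
      have := hbmin ⟨⟨hs, hsb.le.trans hb.1.2⟩, hcon⟩
      linarith
    have hxb : x < b := by
      rcases hb.1.1.lt_or_eq with q | q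
      · exact q
      · exfalso
        have := hb.2
        rw [← q] at this
        simp only [Set.mem_ofPred_eq] at this
        linarith
    have hbX : (f (b, Λ)).1 = X0 := by
      refine le_antisymm ?_ hb.2
      have : b ∈ closure (Set.Ico x b) := by
        rw [closure_Ico hxb.ne]; exact ⟨hxb.le, le_rfl⟩
      refine closure_minimal (t := {s | (f (s, Λ)).1 ≤ X0}) ?_ (isClosed_le hc continuous_const) this
      exact fun s hs => (hlt s hs.1 hs.2).le
    obtain ⟨Yf, hYf⟩ := h.exists_fiber_fun hX0.symm hbX
    have hd := h.fiber_le hxb.le hYf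
    have hge : ∀ s ∈ Set.Icc x b, Λ ≤ Yf s := by
      intro s hs
      by_contra hcon
      push Not at hcon
      have h3 := h.mono s hcon
      simp only at h3
      rw [hYf s hs] at h3
      rcases hs.2.lt_or_eq with q | q
      · linarith [hlt s hs.1 q]
      · rw [q, hbX] at h3; linarith
    have hx : Yf x = y := (h.mono x).injective (hYf x ⟨le_rfl, hxb.le⟩)
    have hbΛ : Yf b = Λ := (h.mono b).injective
      (by rw [hbX]; exact hYf b ⟨hxb.le, le_rfl⟩)
    have key : S (b, Yf b) - S (x, Yf x) ≤ -Λ * (b - x) := by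
      refine (convex_Icc x b).image_sub_le_mul_sub_of_deriv_le (f := fun s => S (s, Yf s))
        (fun s hs => (hd s hs).continuousWithinAt) ?_ ?_ x ⟨le_rfl, hxb.le⟩ b ⟨hxb.le, le_rfl⟩ hxb.le
      · intro s hs
        exact ((hd s (interior_subset hs)).mono interior_subset).differentiableWithinAt
      · intro s hs
        have := (hd s (interior_subset hs)).hasDerivAt (mem_interior_iff_mem_nhds.1 hs)
        rw [this.deriv]
        linarith [hge s (interior_subset hs)]
    refine ⟨b, Λ, hbX, by rw [abs_of_nonneg hΛ], ?_⟩
    rw [hx, hbΛ] at key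
    have := (abs_le.1 (hη x b)).2
    rw [abs_of_pos (by linarith)] at this
    linarith
  rcases lt_or_ge y (-Λ) with hy' | hy'
  · set X0 := (f (x, y)).1 with hX0
    have hc : Continuous fun s => (f (s, -Λ)).1 := h.contX.comp (by fun_prop)
    have h1 : X0 < (f (x, -Λ)).1 := h.mono x hy'
    obtain ⟨n, hn⟩ := exists_nat_gt ((f (x, -Λ)).1 - X0)
    have h2 := h.X_add_int (-n) x (-Λ)
    set P : Set ℝ := Set.Icc (x - n) x ∩ {s | (f (s, -Λ)).1 ≤ X0} with hP
    have hPc : IsCompact P := isCompact_Icc.inter_right (isClosed_le hc continuous_const)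
    have hPn : P.Nonempty := by
      refine ⟨x - n, ⟨le_rfl, by simp⟩, ?_⟩
      simp only [Set.mem_ofPred_eq]
      push_cast at h2
      rw [← sub_eq_add_neg] at h2
      linarith
    obtain ⟨b, hb, hbmin⟩ := hPc.exists_isGreatest hPn
    have hlt : ∀ s, s ≤ x → b < s → X0 < (f (s, -Λ)).1 := by
      intro s hs hsb
      by_contra hcon
      push Not at hcon
      have := hbmin ⟨⟨hb.1.1.trans hsb.le, hs⟩, hcon⟩
      linarith
    have hxb : b < x := by
      rcases hb.1.2.lt_or_eq with q | q
      · exact q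
      · exfalso
        have := hb.2
        rw [q] at this
        simp only [Set.mem_ofPred_eq] at this
        linarith
    have hbX : (f (b, -Λ)).1 = X0 := by
      refine le_antisymm hb.2 ?_
      have : b ∈ closure (Set.Ioc b x) := by
        rw [closure_Ioc hxb.ne]; exact ⟨le_rfl, hxb.le⟩
      refine closure_minimal (t := {s | X0 ≤ (f (s, -Λ)).1}) ?_ (isClosed_le continuous_const hc) this
      exact fun s hs => (hlt s hs.2 hs.1).le
    obtain ⟨Yf, hYf⟩ := h.exists_fiber_fun hbX hX0.symm
    have hd := h.fiber_le hxb.le hYf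
    have hge : ∀ s ∈ Set.Icc b x, Yf s ≤ -Λ := by
      intro s hs
      by_contra hcon
      push Not at hcon
      have h3 := h.mono s hcon
      simp only at h3
      rw [hYf s hs] at h3
      rcases hs.1.lt_or_eq with q | q
      · linarith [hlt s hs.2 q]
      · rw [← q, hbX] at h3; linarith
    have hx : Yf x = y := (h.mono x).injective (hYf x ⟨hxb.le, le_rfl⟩)
    have hbΛ : Yf b = -Λ := (h.mono b).injective
      (by rw [hbX]; exact hYf b ⟨le_rfl, hxb.le⟩)
    have key : Λ * (x - b) ≤ S (x, Yf x) - S (b, Yf b) := by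
      refine (convex_Icc b x).mul_sub_le_image_sub_of_le_deriv (f := fun s => S (s, Yf s))
        (fun s hs => (hd s hs).continuousWithinAt) ?_ ?_ b ⟨le_rfl, hxb.le⟩ x ⟨hxb.le, le_rfl⟩ hxb.le
      · intro s hs
        exact ((hd s (interior_subset hs)).mono interior_subset).differentiableWithinAt
      · intro s hs
        have := (hd s (interior_subset hs)).hasDerivAt (mem_interior_iff_mem_nhds.1 hs)
        rw [this.deriv]
        linarith [hge s (interior_subset hs)]
    refine ⟨b, -Λ, hbX, by rw [abs_neg, abs_of_nonneg hΛ], ?_⟩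
    rw [hx, hbΛ] at key
    have := (abs_le.1 (hη x b)).2
    rw [abs_of_neg (by linarith)] at this
    linarith
  · exact ⟨x, y, rfl, abs_le.2 ⟨hy', hy⟩, le_rfl⟩

lemma exists_min {Λ : ℝ} {η : ℝ → ℝ} (hη : Lip Λ η) (X0 : ℝ) :
    ∃ x y, (f (x, y)).1 = X0 ∧ |y| ≤ Λ ∧
      ∀ x' y', (f (x', y')).1 = X0 → η x + S (x, y) ≤ η x' + S (x', y') := by
  obtain ⟨R, hR⟩ := h.bddX Λ
  set P : Set V2 := (Set.Icc (X0 - R) (X0 + R) ×ˢ Set.Icc (-Λ) Λ) ∩ {p | (f p).1 = X0} with hP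
  have hPc : IsCompact P := (isCompact_Icc.prod isCompact_Icc).inter_right
    (isClosed_eq h.contX continuous_const)
  have memP : ∀ x y, (f (x, y)).1 = X0 → |y| ≤ Λ → (x, y) ∈ P := by
    intro x y hX hy
    have := abs_le.1 (hR x y hy)
    rw [hX] at this
    exact ⟨⟨⟨by linarith, by linarith⟩, abs_le.1 hy⟩, hX⟩
  have hPn : P.Nonempty := by
    obtain ⟨x, hx⟩ := h.exists_fiber X0 0
    exact ⟨(x, 0), memP x 0 hx (by simpa using hη.nonneg)⟩
  have hc : Continuous fun p : V2 => η p.1 + S p :=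
    (hη.continuous.comp continuous_fst).add h.cS.continuous
  obtain ⟨⟨x, y⟩, hp, hmin⟩ := hPc.exists_isMinOn hPn hc.continuousOn
  refine ⟨x, y, hp.2, abs_le.2 hp.1.2, fun x' y' hx' => ?_⟩
  obtain ⟨x2, y2, h1, h2, h3⟩ := h.improve hη x' y'
  exact le_trans (hmin (memP x2 y2 (h1.trans hx') h2)) h3

lemma fiber_end_variation (Λ : ℝ) : ∃ r : ℝ → ℝ, (∀ ε > 0, 0 < r ε) ∧
    ∀ x y, |y| ≤ Λ → ∀ ε > 0, ∀ X', |X' - (f (x, y)).1| ≤ r ε → ∃ y', (f (x, y')).1 = X' ∧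
      S (x, y') ≤ S (x, y) + (f (x, y)).2 * (X' - (f (x, y)).1) +
        ε * |X' - (f (x, y)).1| := by
  have hβc : Continuous fun p : V2 => fderiv ℝ (fun q => (f q).1) p (0, 1) :=
    (h.cX.continuous_fderiv one_ne_zero).clm_apply continuous_const
  have hK : IsCompact (Set.Icc (0 : ℝ) 1 ×ˢ Set.Icc (-(|Λ| + 1)) (|Λ| + 1)) :=
    isCompact_Icc.prod isCompact_Icc
  obtain ⟨p0, hp0, hmin⟩ := hK.exists_isMinOn
    ⟨(0, 0), ⟨by simp, ⟨by have := abs_nonneg Λ; show -(|Λ| + 1) ≤ (0 : ℝ); linarith,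
      by have := abs_nonneg Λ; show (0 : ℝ) ≤ |Λ| + 1; linarith⟩⟩⟩ hβc.continuousOn
  set b := fderiv ℝ (fun q => (f q).1) p0 (0, 1) with hb
  have hb0 : 0 < b := h.pos p0
  have huc := hK.uniformContinuousOn_of_continuous
    (continuous_snd.comp h.cf.continuous).continuousOn
  rw [Metric.uniformContinuousOn_iff] at huc
  have : ∀ ε : ℝ, ∃ s, 0 < s ∧ s ≤ 1 ∧ (0 < ε → ∀ x ∈ Set.Icc (0 : ℝ) 1, ∀ y y', |y| ≤ Λ →
      |y' - y| ≤ s → |(f (x, y')).2 - (f (x, y)).2| ≤ ε) := by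
    intro ε
    by_cases hε : 0 < ε
    · obtain ⟨δ, hδ, H⟩ := huc ε hε
      refine ⟨min (δ / 2) 1, by positivity, min_le_right _ _, fun _ x hx y y' hy hyy => ?_⟩
      have hy1 := abs_le.1 hy
      have hy2 := abs_le.1 (hyy.trans (min_le_right _ _))
      have hl := le_abs_self Λ
      have := H (x, y') ⟨hx, ⟨by simp only; linarith, by simp only; linarith⟩⟩ (x, y)
        ⟨hx, ⟨by simp only; linarith, by simp only; linarith⟩⟩ (by
          rw [Prod.dist_eq, dist_self, Real.dist_eq]
          refine max_lt hδ ?_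
          have := hyy.trans (min_le_left _ _)
          linarith)
      rw [Real.dist_eq] at this
      exact this.le
    · exact ⟨1, one_pos, le_rfl, fun h => absurd h hε⟩
  choose s hs0 hs1 hs using this
  refine ⟨fun ε => b * s ε, fun ε _ => mul_pos hb0 (hs0 ε), ?_⟩
  have key : ∀ x ∈ Set.Icc (0 : ℝ) 1, ∀ y, |y| ≤ Λ → ∀ ε > 0, ∀ X',
      |X' - (f (x, y)).1| ≤ b * s ε → ∃ y', (f (x, y')).1 = X' ∧
      S (x, y') ≤ S (x, y) + (f (x, y)).2 * (X' - (f (x, y)).1) +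
        ε * |X' - (f (x, y)).1| := by
    intro x hx y hy ε hε X' hX'
    have hy1 := abs_le.1 hy
    have hl := le_abs_self Λ
    have hgrow : ∀ y1 ∈ Set.Icc (y - 1) (y + 1), ∀ y2 ∈ Set.Icc (y - 1) (y + 1), y1 ≤ y2 →
        b * (y2 - y1) ≤ (f (x, y2)).1 - (f (x, y1)).1 := by
      refine (convex_Icc (y - 1) (y + 1)).mul_sub_le_image_sub_of_le_deriv
        (f := fun y => (f (x, y)).1)
        (fun t _ => (h.dy x t).continuousAt.continuousWithinAt)
        (fun t _ => (h.dy x t).differentiableAt.differentiableWithinAt) ?_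
      intro t ht
      have ht' := interior_subset ht
      rw [(h.dy x t).deriv]
      exact hmin (show (x, t) ∈ _ from ⟨hx, ⟨by simp only; linarith [ht'.1], by
        simp only; linarith [ht'.2]⟩⟩)
    have hsp := hs0 ε
    have hs1' := hs1 ε
    have hc : Continuous fun t => (f (x, t)).1 := h.contX.comp (by fun_prop)
    have hX2 := abs_le.1 hX'
    have g1 := hgrow (y - s ε) ⟨by linarith, by linarith⟩ y ⟨by linarith, by linarith⟩ (by linarith)
    have g2 := hgrow y ⟨by linarith, by linarith⟩ (y + s ε) ⟨by linarith, by linarith⟩ (by linarith)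
    obtain ⟨y', hy', hX'e⟩ := intermediate_value_Icc (show y - s ε ≤ y + s ε by linarith)
      hc.continuousOn (show X' ∈ Set.Icc _ _ from ⟨by linarith, by linarith⟩)
    simp only at hX'e
    refine ⟨y', hX'e, ?_⟩
    have hYle : ∀ t, |t - y| ≤ |y' - y| → |(f (x, t)).2 - (f (x, y)).2| ≤ ε := by
      intro t ht
      refine hs ε hε x hx y t hy (ht.trans (abs_le.2 ⟨by linarith [hy'.1], by linarith [hy'.2]⟩))
    have dS : ∀ t, HasDerivAt (fun t => S (x, t))
        ((f (x, t)).2 * fderiv ℝ (fun q => (f q).1) (x, t) (0, 1)) t := by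
      intro t
      have := h.dyS x t
      rwa [h.eq2] at this
    have cauchy : ∀ a b', a < b' → ∃ t ∈ Set.Ioo a b',
        S (x, b') - S (x, a) = (f (x, t)).2 * ((f (x, b')).1 - (f (x, a)).1) := by
      intro a b' hab
      obtain ⟨t, ht, he⟩ := exists_ratio_hasDerivAt_eq_ratio_slope (fun t => S (x, t)) _ hab
        (fun t _ => (dS t).continuousAt.continuousWithinAt) (fun t _ => dS t)
        (fun t => (f (x, t)).1) _
        (fun t _ => (h.dy x t).continuousAt.continuousWithinAt) (fun t _ => h.dy x t)
      refine ⟨t, ht, ?_⟩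
      have hp := h.pos (x, t)
      refine mul_right_cancel₀ hp.ne' ?_
      linear_combination -he
    rcases lt_trichotomy y y' with hlt | heq | hlt
    · obtain ⟨t, ht, he⟩ := cauchy y y' hlt
      have := hYle t (by
        rw [abs_of_pos (by linarith [ht.1]), abs_of_pos (by linarith)]; linarith [ht.2])
      rw [hX'e] at he
      have hpos : 0 ≤ X' - (f (x, y)).1 := by
        have := h.mono x hlt
        simp only at this
        linarith
      rw [abs_of_nonneg hpos]
      have := (abs_le.1 this).2
      nlinarith
    · subst heq
      rw [hX'e]; simp
    · obtain ⟨t, ht, he⟩ := cauchy y' y hlt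
      have := hYle t (by
        rw [abs_of_neg (by linarith [ht.2]), abs_of_neg (by linarith)]; linarith [ht.1])
      rw [hX'e] at he
      have hpos : X' - (f (x, y)).1 ≤ 0 := by
        have := h.mono x hlt
        simp only at this
        linarith
      rw [abs_of_nonpos hpos]
      have := (abs_le.1 this).1
      nlinarith
  intro x y hy ε hε X' hX'
  have e1 := h.X_add_int ⌊x⌋ (Int.fract x)
  have e2 := h.Y_add_int ⌊x⌋ (Int.fract x)
  have e3 := h.S_add_int ⌊x⌋ (Int.fract x)
  rw [Int.fract_add_floor] at e1 e2 e3
  have e4 : X' - (f (x, y)).1 = X' - ⌊x⌋ - (f (Int.fract x, y)).1 := by rw [e1]; ring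
  rw [e4] at hX'
  obtain ⟨y', h1, h2⟩ := key (Int.fract x) ⟨Int.fract_nonneg x, (Int.fract_lt_one x).le⟩ y hy ε hε
    (X' - ⌊x⌋) hX'
  refine ⟨y', by rw [e1, h1]; ring, ?_⟩
  rw [e4, e3, e3, e2]
  exact h2

end TwistData

/-- The Lax–Oleinik operator of a generating function. -/
def laxOleinik (f : V2 → V2) (S : V2 → ℝ) (η : ℝ → ℝ) (X : ℝ) : ℝ :=
  sInf ((fun p : V2 => η p.1 + S p) '' {p | (f p).1 = X})

theorem TwistData.isLaxOleinik {f : V2 → V2} {S : V2 → ℝ} (h : TwistData f S) :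
    IsLaxOleinik f (laxOleinik f S) := by
  have attain : ∀ {Λ : ℝ} {η : ℝ → ℝ}, Lip Λ η → ∀ X0, ∃ x y, (f (x, y)).1 = X0 ∧ |y| ≤ Λ ∧
      laxOleinik f S η X0 = η x + S (x, y) ∧
      ∀ x' y', (f (x', y')).1 = X0 → laxOleinik f S η X0 ≤ η x' + S (x', y') := by
    intro Λ η hη X0
    obtain ⟨x, y, h1, h2, h3⟩ := h.exists_min hη X0
    have : IsLeast ((fun p : V2 => η p.1 + S p) '' {p | (f p).1 = X0}) (η x + S (x, y)) :=
      ⟨⟨(x, y), h1, rfl⟩, by rintro _ ⟨⟨x', y'⟩, h4, rfl⟩; exact h3 x' y' h4⟩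
    have e : laxOleinik f S η X0 = η x + S (x, y) := this.csInf_eq
    exact ⟨x, y, h1, h2, e, fun x' y' h4 => e ▸ h3 x' y' h4⟩
  refine ⟨fun η _ => ?_, fun Λ => ?_⟩
  · funext X
    unfold laxOleinik
    congr 1
    ext t
    constructor
    · rintro ⟨⟨x, y⟩, hp, rfl⟩
      refine ⟨(x + 1, y), ?_, ?_⟩
      · simp only [Set.mem_ofPred_eq] at hp ⊢
        rw [h.X_add_one, hp]
      · have := h.ST (x, y)
        simp only [Tmap] at this
        simp only
        rw [this]
    · rintro ⟨⟨x, y⟩, hp, rfl⟩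
      refine ⟨(x - 1, y), ?_, ?_⟩
      · simp only [Set.mem_ofPred_eq] at hp ⊢
        have := h.X_add_one (x - 1) y
        rw [sub_add_cancel] at this
        linarith
      · have := h.ST (x - 1, y)
        simp only [Tmap, sub_add_cancel] at this
        simp only [sub_add_cancel]
        rw [this]
  · obtain ⟨R, hR⟩ := h.bddX Λ
    obtain ⟨C, hC⟩ := h.bddY Λ
    obtain ⟨r, hr, H⟩ := h.fiber_end_variation Λ
    refine ⟨R, C + 1, r, hr, fun η hη => ?_⟩
    have main : ∀ X, ∃ x y, |y| ≤ Λ ∧ |x - X| ≤ R ∧ (f (x, y)).1 = X ∧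
      (∀ ε > 0, ∀ᶠ x' in 𝓝 x, η x + y * (x' - x) - ε * |x' - x| ≤ η x') ∧
      ∀ ζ, (∃ Λ, Lip Λ ζ) → ∀ ε > 0, ∀ X', |X' - X| ≤ r ε →
        laxOleinik f S ζ X' ≤
          ζ x - η x + laxOleinik f S η X + (f (x, y)).2 * (X' - X) + ε * |X' - X| := by
      intro X
      obtain ⟨x, y, h1, h2, h3, h4⟩ := attain hη X
      refine ⟨x, y, h2, h1 ▸ hR x y h2, h1, fun ε hε => ?_, ?_⟩
      · filter_upwards [h.fiber_variation x y ε hε] with x' hx'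
        obtain ⟨y', a, b⟩ := hx'
        have := h4 x' y' (a.trans h1)
        have := (abs_le.1 b).2
        linarith
      · rintro ζ ⟨Λ2, hζ⟩ ε hε X' hX'
        obtain ⟨y', a, b⟩ := H x y h2 ε hε X' (by rwa [h1])
        obtain ⟨-, -, -, -, -, h6⟩ := attain hζ X'
        have := h6 x y' a
        rw [h1] at b
        linarith
    refine ⟨?_, fun X => ?_⟩
    · refine Lip_of_local (hr 1 one_pos) fun X X' hX => ?_
      obtain ⟨x, y, h1, h2, h3, h4, h5⟩ := main X
      have := h5 η ⟨Λ, hη⟩ 1 one_pos X' hX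
      have h7 : (f (x, y)).2 * (X' - X) ≤ C * |X' - X| := by
        refine (le_abs_self _).trans ?_
        rw [abs_mul]
        exact mul_le_mul_of_nonneg_right (hC x y h1) (abs_nonneg _)
      linarith
    · obtain ⟨x, y, h1, h2, h3, h4, h5⟩ := main X
      exact ⟨x, y, (f (x, y)).2, h2, Prod.ext h3 rfl, h4, h5⟩

lemma IsLaxOleinik.comp {φ₁ φ₂ : V2 → V2} {T₁ T₂ : (ℝ → ℝ) → ℝ → ℝ}
    (h₁ : IsLaxOleinik φ₁ T₁) (h₂ : IsLaxOleinik φ₂ T₂) :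
    IsLaxOleinik (φ₂ ∘ φ₁) (T₂ ∘ T₁) := by
  have lip : ∀ η, (∃ Λ, Lip Λ η) → ∃ Λ, Lip Λ (T₁ η) := by
    rintro η ⟨Λ, hη⟩
    obtain ⟨R, Λ', r, -, H⟩ := h₁.main Λ
    exact ⟨Λ', (H η hη).1⟩
  refine ⟨fun η hη => ?_, fun Λ => ?_⟩
  · simp only [Function.comp]
    rw [h₁.shift η hη, h₂.shift _ (lip η hη)]
  · obtain ⟨R, Λ', r, hr, H⟩ := h₁.main Λ
    obtain ⟨R', Λ'', r', hr', H'⟩ := h₂.main Λ'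
    refine ⟨R + R', Λ'', r', hr', fun η hη => ?_⟩
    obtain ⟨hη1, H1⟩ := H η hη
    obtain ⟨hη2, H2⟩ := H' (T₁ η) hη1
    refine ⟨hη2, fun X => ?_⟩
    obtain ⟨z, w, Y, hz, hφ2, hsub, hsup⟩ := H2 X
    obtain ⟨x, y, W, hx, hφ1, hsub1, hsup1⟩ := H1 z
    have hwW : w = W := by
      have key : ∀ s : ℝ, (s = 1 ∨ s = -1) → s * w ≤ s * W := by
        intro s hs
        refine le_of_forall_pos_le_add fun ε hε => ?_
        have hpos := hr (ε / 2) (by positivity)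
        have ev := hsub (ε / 2) (by positivity)
        obtain ⟨δ, hδ, hδ'⟩ := Metric.eventually_nhds_iff.1 ev
        set t := min (δ / 2) (r (ε / 2)) with ht
        have ht0 : 0 < t := by positivity
        have habs : |z + s * t - z| = t := by
          rw [add_sub_cancel_left]
          rcases hs with rfl | rfl <;> simp [abs_of_pos ht0]
        have hlo := hδ' (y := z + s * t) (by
          rw [Real.dist_eq, habs]
          exact (min_le_left _ _).trans_lt (by linarith))
        have hhi := hsup1 η ⟨Λ, hη⟩ (ε / 2) (by positivity) (z + s * t) (by
          rw [habs]; exact min_le_right _ _)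
        rw [habs] at hlo hhi
        rw [add_sub_cancel_left] at hlo hhi
        have : t * (s * w) ≤ t * (s * W + ε) := by linarith
        exact le_of_mul_le_mul_left this ht0
      have a := key 1 (Or.inl rfl)
      have b := key (-1) (Or.inr rfl)
      linarith
    refine ⟨x, y, Y, ?_, ?_, hsub1, ?_⟩
    · calc |x - X| = |(x - z) + (z - X)| := by ring_nf
        _ ≤ _ := (abs_add_le _ _).trans (add_le_add hx hz)
    · simp only [Function.comp]
      rw [hφ1, ← hwW, hφ2]
    · intro ζ hζ ε hε X' hX'
      have a := hsup (T₁ ζ) (lip ζ hζ) ε hε X' hX'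
      have b := hsup1 ζ hζ 1 one_pos z (by simpa using (hr 1 one_pos).le)
      simp only [sub_self, mul_zero, abs_zero, add_zero] at b
      simp only [Function.comp]
      linarith

lemma IsPosTwistLift.exists_isLaxOleinik {f : V2 → V2} (h : IsPosTwistLift f) :
    (∃ T, IsLaxOleinik f T) ∧ (∃ e : V2 ≃ₜ V2, f = e) ∧ ∀ p, f (Tmap p) = Tmap (f p) := by
  obtain ⟨cf, bij, ci, hT, -, hpos, S, cS, ST, hS⟩ := h
  have hl : Function.LeftInverse (Function.invFun f) f := Function.leftInverse_invFun bij.1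
  have hr : Function.RightInverse (Function.invFun f) f := Function.rightInverse_invFun bij.2
  refine ⟨⟨_, TwistData.isLaxOleinik (S := S) ⟨cf, cS, ⟨Function.invFun f, ci.continuous, hl, hr⟩,
    hT, ST, hpos, fun p => (hS p).1, fun p => (hS p).2⟩⟩, ?_, hT⟩
  exact ⟨⟨⟨f, Function.invFun f, hl, hr⟩, cf.continuous, ci.continuous⟩, rfl⟩

theorem MemP1.exists_isLaxOleinik {φ : V2 → V2} (h : MemP1 φ) :
    (∃ T, IsLaxOleinik φ T) ∧ (∃ e : V2 ≃ₜ V2, φ = e) ∧ ∀ p, φ (Tmap p) = Tmap (φ p) := by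
  obtain ⟨l, hl, hf, rfl⟩ := h
  induction l with
  | nil => exact absurd rfl hl
  | cons f l ih =>
    obtain ⟨⟨T, hT⟩, ⟨e, he⟩, hfT⟩ := (hf f (by simp)).exists_isLaxOleinik
    rcases eq_or_ne l [] with rfl | hne
    · simpa using ⟨⟨T, hT⟩, ⟨e, he⟩, fun x y => hfT (x, y)⟩
    · obtain ⟨⟨T', hT'⟩, ⟨e', he'⟩, hfT'⟩ := ih hne fun g hg => hf g (by simp [hg])
      refine ⟨⟨_, hT'.comp hT⟩, ⟨e'.trans e, ?_⟩, fun p => ?_⟩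
      · rw [List.foldr_cons, he', he]; rfl
      · simp only [List.foldr_cons, Function.comp, hfT', hfT]

/-- `X` is reached from `x` by a minimizing segment for the initial condition `η`. -/
def Cal (T : (ℝ → ℝ) → ℝ → ℝ) (η : ℝ → ℝ) (x X : ℝ) : Prop :=
  ∀ ζ, (∃ Λ, Lip Λ ζ) → T ζ X ≤ ζ x - η x + T η X

/-- `y` is a subgradient of `η` at `x`. -/
def Subgrad (η : ℝ → ℝ) (x y : ℝ) : Prop :=
  ∀ ε > 0, ∀ᶠ x' in 𝓝 x, η x + y * (x' - x) - ε * |x' - x| ≤ η x'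

/-- `y` is a supergradient of `η` at `x`. -/
def Supgrad (η : ℝ → ℝ) (x y : ℝ) : Prop :=
  ∀ ε > 0, ∀ᶠ x' in 𝓝 x, η x' ≤ η x + y * (x' - x) + ε * |x' - x|

/-- `Y` is a supergradient of `η` at `X` with modulus controlled by `r`. -/
def USup (r : ℝ → ℝ) (η : ℝ → ℝ) (X Y : ℝ) : Prop :=
  ∀ ε > 0, ∀ X', |X' - X| ≤ r ε → η X' ≤ η X + Y * (X' - X) + ε * |X' - X|

lemma eventually_abs_sub_le (x : ℝ) {r : ℝ} (hr : 0 < r) : ∀ᶠ x' in 𝓝 x, |x' - x| ≤ r := by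
  filter_upwards [Metric.ball_mem_nhds x hr] with x' hx'
  rw [Metric.mem_ball, Real.dist_eq] at hx'
  exact hx'.le

lemma USup.supgrad {r : ℝ → ℝ} (hr : ∀ ε > 0, 0 < r ε) {η : ℝ → ℝ} {X Y : ℝ}
    (h : USup r η X Y) : Supgrad η X Y := fun ε hε =>
  (eventually_abs_sub_le X (hr ε hε)).mono fun X' hX' => h ε hε X' hX'

lemma Subgrad.le_supgrad {η : ℝ → ℝ} {x y Y : ℝ} (h₁ : Subgrad η x y) (h₂ : Supgrad η x Y) :
    y = Y := by
  have key : ∀ s : ℝ, (s = 1 ∨ s = -1) → s * y ≤ s * Y := by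
    intro s hs
    refine le_of_forall_pos_le_add fun ε hε => ?_
    obtain ⟨δ, hδ, hδ'⟩ := Metric.eventually_nhds_iff.1
      ((h₁ (ε / 2) (by positivity)).and (h₂ (ε / 2) (by positivity)))
    have habs : |x + s * (δ / 2) - x| = δ / 2 := by
      rw [add_sub_cancel_left]
      have := half_pos hδ
      rcases hs with rfl | rfl <;> simp [this.le]
    obtain ⟨a, b⟩ := hδ' (y := x + s * (δ / 2)) (by rw [Real.dist_eq, habs]; linarith)
    rw [habs, add_sub_cancel_left] at a b
    have : (δ / 2) * (s * y) ≤ (δ / 2) * (s * Y + ε) := by linarith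
    exact le_of_mul_le_mul_left this (by positivity)
  have a := key 1 (Or.inl rfl)
  have b := key (-1) (Or.inr rfl)
  linarith

lemma HasDerivAt.both {η : ℝ → ℝ} {x y : ℝ} (h : HasDerivAt η y x) :
    ∀ ε > 0, ∀ᶠ x' in 𝓝 x, |η x' - η x - y * (x' - x)| ≤ ε * |x' - x| := by
  intro ε hε
  filter_upwards [(hasDerivAt_iff_isLittleO.1 h).def hε] with x' hx'
  rw [Real.norm_eq_abs, Real.norm_eq_abs, smul_eq_mul, mul_comm (x' - x)] at hx'
  exact hx'

lemma HasDerivAt.subgrad {η : ℝ → ℝ} {x y : ℝ} (h : HasDerivAt η y x) : Subgrad η x y := by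
  intro ε hε
  filter_upwards [h.both ε hε] with x' hx'
  linarith [(abs_le.1 hx').1]

lemma HasDerivAt.supgrad {η : ℝ → ℝ} {x y : ℝ} (h : HasDerivAt η y x) : Supgrad η x y := by
  intro ε hε
  filter_upwards [h.both ε hε] with x' hx'
  linarith [(abs_le.1 hx').2]

lemma Subgrad.hasDerivAt {η : ℝ → ℝ} {x y Y : ℝ} (h₁ : Subgrad η x y) (h₂ : Supgrad η x Y) :
    HasDerivAt η y x := by
  obtain rfl := h₁.le_supgrad h₂
  rw [hasDerivAt_iff_isLittleO, Asymptotics.isLittleO_iff]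
  intro ε hε
  filter_upwards [h₁ ε hε, h₂ ε hε] with x' a b
  rw [Real.norm_eq_abs, Real.norm_eq_abs, smul_eq_mul, mul_comm (x' - x), abs_le]
  constructor <;> linarith

lemma lip_bump (x : ℝ) : Lip 2 fun x' => min ((x' - x) ^ 2) 1 := by
  have key : ∀ s t : ℝ, min (t ^ 2) 1 - min (s ^ 2) 1 ≤ 2 * |t - s| := by
    intro s t
    rcases le_total (s ^ 2) 1 with h | h
    · rw [min_eq_left h]
      rcases le_total (t ^ 2) 1 with h' | h'
      · rw [min_eq_left h']
        have hs := abs_le_one_iff_mul_self_le_one.2 (show s * s ≤ 1 by nlinarith)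
        have ht := abs_le_one_iff_mul_self_le_one.2 (show t * t ≤ 1 by nlinarith)
        calc t ^ 2 - s ^ 2 = (t + s) * (t - s) := by ring
          _ ≤ |t + s| * |t - s| := by rw [← abs_mul]; exact le_abs_self _
          _ ≤ 2 * |t - s| := by
            gcongr
            exact (abs_add_le _ _).trans (by linarith)
      · rw [min_eq_right h']
        have hs := abs_le_one_iff_mul_self_le_one.2 (show s * s ≤ 1 by nlinarith)
        have ht : 1 ≤ |t| := by
          by_contra hcon
          push Not at hcon
          have : |t| * |t| < 1 := by nlinarith [abs_nonneg t]
          rw [abs_mul_abs_self] at this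
          nlinarith
        have h1 : |t| - |s| ≤ |t - s| := abs_sub_abs_le_abs_sub t s
        have : s ^ 2 = |s| ^ 2 := (sq_abs s).symm
        nlinarith [abs_nonneg s]
    · rw [min_eq_right h]
      have := min_le_right (t ^ 2) 1
      have := abs_nonneg (t - s)
      linarith
  intro a b
  rw [abs_le]
  have h1 := key (a - x) (b - x)
  have h2 := key (b - x) (a - x)
  have e1 : b - x - (a - x) = b - a := by ring
  have e2 : a - x - (b - x) = a - b := by ring
  rw [e1] at h1
  rw [e2, abs_sub_comm] at h2
  constructor <;> linarith

lemma Lip.add {Λ Λ' : ℝ} {η ζ : ℝ → ℝ} (h : Lip Λ η) (h' : Lip Λ' ζ) :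
    Lip (Λ + Λ') fun x => η x + ζ x := by
  intro x x'
  have : η x' + ζ x' - (η x + ζ x) = (η x' - η x) + (ζ x' - ζ x) := by ring
  simp only
  rw [this, add_mul]
  exact (abs_add_le _ _).trans (add_le_add (h x x') (h' x x'))

lemma Lip.add_const {Λ : ℝ} {η : ℝ → ℝ} (h : Lip Λ η) (a : ℝ) : Lip Λ fun x => η x + a := by
  intro x x'
  simpa using h x x'

/-- Every calibrated pair carries first-order information, uniformly for `Λ`-Lipschitz data. -/
def Full (φ : V2 → V2) (T : (ℝ → ℝ) → ℝ → ℝ) (Λ R : ℝ) (r : ℝ → ℝ) : Prop :=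
  (∀ ε > 0, 0 < r ε) ∧ ∀ η, Lip Λ η → (∃ Λ', Lip Λ' (T η)) ∧ (∀ X, ∃ x, Cal T η x X) ∧
    ∀ x X, Cal T η x X → |x - X| ≤ R ∧ ∃ y Y, φ (x, y) = (X, Y) ∧ Subgrad η x y ∧
      ∀ ζ, (∃ Λ, Lip Λ ζ) → ∀ ε > 0, ∀ X', |X' - X| ≤ r ε →
        T ζ X' ≤ ζ x - η x + T η X + Y * (X' - X) + ε * |X' - X|

namespace IsLaxOleinik

variable {φ : V2 → V2} {T : (ℝ → ℝ) → ℝ → ℝ} (h : IsLaxOleinik φ T)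
include h

lemma full (Λ : ℝ) : ∃ R r, Full φ T Λ R r := by
  obtain ⟨R, Λ', r, hr, H⟩ := h.main (Λ + 2)
  refine ⟨R, r, hr, fun η hη => ?_⟩
  obtain ⟨hL, hm⟩ := H η (hη.mono (by linarith))
  refine ⟨⟨Λ', hL⟩, fun X => ?_, fun x X hcal => ?_⟩
  · obtain ⟨x, y, Y, -, -, -, hs⟩ := hm X
    refine ⟨x, fun ζ hζ => ?_⟩
    simpa using hs ζ hζ 1 one_pos X (by simpa using (hr 1 one_pos).le)
  · set ζ : ℝ → ℝ := fun x' => η x' + min ((x' - x) ^ 2) 1 with hζ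
    have hζL : Lip (Λ + 2) ζ := hη.add (lip_bump x)
    obtain ⟨x1, y, Y, hx1, hφ, hsub, hsup⟩ := (H ζ hζL).2 X
    have hζx : ζ x = η x := by simp [hζ]
    have a1 := hcal ζ ⟨_, hζL⟩
    have a2 := hsup η ⟨_, hη⟩ 1 one_pos X (by simpa using (hr 1 one_pos).le)
    simp only [sub_self, mul_zero, abs_zero, add_zero] at a2
    have a3 : min ((x1 - x) ^ 2) 1 ≤ 0 := by
      have : ζ x1 = η x1 + min ((x1 - x) ^ 2) 1 := rfl
      linarith
    have hxx : x1 = x := by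
      rcases min_le_iff.1 a3 with q | q
      · have := pow_eq_zero_iff (two_ne_zero) |>.1 (le_antisymm q (sq_nonneg _))
        linarith
      · linarith
    subst hxx
    refine ⟨hx1, y, Y, hφ, fun ε hε => ?_, fun ζ' hζ' ε hε X' hX' => ?_⟩
    · filter_upwards [hsub (ε / 2) (by positivity),
        eventually_abs_sub_le x1 (show 0 < ε / 2 by positivity)] with x' b1 b2
      have b3 : min ((x' - x1) ^ 2) 1 ≤ (ε / 2) * |x' - x1| := by
        refine (min_le_left _ _).trans ?_
        rw [← sq_abs, sq]
        gcongr
      have : ζ x' = η x' + min ((x' - x1) ^ 2) 1 := rfl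
      rw [hζx] at b1
      linarith
    · have := hsup ζ' hζ' ε hε X' hX'
      linarith

lemma lip {η : ℝ → ℝ} (hη : ∃ Λ, Lip Λ η) : ∃ Λ, Lip Λ (T η) := by
  obtain ⟨Λ, hη⟩ := hη
  obtain ⟨R, Λ', r, -, H⟩ := h.main Λ
  exact ⟨Λ', (H η hη).1⟩

lemma lip_iterate {η : ℝ → ℝ} (hη : ∃ Λ, Lip Λ η) (n : ℕ) : ∃ Λ, Lip Λ (T^[n] η) := by
  induction n with
  | zero => exact hη
  | succ n ih => rw [Function.iterate_succ_apply']; exact h.lip ih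

/-- Finite speed of propagation and monotonicity. -/
lemma local_le (Λ : ℝ) : ∃ R, ∀ η, Lip Λ η → ∀ ζ, (∃ Λ, Lip Λ ζ) → ∀ X κ,
    (∀ x, |x - X| ≤ R → ζ x ≤ η x + κ) → T ζ X ≤ T η X + κ := by
  obtain ⟨R, r, hr, H⟩ := h.full Λ
  refine ⟨R, fun η hη ζ hζ X κ hle => ?_⟩
  obtain ⟨-, hex, hc⟩ := H η hη
  obtain ⟨x, hx⟩ := hex X
  have := hx ζ hζ
  have := hle x (hc x X hx).1
  linarith

lemma le_add {η ζ : ℝ → ℝ} (hη : ∃ Λ, Lip Λ η) (hζ : ∃ Λ, Lip Λ ζ) {κ : ℝ}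
    (hle : ∀ x, ζ x ≤ η x + κ) (X : ℝ) : T ζ X ≤ T η X + κ := by
  obtain ⟨Λ, hη⟩ := hη
  obtain ⟨R, H⟩ := h.local_le Λ
  exact H η hη ζ hζ X κ fun x _ => hle x

lemma add_const {η : ℝ → ℝ} (hη : ∃ Λ, Lip Λ η) (a : ℝ) :
    T (fun x => η x + a) = fun X => T η X + a := by
  have hη' : ∃ Λ, Lip Λ fun x => η x + a := hη.imp fun Λ h => h.add_const a
  funext X
  refine le_antisymm (h.le_add hη hη' (fun x => le_rfl) X) ?_
  have := h.le_add (κ := -a) hη' hη (fun x => by simp) X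
  linarith

lemma iterate_add_const {η : ℝ → ℝ} (hη : ∃ Λ, Lip Λ η) (a : ℝ) (n : ℕ) :
    T^[n] (fun x => η x + a) = fun X => T^[n] η X + a := by
  induction n with
  | zero => rfl
  | succ n ih => rw [Function.iterate_succ_apply', ih, h.add_const (h.lip_iterate hη n),
      Function.iterate_succ_apply']

lemma iterate_le_add {η ζ : ℝ → ℝ} (hη : ∃ Λ, Lip Λ η) (hζ : ∃ Λ, Lip Λ ζ) {κ : ℝ}
    (hle : ∀ x, ζ x ≤ η x + κ) (n : ℕ) (X : ℝ) : T^[n] ζ X ≤ T^[n] η X + κ := by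
  induction n generalizing X with
  | zero => exact hle X
  | succ n ih =>
    rw [Function.iterate_succ_apply', Function.iterate_succ_apply']
    exact h.le_add (h.lip_iterate hη n) (h.lip_iterate hζ n) ih X

lemma per {η : ℝ → ℝ} (hη : ∃ Λ, Lip Λ η) {c : ℝ} (hc : ∀ x, η (x + 1) = η x + c) (X : ℝ) :
    T η (X + 1) = T η X + c := by
  have h1 := h.shift η hη
  have h2 : (fun x => η (x + 1)) = fun x => η x + c := funext hc
  rw [h2, h.add_const hη] at h1
  exact (congrFun h1 X).symm

end IsLaxOleinik

/-- Pointwise convergence of equi-Lipschitz functions is locally uniform. -/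
lemma eventually_close {ι : Type*} {l : Filter ι} {Λ : ℝ} {η : ι → ℝ → ℝ} {θ : ℝ → ℝ}
    (hη : ∀ k, Lip Λ (η k)) (hθ : Lip Λ θ) (hlim : ∀ x, Tendsto (fun k => η k x) l (𝓝 (θ x)))
    (K : ℝ) {κ : ℝ} (hκ : 0 < κ) : ∀ᶠ k in l, ∀ x, |x| ≤ K → |η k x - θ x| ≤ κ := by
  have : ∀ᶠ k in l, ∀ x ∈ Set.Icc (-K) K, |η k x - θ x| ≤ κ := by
    refine isCompact_Icc.induction_on (p := fun s => ∀ᶠ k in l, ∀ x ∈ s, |η k x - θ x| ≤ κ)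
      (by simp) (fun s t hst ht => ht.mono fun k hk x hx => hk x (hst hx))
      (fun s t hs ht => ?_) fun x _ => ?_
    · filter_upwards [hs, ht] with k a b x hx
      exact hx.elim (a x) (b x)
    · have hΛ := hθ.nonneg
      refine ⟨{x' | |x' - x| ≤ κ / (3 * (Λ + 1))}, mem_nhdsWithin_of_mem_nhds
        (eventually_abs_sub_le x (by positivity)), ?_⟩
      have := (Metric.tendsto_nhds.1 (hlim x)) (κ / 3) (by positivity)
      filter_upwards [this] with k hk x' hx'
      rw [Real.dist_eq] at hk
      have b1 := hη k x x'
      have b2 := hθ x x'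
      have b3 : Λ * |x' - x| ≤ κ / 3 := by
        calc Λ * |x' - x| ≤ (Λ + 1) * (κ / (3 * (Λ + 1))) := by
              gcongr
              linarith
          _ = κ / 3 := by field_simp
      have e : η k x' - θ x' = (η k x' - η k x) + (η k x - θ x) - (θ x' - θ x) := by ring
      rw [abs_le] at *
      rw [abs_lt] at hk
      constructor <;> linarith [b1.1, b1.2, b2.1, b2.2, hk.1, hk.2]
  filter_upwards [this] with k hk x hx
  exact hk x (abs_le.1 hx)

lemma Lip.of_tendsto {ι : Type*} {l : Filter ι} [l.NeBot] {Λ : ℝ} {η : ι → ℝ → ℝ} {θ : ℝ → ℝ}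
    (hη : ∀ k, Lip Λ (η k)) (hlim : ∀ x, Tendsto (fun k => η k x) l (𝓝 (θ x))) : Lip Λ θ :=
  fun x x' => le_of_tendsto ((hlim x').sub (hlim x)).abs (Eventually.of_forall fun k => hη k x x')

lemma IsLaxOleinik.tendsto {φ : V2 → V2} {T : (ℝ → ℝ) → ℝ → ℝ} (h : IsLaxOleinik φ T)
    {ι : Type*} {l : Filter ι} [l.NeBot] {Λ : ℝ} {η : ι → ℝ → ℝ} {θ : ℝ → ℝ}
    (hη : ∀ k, Lip Λ (η k)) (hlim : ∀ x, Tendsto (fun k => η k x) l (𝓝 (θ x))) (X : ℝ) :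
    Tendsto (fun k => T (η k) X) l (𝓝 (T θ X)) := by
  have hθ := Lip.of_tendsto hη hlim
  obtain ⟨R, H⟩ := h.local_le Λ
  rw [Metric.tendsto_nhds]
  intro ε hε
  filter_upwards [eventually_close hη hθ hlim (|X| + R) (half_pos hε)] with k hk
  have hb : ∀ x, |x - X| ≤ R → |η k x - θ x| ≤ ε / 2 := by
    intro x hx
    refine hk x ?_
    have : |x| ≤ |X| + |x - X| := by
      have := abs_add_le X (x - X)
      rwa [add_sub_cancel] at this
    linarith
  have a := H θ hθ (η k) ⟨_, hη k⟩ X (ε / 2) fun x hx => by linarith [(abs_le.1 (hb x hx)).2]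
  have b := H (η k) (hη k) θ ⟨_, hθ⟩ X (ε / 2) fun x hx => by linarith [(abs_le.1 (hb x hx)).1]
  rw [Real.dist_eq, abs_lt]
  constructor <;> linarith

/-- Limits of calibrated pairs are calibrated. -/
lemma Cal.of_tendsto {φ : V2 → V2} {T : (ℝ → ℝ) → ℝ → ℝ} (h : IsLaxOleinik φ T)
    {ι : Type*} {l : Filter ι} [l.NeBot] {Λ : ℝ} {η : ι → ℝ → ℝ} {θ : ℝ → ℝ}
    (hη : ∀ k, Lip Λ (η k)) (hlim : ∀ x, Tendsto (fun k => η k x) l (𝓝 (θ x)))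
    {x X : ι → ℝ} {x0 X0 : ℝ} (hx : Tendsto x l (𝓝 x0)) (hX : Tendsto X l (𝓝 X0))
    (hcal : ∀ᶠ k in l, Cal T (η k) (x k) (X k)) : Cal T θ x0 X0 := by
  have joint : ∀ {Λ : ℝ} {η : ι → ℝ → ℝ} {θ : ℝ → ℝ} {x : ι → ℝ} {x0 : ℝ}, (∀ k, Lip Λ (η k)) →
      (∀ x, Tendsto (fun k => η k x) l (𝓝 (θ x))) → Tendsto x l (𝓝 x0) →
      Tendsto (fun k => η k (x k)) l (𝓝 (θ x0)) := by
    intro Λ η θ x x0 hη hlim hx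
    have h1 : Tendsto (fun k => η k (x k) - η k x0) l (𝓝 0) := by
      refine squeeze_zero_norm (a := fun k => Λ * |x k - x0|) (fun k => hη k x0 (x k)) ?_
      simpa using ((hx.sub_const x0).abs).const_mul Λ
    simpa using h1.add (hlim x0)
  intro ζ hζ
  obtain ⟨Λ2, hζ2⟩ := h.lip hζ
  obtain ⟨R', Λ', r', -, H'⟩ := h.main Λ
  have t1 := joint hη hlim hx
  have t2 := joint (fun k => (H' (η k) (hη k)).1) (h.tendsto hη hlim) hX
  have t3 : Tendsto (fun k => T ζ (X k)) l (𝓝 (T ζ X0)) := (hζ2.continuous.tendsto X0).comp hX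
  obtain ⟨Λ3, hζ3⟩ := id hζ
  have t4 : Tendsto (fun k => ζ (x k)) l (𝓝 (ζ x0)) := (hζ3.continuous.tendsto x0).comp hx
  exact le_of_tendsto_of_tendsto t3 ((t4.sub t1).add t2) (hcal.mono fun k hk => hk ζ hζ)

lemma exists_ultralimit {ι : Type*} (F : Ultrafilter ι) {a : ι → ℝ} {lo hi : ℝ}
    (h : ∀ᶠ k in (F : Filter ι), a k ∈ Set.Icc lo hi) :
    ∃ b ∈ Set.Icc lo hi, Tendsto a F (𝓝 b) :=
  (isCompact_Icc (a := lo) (b := hi)).ultrafilter_le_nhds (F.map a)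
    (by rw [le_principal_iff]; exact h)

lemma exists_ultralimit_fun {ι : Type*} (F : Ultrafilter ι) {η : ι → ℝ → ℝ} {Λ C : ℝ}
    (hη : ∀ k, Lip Λ (η k)) (h0 : ∀ k, |η k 0| ≤ C) :
    ∃ θ : ℝ → ℝ, ∀ x, Tendsto (fun k => η k x) F (𝓝 (θ x)) := by
  have : ∀ x, ∃ b, Tendsto (fun k => η k x) F (𝓝 b) := by
    intro x
    obtain ⟨b, -, hb⟩ := exists_ultralimit F (a := fun k => η k x) (lo := -(C + Λ * |x|))
      (hi := C + Λ * |x|) (Eventually.of_forall fun k => by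
        have a1 := hη k 0 x
        rw [sub_zero] at a1
        refine abs_le.1 ?_
        calc |η k x| = |η k 0 + (η k x - η k 0)| := by ring_nf
          _ ≤ _ := (abs_add_le _ _).trans (add_le_add (h0 k) a1))
    exact ⟨b, hb⟩
  choose θ hθ using this
  exact ⟨θ, hθ⟩

/-- Potential of a periodic function. -/
def pot (w : ℝ → ℝ) (x : ℝ) : ℝ := ∫ t in (0 : ℝ)..x, w t

lemma pot_hasDerivAt {w : ℝ → ℝ} (hw : Continuous w) (x : ℝ) : HasDerivAt (pot w) (w x) x :=
  (hw.integral_hasStrictDerivAt 0 x).hasDerivAt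

lemma pot_add_one {w : ℝ → ℝ} (hw : Continuous w) (hper : ∀ x, w (x + 1) = w x) (x : ℝ) :
    pot w (x + 1) = pot w x + pot w 1 := by
  unfold pot
  have hp : Function.Periodic w 1 := hper
  rw [← intervalIntegral.integral_add_adjacent_intervals (b := x) (hw.intervalIntegrable _ _)
    (hw.intervalIntegrable _ _)]
  congr 1
  have := hp.intervalIntegral_add_eq x 0
  simpa using this

lemma lip_of_deriv {η η' : ℝ → ℝ} {U : ℝ} (hd : ∀ x, HasDerivAt η (η' x) x)
    (hU : ∀ x, |η' x| ≤ U) : Lip U η := fun x x' =>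
  convex_univ.norm_image_sub_le_of_norm_hasDerivWithin_le
    (fun x _ => (hd x).hasDerivWithinAt) (fun x _ => hU x) (Set.mem_univ x) (Set.mem_univ x')

/-- Uniform first order expansion of a function with uniformly continuous derivative. -/
lemma uniform_expansion {η η' : ℝ → ℝ} (hd : ∀ x, HasDerivAt η (η' x) x)
    (huc : UniformContinuous η') {ε : ℝ} (hε : 0 < ε) :
    ∃ δ > 0, ∀ x x', |x' - x| ≤ δ → |η x' - η x - η' x * (x' - x)| ≤ ε * |x' - x| := by
  obtain ⟨δ, hδ, H⟩ := Metric.uniformContinuous_iff.1 huc ε hε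
  refine ⟨δ / 2, by positivity, fun x x' hx => ?_⟩
  have hd' : ∀ t ∈ Set.uIcc x x', HasDerivWithinAt (fun t => η t - η' x * t) (η' t - η' x)
      (Set.uIcc x x') t := by
    intro t _
    have h1 : HasDerivAt (fun t => η' x * t) (η' x * 1) t := (hasDerivAt_id t).const_mul (η' x)
    rw [mul_one] at h1
    exact ((hd t).sub h1).hasDerivWithinAt
  have := (convex_uIcc x x').norm_image_sub_le_of_norm_hasDerivWithin_le hd' (C := ε)
    (fun t ht => by
      have h1 : |t - x| ≤ |x' - x| := Set.abs_sub_left_of_mem_uIcc ht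
      have := H (a := t) (b := x) (by rw [Real.dist_eq]; linarith)
      rw [Real.dist_eq] at this
      exact this.le) Set.left_mem_uIcc Set.right_mem_uIcc
  rw [Real.norm_eq_abs, Real.norm_eq_abs] at this
  convert this using 2
  ring

/-- A rotational invariant graph with bounded ordinate. -/
structure Bdry (φ : V2 → V2) (U : ℝ) (w : ℝ → ℝ) : Prop where
  uc : UniformContinuous w
  per : ∀ x, w (x + 1) = w x
  bd : ∀ x, |w x| ≤ U
  inv : φ '' {p | p.2 = w p.1} = {p | p.2 = w p.1}

/-- Dynamics on an invariant graph, projected to the line. -/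
def proj (φ : V2 → V2) (w : ℝ → ℝ) (x : ℝ) : ℝ := (φ (x, w x)).1

namespace Bdry
variable {φ : V2 → V2} {T : (ℝ → ℝ) → ℝ → ℝ} {U R : ℝ} {r : ℝ → ℝ} {w : ℝ → ℝ}

lemma apply_eq (hw : Bdry φ U w) (x : ℝ) : φ (x, w x) = (proj φ w x, w (proj φ w x)) := by
  have : φ (x, w x) ∈ {p : V2 | p.2 = w p.1} := by
    rw [← hw.inv]; exact ⟨(x, w x), rfl, rfl⟩
  exact Prod.ext rfl this

lemma lip_pot (hw : Bdry φ U w) : Lip U (pot w) :=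
  lip_of_deriv (pot_hasDerivAt hw.uc.continuous) hw.bd

lemma exists_T_pot (hw : Bdry φ U w) (hfull : Full φ T (U + 1) R r) :
    ∃ a, ∀ X, T (pot w) X = pot w X + a := by
  obtain ⟨hr, H⟩ := hfull
  have hL := hw.lip_pot
  have hd := pot_hasDerivAt hw.uc.continuous
  obtain ⟨-, hex, hcal⟩ := H (pot w) (hL.mono (by linarith))
  have hsup : ∀ X, USup r (T (pot w)) X (w X) := by
    intro X
    obtain ⟨x, hx⟩ := hex X
    obtain ⟨-, y, Y, h1, h2, h3⟩ := hcal x X hx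
    have hy : y = w x := h2.le_supgrad (hd x).supgrad
    subst hy
    rw [hw.apply_eq x] at h1
    obtain ⟨rfl, rfl⟩ := Prod.mk.inj h1
    intro ε hε X' hX'
    have := h3 (pot w) ⟨_, hL⟩ ε hε X' hX'
    linarith
  have hlip : ∀ ε > 0, Lip (2 * ε) fun X => T (pot w) X - pot w X := by
    intro ε hε
    obtain ⟨δ, hδ, hδ'⟩ := uniform_expansion hd hw.uc hε
    refine Lip_of_local (r := min δ (r ε)) (lt_min hδ (hr ε hε)) fun X X' hX => ?_
    have a := hsup X ε hε X' (hX.trans (min_le_right _ _))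
    have b := (abs_le.1 (hδ' X X' (hX.trans (min_le_left _ _)))).1
    linarith
  refine ⟨T (pot w) 0 - pot w 0, fun X => ?_⟩
  have : |(T (pot w) X - pot w X) - (T (pot w) 0 - pot w 0)| ≤ 0 := by
    refine le_of_forall_pos_le_add fun ε hε => ?_
    have := hlip (ε / (2 * (|X| + 1))) (by positivity) 0 X
    rw [sub_zero] at this
    refine this.trans ?_
    rw [zero_add]
    have h1 : 2 * (ε / (2 * (|X| + 1))) * |X| = ε * (|X| / (|X| + 1)) := by field_simp
    rw [h1]
    have : |X| / (|X| + 1) ≤ 1 := (div_le_one (by positivity)).2 (by linarith)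
    nlinarith
  have := abs_nonpos_iff.1 this
  linarith

lemma cal (hw : Bdry φ U w) (hfull : Full φ T (U + 1) R r)
    (hinj : Function.Injective φ) (x : ℝ) : Cal T (pot w) x (proj φ w x) := by
  obtain ⟨hr, H⟩ := hfull
  obtain ⟨-, hex, hcal⟩ := H (pot w) (hw.lip_pot.mono (by linarith))
  obtain ⟨x1, hx1⟩ := hex (proj φ w x)
  obtain ⟨-, y, Y, h1, h2, h3⟩ := hcal x1 _ hx1
  have hy : y = w x1 := h2.le_supgrad (pot_hasDerivAt hw.uc.continuous x1).supgrad
  subst hy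
  rw [hw.apply_eq x1] at h1
  obtain ⟨h4, -⟩ := Prod.mk.inj h1
  have : φ (x1, w x1) = φ (x, w x) := by rw [hw.apply_eq, hw.apply_eq, h4]
  have := congrArg Prod.fst (hinj this)
  simp only at this
  rwa [this] at hx1

lemma upper (hw : Bdry φ U w) (hfull : Full φ T (U + 1) R r)
    (hinj : Function.Injective φ) {a : ℝ} (ha : ∀ X, T (pot w) X = pot w X + a)
    {ζ : ℝ → ℝ} (hζ : ∃ Λ, Lip Λ ζ) (x : ℝ) {ε : ℝ} (hε : 0 < ε) {X' : ℝ}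
    (hX' : |X' - proj φ w x| ≤ r ε) :
    T ζ X' ≤ ζ x - pot w x + pot w (proj φ w x) + a +
      w (proj φ w x) * (X' - proj φ w x) + ε * |X' - proj φ w x| := by
  obtain ⟨-, y, Y, h1, h2, h3⟩ :=
    (hfull.2 (pot w) (hw.lip_pot.mono (by linarith))).2.2 x _ (hw.cal hfull hinj x)
  have hy : y = w x := h2.le_supgrad (pot_hasDerivAt hw.uc.continuous x).supgrad
  subst hy
  rw [hw.apply_eq x] at h1
  obtain ⟨-, rfl⟩ := Prod.mk.inj h1
  have := h3 ζ hζ ε hε X' hX'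
  rw [ha] at this
  linarith

lemma proj_add_one (hw : Bdry φ U w) (hφ : ∀ p, φ (Tmap p) = Tmap (φ p)) (x : ℝ) :
    proj φ w (x + 1) = proj φ w x + 1 := by
  unfold proj
  rw [hw.per]
  exact congrArg Prod.fst (hφ (x, w x))

lemma proj_continuous (hw : Bdry φ U w) (hφ : Continuous φ) : Continuous (proj φ w) := by
  have := hw.uc.continuous
  unfold proj
  fun_prop

lemma proj_strictMono (hw : Bdry φ U w) (hc : Continuous φ) (hinj : Function.Injective φ)
    (hφ : ∀ p, φ (Tmap p) = Tmap (φ p)) : StrictMono (proj φ w) := by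
  have : Function.Injective (proj φ w) := by
    intro x x' hx
    have : φ (x, w x) = φ (x', w x') := by rw [hw.apply_eq, hw.apply_eq, hx]
    exact congrArg Prod.fst (hinj this)
  rcases (hw.proj_continuous hc).strictMono_of_inj this with h | h
  · exact h
  · exfalso
    have h1 := h (show (0 : ℝ) < 0 + 1 by norm_num)
    rw [hw.proj_add_one hφ] at h1
    linarith

lemma proj_surjective (hw : Bdry φ U w) : Function.Surjective (proj φ w) := by
  intro X
  have : ((X, w X) : V2) ∈ φ '' {p | p.2 = w p.1} := by rw [hw.inv]; rfl
  obtain ⟨⟨x, y⟩, h1, h2⟩ := this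
  have h1' : y = w x := h1
  subst h1'
  exact ⟨x, congrArg Prod.fst h2⟩

end Bdry

/-- Functions whose differentials lie in the region between two graphs, with uniform
semiconcavity modulus. -/
def State (um up : ℝ → ℝ) (r : ℝ → ℝ) (c : ℝ) (η : ℝ → ℝ) : Prop :=
  (∀ x, η (x + 1) = η x + c) ∧ ∀ X, ∃ Y ∈ Set.Icc (um X) (up X), USup r η X Y

/-- A region bounded by two invariant graphs, without invariant graphs in between, together with
the Lax–Oleinik operator. -/
structure Region (φ : V2 → V2) (T : (ℝ → ℝ) → ℝ → ℝ) (um up : ℝ → ℝ) (U R : ℝ) (r : ℝ → ℝ) :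
    Prop where
  lo : IsLaxOleinik φ T
  full : Full φ T (U + 1) R r
  homeo : ∃ e : V2 ≃ₜ V2, φ = e
  equiv : ∀ p, φ (Tmap p) = Tmap (φ p)
  bm : Bdry φ U um
  bp : Bdry φ U up
  lt : ∀ x, um x < up x
  inv : ∀ x y X Y, φ (x, y) = (X, Y) → y ∈ Set.Icc (um x) (up x) → Y ∈ Set.Icc (um X) (up X)
  birkhoff : ∀ w : ℝ → ℝ, Continuous w → (∀ x, w (x + 1) = w x) →
    φ '' {p : V2 | p.2 = w p.1} = {p : V2 | p.2 = w p.1} →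
    (∀ x, w x ∈ Set.Icc (um x) (up x)) → w = um ∨ w = up

namespace Region
variable {φ : V2 → V2} {T : (ℝ → ℝ) → ℝ → ℝ} {um up : ℝ → ℝ} {U R : ℝ} {r : ℝ → ℝ}
  (h : Region φ T um up U R r)
include h

lemma rpos {ε : ℝ} (hε : 0 < ε) : 0 < r ε := h.full.1 ε hε

lemma injective : Function.Injective φ := by
  obtain ⟨e, rfl⟩ := h.homeo; exact e.injective

lemma continuous : Continuous φ := by
  obtain ⟨e, rfl⟩ := h.homeo; exact e.continuous

lemma abs_le_of_mem {X Y : ℝ} (hY : Y ∈ Set.Icc (um X) (up X)) : |Y| ≤ U := by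
  have := abs_le.1 (h.bm.bd X)
  have := abs_le.1 (h.bp.bd X)
  exact abs_le.2 ⟨by linarith [hY.1], by linarith [hY.2]⟩

lemma state_lip {c : ℝ} {η : ℝ → ℝ} (hη : State um up r c η) : Lip U η := by
  have key : ∀ ε > 0, Lip (U + ε) η := by
    intro ε hε
    refine Lip_of_local (h.rpos hε) fun X X' hX => ?_
    obtain ⟨Y, hY, hs⟩ := hη.2 X
    have a := hs ε hε X' hX
    have b : Y * (X' - X) ≤ U * |X' - X| := by
      refine (le_abs_self _).trans ?_
      rw [abs_mul]
      exact mul_le_mul_of_nonneg_right (h.abs_le_of_mem hY) (abs_nonneg _)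
    linarith
  intro x x'
  refine le_of_forall_pos_le_add fun ε hε => ?_
  have := key (ε / (|x' - x| + 1)) (by positivity) x x'
  rw [add_mul] at this
  refine this.trans ?_
  gcongr
  rw [div_mul_eq_mul_div, div_le_iff₀ (by positivity)]
  nlinarith [abs_nonneg (x' - x)]

lemma state_subgrad {c : ℝ} {η : ℝ → ℝ} (hη : State um up r c η) {x y : ℝ}
    (hy : Subgrad η x y) : y ∈ Set.Icc (um x) (up x) ∧ HasDerivAt η y x := by
  obtain ⟨Y, hY, hs⟩ := hη.2 x
  have hs' := hs.supgrad h.full.1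
  refine ⟨?_, hy.hasDerivAt hs'⟩
  rwa [hy.le_supgrad hs']

lemma state_deriv {c : ℝ} {η : ℝ → ℝ} (hη : State um up r c η) {x y : ℝ}
    (hy : HasDerivAt η y x) : y ∈ Set.Icc (um x) (up x) ∧ USup r η x y := by
  obtain ⟨Y, hY, hs⟩ := hη.2 x
  have := hy.subgrad.le_supgrad (hs.supgrad h.full.1)
  subst this
  exact ⟨hY, hs⟩

lemma used {ζ : ℝ → ℝ} (hζ : Lip (U + 1) ζ) {X Y : ℝ} (hY : HasDerivAt (T ζ) Y X) :
    ∃ x y, Cal T ζ x X ∧ φ (x, y) = (X, Y) ∧ Subgrad ζ x y := by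
  obtain ⟨-, hex, hcal⟩ := h.full.2 ζ hζ
  obtain ⟨x, hx⟩ := hex X
  obtain ⟨-, y, Y', h1, h2, h3⟩ := hcal x X hx
  have : USup r (T ζ) X Y' := fun ε hε X' hX' => by
    have := h3 ζ ⟨_, hζ⟩ ε hε X' hX'
    linarith
  have := hY.subgrad.le_supgrad (this.supgrad h.full.1)
  subst this
  exact ⟨x, y, hx, h1, h2⟩

lemma state_of_used {ζ : ℝ → ℝ} {c : ℝ} (hζ : Lip (U + 1) ζ) (hc : ∀ x, ζ (x + 1) = ζ x + c)
    (hB : ∀ x y X, Cal T ζ x X → Subgrad ζ x y → y ∈ Set.Icc (um x) (up x)) :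
    State um up r c (T ζ) := by
  refine ⟨h.lo.per ⟨_, hζ⟩ hc, fun X => ?_⟩
  obtain ⟨-, hex, hcal⟩ := h.full.2 ζ hζ
  obtain ⟨x, hx⟩ := hex X
  obtain ⟨-, y, Y, h1, h2, h3⟩ := hcal x X hx
  refine ⟨Y, h.inv x y X Y h1 (hB x y X hx h2), fun ε hε X' hX' => ?_⟩
  have := h3 ζ ⟨_, hζ⟩ ε hε X' hX'
  linarith

lemma state_lip1 {c : ℝ} {η : ℝ → ℝ} (hη : State um up r c η) : Lip (U + 1) η :=
  (h.state_lip hη).mono (by linarith)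

lemma state_exLip {c : ℝ} {η : ℝ → ℝ} (hη : State um up r c η) : ∃ Λ, Lip Λ η :=
  ⟨_, h.state_lip hη⟩

lemma state_T {c : ℝ} {η : ℝ → ℝ} (hη : State um up r c η) : State um up r c (T η) :=
  h.state_of_used (h.state_lip1 hη) hη.1 fun _ _ _ _ hy => (h.state_subgrad hη hy).1

lemma state_iterate {c : ℝ} {η : ℝ → ℝ} (hη : State um up r c η) (n : ℕ) :
    State um up r c (T^[n] η) := by
  induction n with
  | zero => exact hη
  | succ n ih => rw [Function.iterate_succ_apply']; exact h.state_T ih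

lemma graph_T {c : ℝ} {η : ℝ → ℝ} (hη : State um up r c η) {X Y : ℝ}
    (hY : HasDerivAt (T η) Y X) : ∃ x y, φ (x, y) = (X, Y) ∧ HasDerivAt η y x := by
  obtain ⟨x, y, -, h1, h2⟩ := h.used (h.state_lip1 hη) hY
  exact ⟨x, y, h1, (h.state_subgrad hη h2).2⟩

lemma graph_iterate {c : ℝ} {η : ℝ → ℝ} (hη : State um up r c η) (n : ℕ) {q : V2}
    (hq : HasDerivAt (T^[n] η) q.2 q.1) : ∃ p : V2, φ^[n] p = q ∧
      ∀ j ≤ n, HasDerivAt (T^[j] η) (φ^[j] p).2 (φ^[j] p).1 := by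
  induction n generalizing q with
  | zero =>
    refine ⟨q, rfl, fun j hj => ?_⟩
    obtain rfl : j = 0 := by omega
    exact hq
  | succ n ih =>
    rw [Function.iterate_succ_apply'] at hq
    obtain ⟨x, y, h1, h2⟩ := h.graph_T (h.state_iterate hη n) hq
    obtain ⟨p, h3, h4⟩ := ih (q := (x, y)) h2
    refine ⟨p, by rw [Function.iterate_succ_apply', h3, h1], fun j hj => ?_⟩
    rcases hj.lt_or_eq with hj | rfl
    · exact h4 j (by omega)
    · rw [Function.iterate_succ_apply', Function.iterate_succ_apply', h3, h1]
      exact hq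

lemma state_add_const {c : ℝ} {η : ℝ → ℝ} (hη : State um up r c η) (a : ℝ) :
    State um up r c fun x => η x + a := by
  refine ⟨fun x => by simp only [hη.1]; ring, fun X => ?_⟩
  obtain ⟨Y, hY, hs⟩ := hη.2 X
  refine ⟨Y, hY, fun ε hε X' hX' => ?_⟩
  have := hs ε hε X' hX'
  simp only
  linarith

lemma state_inf {ι : Type*} {I : Finset ι} (hI : I.Nonempty) {c : ℝ} {η : ι → ℝ → ℝ}
    (hη : ∀ i, State um up r c (η i)) : State um up r c fun x => I.inf' hI fun i => η i x := by
  refine ⟨fun x => ?_, fun X => ?_⟩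
  · have h1 : ∀ i, η i (x + 1) = η i x + c := fun i => (hη i).1 x
    simp only [h1]
    refine le_antisymm ?_ ?_
    · obtain ⟨i, hi, he⟩ := Finset.exists_mem_eq_inf' hI fun i => η i x
      rw [he]
      exact Finset.inf'_le (fun i => η i x + c) hi
    · obtain ⟨i, hi, he⟩ := Finset.exists_mem_eq_inf' hI fun i => η i x + c
      rw [he]
      have := Finset.inf'_le (fun i => η i x) hi
      linarith
  · obtain ⟨i, hi, he⟩ := Finset.exists_mem_eq_inf' hI fun i => η i X
    obtain ⟨Y, hY, hs⟩ := (hη i).2 X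
    refine ⟨Y, hY, fun ε hε X' hX' => ?_⟩
    have a := hs ε hε X' hX'
    have b := Finset.inf'_le (fun i => η i X') hi
    simp only at b ⊢
    rw [he]
    linarith

lemma state_tendsto {ι : Type*} {l : Filter ι} [l.NeBot] {c : ι → ℝ} {c0 : ℝ}
    {η : ι → ℝ → ℝ} {θ : ℝ → ℝ} (hη : ∀ k, State um up r (c k) (η k))
    (hc : Tendsto c l (𝓝 c0)) (hlim : ∀ x, Tendsto (fun k => η k x) l (𝓝 (θ x))) :
    State um up r c0 θ := by
  refine ⟨fun x => ?_, fun X => ?_⟩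
  · refine tendsto_nhds_unique (hlim (x + 1)) ?_
    have h1 : ∀ k, η k (x + 1) = η k x + c k := fun k => (hη k).1 x
    simp only [h1]
    exact (hlim x).add hc
  · choose Y hY hs using fun k => (hη k).2 X
    set F := Ultrafilter.of l
    have hF : (F : Filter ι) ≤ l := Ultrafilter.of_le l
    obtain ⟨Y0, hY0, hYlim⟩ := exists_ultralimit F (a := Y) (Eventually.of_forall hY)
    refine ⟨Y0, hY0, fun ε hε X' hX' => ?_⟩
    refine le_of_tendsto_of_tendsto ((hlim X').mono_left hF)
      ((((hlim X).mono_left hF).add (hYlim.mul_const _)).add_const _)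
      (Eventually.of_forall fun k => hs k ε hε X' hX')

lemma exists_state {c : ℝ} (hc : c ∈ Set.Icc (pot um 1) (pot up 1)) :
    ∃ η, State um up r c η := by
  obtain ⟨t, ht, hct⟩ : ∃ t ∈ Set.Icc (0 : ℝ) 1, (1 - t) * pot um 1 + t * pot up 1 = c := by
    rcases hc.1.trans hc.2 |>.lt_or_eq with hlt | heq
    · refine ⟨(c - pot um 1) / (pot up 1 - pot um 1), ⟨div_nonneg (by linarith [hc.1])
        (by linarith), (div_le_one (by linarith)).2 (by linarith [hc.2])⟩, ?_⟩
      have : pot up 1 - pot um 1 ≠ 0 := by linarith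
      field_simp
      ring
    · exact ⟨0, by simp, by linarith [hc.1, hc.2]⟩
  have hd : ∀ x, HasDerivAt (fun x => (1 - t) * pot um x + t * pot up x)
      ((1 - t) * um x + t * up x) x := fun x =>
    ((pot_hasDerivAt h.bm.uc.continuous x).const_mul _).add
      ((pot_hasDerivAt h.bp.uc.continuous x).const_mul _)
  have hmem : ∀ x, (1 - t) * um x + t * up x ∈ Set.Icc (um x) (up x) := by
    intro x
    have := h.lt x
    constructor <;> nlinarith [ht.1, ht.2]
  have hL : Lip U fun x => (1 - t) * pot um x + t * pot up x :=
    lip_of_deriv hd fun x => h.abs_le_of_mem (hmem x)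
  refine ⟨_, h.state_of_used (hL.mono (by linarith)) (fun x => ?_) fun x y X _ hy => ?_⟩
  · rw [pot_add_one h.bm.uc.continuous h.bm.per, pot_add_one h.bp.uc.continuous h.bp.per]
    linarith
  · rw [hy.le_supgrad (hd x).supgrad]
    exact hmem x

end Region

/-- A quasi-additive sequence is at bounded distance from a linear one. -/
lemma exists_linear_of_quasiadditive {b : ℕ → ℝ} {C : ℝ} (h0 : b 0 = 0)
    (hb : ∀ m n, |b (m + n) - b m - b n| ≤ C) : ∃ a, ∀ n : ℕ, |b n - n * a| ≤ C := by
  have hC : 0 ≤ C := (abs_nonneg _).trans (hb 0 0)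
  have mul : ∀ n m : ℕ, |b (m * n) - m * b n| ≤ m * C := by
    intro n m
    induction m with
    | zero => simp [h0]
    | succ m ih =>
      have h1 := hb (m * n) n
      rw [Nat.succ_mul]
      push_cast
      have : b (m * n + n) - (m + 1) * b n = (b (m * n + n) - b (m * n) - b n) +
        (b (m * n) - m * b n) := by ring
      rw [this]
      refine (abs_add_le _ _).trans ?_
      linarith
  have cross : ∀ m n : ℕ, (b (n + 1) - C) / (n + 1 : ℕ) ≤ (b (m + 1) + C) / (m + 1 : ℕ) := by
    intro m n
    rw [div_le_div_iff₀ (by positivity) (by positivity)]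
    have h1 := (abs_le.1 (mul (n + 1) (m + 1))).1
    have h2 := (abs_le.1 (mul (m + 1) (n + 1))).2
    rw [mul_comm (n + 1) (m + 1)] at h2
    nlinarith
  have hbdd : BddAbove (Set.range fun n : ℕ => (b (n + 1) - C) / (n + 1 : ℕ)) :=
    ⟨(b 1 + C) / (0 + 1 : ℕ), by rintro _ ⟨n, rfl⟩; exact cross 0 n⟩
  refine ⟨⨆ n : ℕ, (b (n + 1) - C) / (n + 1 : ℕ), fun n => ?_⟩
  rcases n with _ | n
  · simpa [h0] using hC
  · have h1 := le_ciSup hbdd n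
    have h2 : (⨆ n : ℕ, (b (n + 1) - C) / (n + 1 : ℕ)) ≤ (b (n + 1) + C) / (n + 1 : ℕ) :=
      ciSup_le fun m => cross n m
    rw [div_le_iff₀ (by positivity)] at h1
    rw [le_div_iff₀ (by positivity)] at h2
    rw [abs_le]
    constructor <;> linarith

lemma periodic_of_class {η ζ : ℝ → ℝ} {c : ℝ} (hη : ∀ x, η (x + 1) = η x + c)
    (hζ : ∀ x, ζ (x + 1) = ζ x + c) (x : ℝ) : η x - ζ x = η (Int.fract x) - ζ (Int.fract x) := by
  have : Function.Periodic (fun x => η x - ζ x) 1 := fun x => by simp only [hη, hζ]; ring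
  have := this.sub_int_mul_eq (x := x) ⌊x⌋
  simp only [mul_one] at this
  exact this.symm

lemma class_int {η : ℝ → ℝ} {c : ℝ} (hη : ∀ x, η (x + 1) = η x + c) (x : ℝ) (n : ℤ) :
    η (x + n) = η x + n * c := by
  have : Function.Periodic (fun x => η x - c * x) 1 := fun x => by simp only [hη]; ring
  have := this.int_mul n x
  simp only [mul_one] at this
  linarith

lemma close_of_class {η ζ : ℝ → ℝ} {c κ K : ℝ} (hK : 1 ≤ K) (hη : ∀ x, η (x + 1) = η x + c)
    (hζ : ∀ x, ζ (x + 1) = ζ x + c) (h : ∀ x, |x| ≤ K → |η x - ζ x| ≤ κ) (x : ℝ) :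
    |η x - ζ x| ≤ κ := by
  rw [periodic_of_class hη hζ]
  refine h _ ?_
  rw [abs_of_nonneg (Int.fract_nonneg x)]
  exact (Int.fract_lt_one x).le.trans hK

lemma Cal.add_one {φ : V2 → V2} {T : (ℝ → ℝ) → ℝ → ℝ} (h : IsLaxOleinik φ T) {η : ℝ → ℝ} {c : ℝ}
    (hL : ∃ Λ, Lip Λ η) (hη : ∀ x, η (x + 1) = η x + c) {x X : ℝ} (hc : Cal T η x X) :
    Cal T η (x + 1) (X + 1) ∧ Cal T η (x - 1) (X - 1) := by
  have hp := h.per hL hη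
  refine ⟨fun ζ hζ => ?_, fun ζ hζ => ?_⟩
  · have hζ' : ∃ Λ, Lip Λ fun x => ζ (x + 1) := hζ.imp fun Λ h x x' => by
      simpa using h (x + 1) (x' + 1)
    have a := hc _ hζ'
    rw [h.shift ζ hζ] at a
    rw [hη, hp]
    linarith
  · have hζ' : ∃ Λ, Lip Λ fun x => ζ (x - 1) := hζ.imp fun Λ h x x' => by
      simpa using h (x - 1) (x' - 1)
    have a := hc _ hζ'
    have b := congrFun (h.shift _ hζ') (X - 1)
    simp only [add_sub_cancel_right, sub_add_cancel] at b
    have e1 := hη (x - 1)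
    have e2 := hp (X - 1)
    rw [sub_add_cancel] at e1 e2
    have e3 : (fun x => ζ x) = ζ := rfl
    rw [e3] at b
    linarith

lemma Cal.add_int {φ : V2 → V2} {T : (ℝ → ℝ) → ℝ → ℝ} (h : IsLaxOleinik φ T) {η : ℝ → ℝ} {c : ℝ}
    (hL : ∃ Λ, Lip Λ η) (hη : ∀ x, η (x + 1) = η x + c) {x X : ℝ} (hc : Cal T η x X) (n : ℤ) :
    Cal T η (x + n) (X + n) := by
  induction n with
  | zero => simpa using hc
  | succ i ih =>
    have := (ih.add_one h hL hη).1
    push_cast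
    rwa [add_assoc, add_assoc] at this
  | pred i ih =>
    have := (ih.add_one h hL hη).2
    push_cast at this ⊢
    rwa [add_sub_assoc, add_sub_assoc] at this

/-- A periodic bump, integrated. -/
lemma exists_bump (x₀ : ℝ) {ρ : ℝ} (hρ : 0 < ρ) : ∃ (m m' : ℝ → ℝ) (M : ℝ),
    (∀ x, HasDerivAt m (m' x) x) ∧ (∀ x, |m' x| ≤ M) ∧ (∀ x, m (x + 1) = m x + 1) ∧
    ∀ x, (∀ k : ℤ, ρ ≤ |x + k - x₀|) → m' x = 0 := by
  set ρ' := min ρ (1 / 2) with hρ'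
  have hρ'0 : 0 < ρ' := by positivity
  have hρ'1 : ρ' ≤ 1 / 2 := min_le_right _ _
  have hπ := Real.pi_pos
  set b : ℝ → ℝ := fun x => max 0 (Real.cos (2 * Real.pi * (x - x₀)) - Real.cos (2 * Real.pi * ρ'))
    with hb
  have hbc : Continuous b := by fun_prop
  have hbp : ∀ x, b (x + 1) = b x := by
    intro x
    simp only [hb]
    have : 2 * Real.pi * (x + 1 - x₀) = 2 * Real.pi * (x - x₀) + 2 * Real.pi := by ring
    rw [this, Real.cos_add_two_pi]
  have hI : 0 < pot b 1 := by
    refine intervalIntegral.integral_pos one_pos hbc.continuousOn (fun x _ => le_max_left _ _)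
      ⟨Int.fract x₀, ⟨Int.fract_nonneg _, (Int.fract_lt_one _).le⟩, ?_⟩
    have hp : Function.Periodic b 1 := hbp
    have := hp.sub_int_mul_eq (x := x₀) ⌊x₀⌋
    rw [mul_one] at this
    rw [← Int.self_sub_floor, this]
    refine lt_max_of_lt_right ?_
    rw [sub_self, mul_zero, Real.cos_zero]
    have := Real.cos_lt_cos_of_nonneg_of_le_pi (x := 0) (y := 2 * Real.pi * ρ') le_rfl
      (by nlinarith) (by positivity)
    rw [Real.cos_zero] at this
    linarith
  refine ⟨fun x => pot b x / pot b 1, fun x => b x / pot b 1, 2 / pot b 1,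
    fun x => (pot_hasDerivAt hbc x).div_const _, fun x => ?_, fun x => ?_, fun x hx => ?_⟩
  · rw [abs_div, abs_of_pos hI]
    gcongr
    rw [abs_of_nonneg (le_max_left _ _)]
    refine max_le (by norm_num) ?_
    linarith [Real.cos_le_one (2 * Real.pi * (x - x₀)), Real.neg_one_le_cos (2 * Real.pi * ρ')]
  · change pot b (x + 1) / pot b 1 = pot b x / pot b 1 + 1
    rw [pot_add_one hbc hbp]
    field_simp
  · have : b x = 0 := by
      refine max_eq_left ?_
      set t := x - x₀ with ht
      have h1 : Real.cos (2 * Real.pi * t) = Real.cos (2 * Real.pi * |t - round t|) := by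
        have : 2 * Real.pi * |t - round t| = |2 * Real.pi * t - round t * (2 * Real.pi)| := by
          rw [show 2 * Real.pi * t - round t * (2 * Real.pi) = 2 * Real.pi * (t - round t) by ring,
            abs_mul, abs_of_pos (by positivity : (0 : ℝ) < 2 * Real.pi)]
        rw [this, Real.cos_abs, Real.cos_sub_int_mul_two_pi]
      have h2 : ρ' ≤ |t - round t| := by
        have := hx (-round t)
        refine (min_le_left _ _).trans (this.trans_eq ?_)
        push_cast
        congr 1
        rw [ht]; ring
      have h3 : |t - round t| ≤ 1 / 2 := abs_sub_round t
      have := Real.cos_le_cos_of_nonneg_of_le_pi (x := 2 * Real.pi * ρ')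
        (y := 2 * Real.pi * |t - round t|) (by positivity) (by nlinarith) (by gcongr)
      linarith
    simp [this]

lemma IsLaxOleinik.map_inf {φ : V2 → V2} {T : (ℝ → ℝ) → ℝ → ℝ} (h : IsLaxOleinik φ T)
    {ι : Type*} {I : Finset ι} (hI : I.Nonempty) {Λ : ℝ} {η : ι → ℝ → ℝ} (hη : ∀ i, Lip Λ (η i))
    (hL : Lip Λ fun x => I.inf' hI fun i => η i x) (X : ℝ) :
    T (fun x => I.inf' hI fun i => η i x) X = I.inf' hI fun i => T (η i) X := by
  refine le_antisymm ?_ ?_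
  · refine Finset.le_inf' _ _ fun i hi => ?_
    have := h.le_add (κ := 0) ⟨_, hη i⟩ ⟨_, hL⟩ (fun x => by
      have := Finset.inf'_le (fun i => η i x) hi
      linarith) X
    linarith
  · obtain ⟨R, r, hr, H⟩ := h.full Λ
    obtain ⟨x, hx⟩ := (H _ hL).2.1 X
    obtain ⟨i, hi, he⟩ := Finset.exists_mem_eq_inf' hI fun i => η i x
    have a := hx (η i) ⟨_, hη i⟩
    have b := Finset.inf'_le (fun i => T (η i) X) hi
    simp only at a b he
    linarith

namespace Region
variable {φ : V2 → V2} {T : (ℝ → ℝ) → ℝ → ℝ} {um up : ℝ → ℝ} {U R : ℝ} {r : ℝ → ℝ}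
  (h : Region φ T um up U R r)
include h

lemma U_nonneg : 0 ≤ U := (abs_nonneg _).trans (h.bm.bd 0)

lemma state_osc {c : ℝ} {η ζ : ℝ → ℝ} (hη : State um up r c η) (hζ : State um up r c ζ) (x : ℝ) :
    |η x - ζ x - (η 0 - ζ 0)| ≤ 2 * U := by
  rw [periodic_of_class hη.1 hζ.1]
  have hU := h.U_nonneg
  have h1 := h.state_lip hη 0 (Int.fract x)
  have h2 := h.state_lip hζ 0 (Int.fract x)
  have h3 : |Int.fract x - 0| ≤ 1 := by
    rw [sub_zero, abs_of_nonneg (Int.fract_nonneg x)]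
    exact (Int.fract_lt_one x).le
  have h4 : U * |Int.fract x - 0| ≤ U := mul_le_of_le_one_right hU h3
  rw [abs_le] at *
  constructor <;> linarith

lemma exists_growth {c : ℝ} {η : ℝ → ℝ} (hη : State um up r c η) :
    ∃ a, ∀ (n : ℕ) x, |T^[n] η x - n * a - η x| ≤ 4 * U := by
  set b : ℕ → ℝ := fun n => T^[n] η 0 - η 0 with hb
  have hn : ∀ n x, |T^[n] η x - η x - b n| ≤ 2 * U := fun n x =>
    h.state_osc (h.state_iterate hη n) hη x
  obtain ⟨a, ha⟩ := exists_linear_of_quasiadditive (b := b) (C := 2 * U) (by simp [hb]) (by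
    intro m n
    have hL := h.state_exLip hη
    have hLn := h.state_exLip (h.state_iterate hη n)
    have e1 := congrFun (h.lo.iterate_add_const hL (b n) m) 0
    have hL' : ∃ Λ, Lip Λ fun x => η x + b n := hL.imp fun Λ h => h.add_const _
    have u1 := h.lo.iterate_le_add (κ := 2 * U) hL' hLn
      (fun x => by linarith [(abs_le.1 (hn n x)).2]) m 0
    have u2 := h.lo.iterate_le_add (κ := 2 * U) hLn hL'
      (fun x => by linarith [(abs_le.1 (hn n x)).1]) m 0
    rw [← Function.iterate_add_apply] at u1 u2
    rw [e1] at u1 u2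
    have e2 : b (m + n) = T^[m + n] η 0 - η 0 := rfl
    have e3 : b m = T^[m] η 0 - η 0 := rfl
    rw [abs_le]
    constructor <;> linarith)
  refine ⟨a, fun n x => ?_⟩
  have h1 := abs_le.1 (hn n x)
  have h2 := abs_le.1 (ha n)
  rw [abs_le]
  constructor <;> linarith [h1.1, h1.2, h2.1, h2.2]

/-- Existence of fixed points (up to constants) as iterated minima of forward iterates. -/
theorem exists_fixed {c : ℝ} {η : ℝ → ℝ} (hη : State um up r c η) :
    ∃ a θ, State um up r c θ ∧ (∀ X, T θ X = θ X + a) ∧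
      ∀ (L : ℕ), ∀ κ > 0, ∃ (I : Finset ℕ) (hI : I.Nonempty), (∀ n ∈ I, L ≤ n) ∧
        ∀ x, |(I.inf' hI fun n => T^[n] η x - n * a) - θ x| ≤ κ := by
  obtain ⟨a, ha⟩ := h.exists_growth hη
  set f : ℕ → ℝ → ℝ := fun n x => T^[n] η x - n * a with hf
  have hfs : ∀ n, State um up r c (f n) := by
    intro n
    have := h.state_add_const (h.state_iterate hη n) (-(n * a))
    simpa [hf, sub_eq_add_neg] using this
  have hTf : ∀ n X, T (f n) X = f (n + 1) X + a := by
    intro n X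
    have := congrFun (h.lo.add_const (h.state_exLip (h.state_iterate hη n)) (-(n * a))) X
    simp only [hf, Function.iterate_succ_apply', sub_eq_add_neg] at this ⊢
    rw [this]
    push_cast
    ring
  have hne : ∀ N M : ℕ, (Finset.Icc N (N + M)).Nonempty := fun N M => ⟨N, by simp⟩
  set g : ℕ → ℕ → ℝ → ℝ := fun N M x => (Finset.Icc N (N + M)).inf' (hne N M) fun n => f n x
    with hg
  have hgs : ∀ N M, State um up r c (g N M) := fun N M => h.state_inf (hne N M) hfs
  have hlo : ∀ n x, η x - 4 * U ≤ f n x := fun n x => by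
    have := (abs_le.1 (ha n x)).1
    simp only [hf]; linarith
  have hhi : ∀ n x, f n x ≤ η x + 4 * U := fun n x => by
    have := (abs_le.1 (ha n x)).2
    simp only [hf]; linarith
  have hglo : ∀ N M x, η x - 4 * U ≤ g N M x := fun N M x =>
    Finset.le_inf' _ _ fun n _ => hlo n x
  have hghi : ∀ N M x, g N M x ≤ f N x := fun N M x =>
    Finset.inf'_le (fun n => f n x) (by simp)
  have hganti : ∀ N x, Antitone fun M => g N M x := by
    intro N x M M' hM
    exact Finset.inf'_mono _ (Finset.Icc_subset_Icc_right (by omega)) (hne N M)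
  have hlim : ∀ N x, Tendsto (fun M => g N M x) atTop (𝓝 (⨅ M, g N M x)) := fun N x =>
    tendsto_atTop_ciInf (hganti N x) ⟨η x - 4 * U, by rintro _ ⟨M, rfl⟩; exact hglo N M x⟩
  set Θ : ℕ → ℝ → ℝ := fun N x => ⨅ M, g N M x with hΘ
  have hΘs : ∀ N, State um up r c (Θ N) := fun N =>
    h.state_tendsto (hgs N) tendsto_const_nhds (hlim N)
  have hΘhi : ∀ N x, Θ N x ≤ η x + 4 * U := fun N x =>
    le_of_tendsto (hlim N x) (Eventually.of_forall fun M => (hghi N M x).trans (hhi N x))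
  have hΘmono : ∀ x, Monotone fun N => Θ N x := by
    intro x
    refine monotone_nat_of_le_succ fun N => ?_
    refine ge_of_tendsto (hlim (N + 1) x) (Eventually.of_forall fun M => ?_)
    refine le_trans (ge_of_tendsto (b := Θ N x) (hlim N x) (Eventually.of_forall fun M' => ?_) |>.trans
      (le_refl (Θ N x))) ?_
    · exact (hganti N x).le_of_tendsto (hlim N x) M'
    · refine ((hganti N x).le_of_tendsto (hlim N x) (M + 1)).trans ?_
      exact Finset.inf'_mono _ (Finset.Icc_subset_Icc (by omega) (by omega)) (hne (N + 1) M)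
  have hlim2 : ∀ x, Tendsto (fun N => Θ N x) atTop (𝓝 (⨆ N, Θ N x)) := fun x =>
    tendsto_atTop_ciSup (hΘmono x) ⟨η x + 4 * U, by rintro _ ⟨M, rfl⟩; exact hΘhi M x⟩
  set θ : ℝ → ℝ := fun x => ⨆ N, Θ N x with hθ
  have hθs : State um up r c θ := h.state_tendsto hΘs tendsto_const_nhds hlim2
  have hTg : ∀ N M X, T (g N M) X = g (N + 1) M X + a := by
    intro N M X
    have := h.lo.map_inf (hne N M) (Λ := U) (fun n => h.state_lip (hfs n))
      (h.state_lip (hgs N M)) X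
    simp only [hg]
    rw [this]
    simp only [hTf]
    refine le_antisymm ?_ ?_
    · obtain ⟨i, hi, he⟩ := Finset.exists_mem_eq_inf' (hne (N + 1) M) fun n => f n X
      rw [he]
      have hi' := Finset.mem_Icc.1 hi
      have := Finset.inf'_le (fun n => f (n + 1) X + a) (s := Finset.Icc N (N + M)) (b := i - 1)
        (Finset.mem_Icc.2 ⟨by omega, by omega⟩)
      rwa [Nat.sub_add_cancel (by omega)] at this
    · obtain ⟨i, hi, he⟩ := Finset.exists_mem_eq_inf' (hne N M) fun n => f (n + 1) X + a
      rw [he]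
      have hi' := Finset.mem_Icc.1 hi
      have := Finset.inf'_le (fun n => f n X) (s := Finset.Icc (N + 1) (N + 1 + M)) (b := i + 1)
        (Finset.mem_Icc.2 ⟨by omega, by omega⟩)
      linarith
  have hTΘ : ∀ N X, T (Θ N) X = Θ (N + 1) X + a := by
    intro N X
    have h1 := h.lo.tendsto (fun M => h.state_lip (hgs N M)) (hlim N) X
    simp only [hTg] at h1
    exact tendsto_nhds_unique h1 ((hlim (N + 1) X).add_const a)
  refine ⟨a, θ, hθs, fun X => ?_, fun L κ hκ => ?_⟩
  · have h1 := h.lo.tendsto (fun M => h.state_lip (hΘs M)) hlim2 X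
    simp only [hTΘ] at h1
    exact tendsto_nhds_unique h1 (((hlim2 X).comp (tendsto_add_atTop_nat 1)).add_const a)
  · obtain ⟨N, hN1, hN2⟩ := ((eventually_close (fun M => h.state_lip (hΘs M)) (h.state_lip hθs)
      hlim2 1 (half_pos hκ)).and (eventually_ge_atTop L)).exists
    obtain ⟨M, hM⟩ := (eventually_close (fun M => h.state_lip (hgs N M)) (h.state_lip (hΘs N))
      (hlim N) 1 (half_pos hκ)).exists
    refine ⟨Finset.Icc N (N + M), hne N M, fun n hn => hN2.trans (Finset.mem_Icc.1 hn).1,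
      fun x => ?_⟩
    have h1 := abs_le.1 (close_of_class le_rfl (hΘs N).1 hθs.1 hN1 x)
    have h2 := abs_le.1 (close_of_class le_rfl (hgs N M).1 (hΘs N).1 hM x)
    have : g N M x = (Finset.Icc N (N + M)).inf' (hne N M) fun n => T^[n] η x - n * a := rfl
    rw [← this, abs_le]
    constructor <;> linarith [h1.1, h1.2, h2.1, h2.2]

/-- A fixed point of intermediate class has a point which is not the origin of any minimizing
segment. -/
theorem exists_gap {c a : ℝ} {θ : ℝ → ℝ} (hθ : State um up r c θ) (hfix : ∀ X, T θ X = θ X + a)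
    (hm : c ≠ pot um 1) (hp : c ≠ pot up 1) : ∃ x₀, ∀ X, ¬ Cal T θ x₀ X := by
  by_contra! hcon
  obtain ⟨-, hex, hcal⟩ := h.full.2 θ (h.state_lip1 hθ)
  have hd : ∀ x X, Cal T θ x X → ∃ y Y, φ (x, y) = (X, Y) ∧ HasDerivAt θ y x ∧ USup r θ X Y := by
    intro x X hx
    obtain ⟨-, y, Y, h1, h2, h3⟩ := hcal x X hx
    refine ⟨y, Y, h1, (h.state_subgrad hθ h2).2, fun ε hε X' hX' => ?_⟩
    have := h3 θ (h.state_exLip hθ) ε hε X' hX'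
    rw [hfix, hfix] at this
    linarith
  have hd' : ∀ x, ∃ y, HasDerivAt θ y x := by
    intro x
    obtain ⟨X, hX⟩ := hcon x
    obtain ⟨y, -, -, hy, -⟩ := hd x X hX
    exact ⟨y, hy⟩
  choose w hw using hd'
  have hws : ∀ x, w x ∈ Set.Icc (um x) (up x) ∧ USup r θ x (w x) := fun x =>
    h.state_deriv hθ (hw x)
  have hwc : Continuous w := by
    rw [continuous_iff_continuousAt]
    intro x
    rw [ContinuousAt, tendsto_iff_ultrafilter]
    intro F hF
    obtain ⟨Y, -, hY⟩ := exists_ultralimit F (a := w) (lo := -U) (hi := U)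
      (Eventually.of_forall fun x => abs_le.1 (h.abs_le_of_mem (hws x).1))
    have hθc := (h.state_lip hθ).continuous
    have hlim : Tendsto (fun x : ℝ => x) F (𝓝 x) := hF
    have : USup r θ x Y := by
      intro ε hε X' hX'
      have h1 : Tendsto (fun z => θ (z + (X' - x))) F (𝓝 (θ X')) := by
        have : Tendsto (fun z => θ (z + (X' - x))) F (𝓝 (θ (x + (X' - x)))) :=
          (hθc.tendsto _).comp (hlim.add_const _)
        rwa [add_sub_cancel] at this
      refine le_of_tendsto_of_tendsto h1
        ((((hθc.tendsto x).comp hlim).add (hY.mul_const _)).add_const _)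
        (Eventually.of_forall fun z => ?_)
      have := (hws z).2 ε hε (z + (X' - x)) (by simpa using hX')
      simpa using this
    have := (hw x).subgrad.le_supgrad (this.supgrad h.full.1)
    rwa [this]
  have hwp : ∀ x, w (x + 1) = w x := by
    intro x
    have h1 := (hw (x + 1)).comp_add_const x 1
    have h2 : (fun x => θ (x + 1)) = fun x => θ x + c := funext hθ.1
    rw [h2] at h1
    exact h1.unique ((hw x).add_const c)
  have hYw : ∀ x X, Cal T θ x X → φ (x, w x) = (X, w X) := by
    intro x X hx
    obtain ⟨y, Y, h1, h2, h3⟩ := hd x X hx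
    rw [(hw x).unique h2, h1, (hw X).subgrad.le_supgrad (h3.supgrad h.full.1)]
  have hinv : φ '' {p : V2 | p.2 = w p.1} = {p : V2 | p.2 = w p.1} := by
    ext ⟨X, Y⟩
    constructor
    · rintro ⟨⟨x, y⟩, hy, he⟩
      have hy' : y = w x := hy
      subst hy'
      obtain ⟨X1, hX1⟩ := hcon x
      rw [hYw x X1 hX1] at he
      obtain ⟨rfl, rfl⟩ := Prod.mk.inj he
      rfl
    · intro hY
      have hY' : Y = w X := hY
      subst hY'
      obtain ⟨x, hx⟩ := hex X
      exact ⟨(x, w x), rfl, hYw x X hx⟩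
  have fin : ∀ u : ℝ → ℝ, Continuous u → w = u → c = pot u 1 := by
    rintro u hu rfl
    have h1 : ∀ x, HasDerivAt (fun x => θ x - pot w x) 0 x := fun x => by
      have := (hw x).sub (pot_hasDerivAt hu x)
      rwa [sub_self] at this
    have h2 := is_const_of_deriv_eq_zero (fun x => (h1 x).differentiableAt)
      (fun x => (h1 x).deriv) (0 + 1) 0
    have h3 := hθ.1 0
    have h4 : pot w 0 = 0 := intervalIntegral.integral_same
    rw [zero_add] at h2 h3
    linarith
  rcases h.birkhoff w hwc hwp hinv fun x => (hws x).1 with e | e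
  · exact hm (fin um h.bm.uc.continuous e)
  · exact hp (fin up h.bp.uc.continuous e)

/-- Gaps persist under perturbation. -/
theorem gap_stable {θ : ℝ → ℝ} {x₀ : ℝ} (hgap : ∀ X, ¬ Cal T θ x₀ X) :
    ∃ ρ > 0, ∃ κ > 0, ∃ K, ∀ ζ c, Lip (U + 1) ζ → (∀ x, ζ (x + 1) = ζ x + c) →
      (∀ x, |x| ≤ K → |ζ x - θ x| ≤ κ) →
      ∀ x X, Cal T ζ x X → ∀ k : ℤ, ρ ≤ |x + k - x₀| := by
  by_contra! hcon
  have hpos : ∀ k : ℕ, (0 : ℝ) < 1 / (k + 1) := fun k => by positivity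
  choose ζ c hζ hc hclose x X hcal m hx using
    fun k : ℕ => hcon (1 / (k + 1)) (hpos k) (1 / (k + 1)) (hpos k) k
  have hcal' : ∀ k, Cal T (ζ k) (x k + m k) (X k + m k) := fun k =>
    (hcal k).add_int h.lo ⟨_, hζ k⟩ (hc k) (m k)
  have hlimx : Tendsto (fun k => x k + m k) atTop (𝓝 x₀) := by
    rw [tendsto_iff_norm_sub_tendsto_zero]
    exact squeeze_zero (fun k => norm_nonneg _) (fun k => (hx k).le)
      tendsto_one_div_add_atTop_nhds_zero_nat
  have hlimζ : ∀ x, Tendsto (fun k => ζ k x) atTop (𝓝 (θ x)) := by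
    intro x
    rw [tendsto_iff_norm_sub_tendsto_zero]
    refine squeeze_zero' (Eventually.of_forall fun k => norm_nonneg _) ?_
      tendsto_one_div_add_atTop_nhds_zero_nat
    obtain ⟨n, hn⟩ := exists_nat_ge |x|
    filter_upwards [eventually_ge_atTop n] with k hk
    exact hclose k x (hn.trans (by exact_mod_cast hk))
  set F := hyperfilter ℕ
  have hF : (F : Filter ℕ) ≤ atTop := Nat.hyperfilter_le_atTop
  obtain ⟨X0, -, hX0⟩ := exists_ultralimit F (a := fun k => X k + m k) (lo := x₀ - 1 - R)
    (hi := x₀ + 1 + R) (Eventually.of_forall fun k => by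
      have h1 := abs_le.1 (((h.full.2 (ζ k) (hζ k)).2.2 _ _ (hcal' k)).1)
      have h2 := abs_lt.1 (hx k)
      have h3 : (1 : ℝ) / (k + 1) ≤ 1 := by
        rw [div_le_one (by positivity)]; linarith [(Nat.cast_nonneg k : (0 : ℝ) ≤ k)]
      constructor <;> linarith [h1.1, h1.2, h2.1, h2.2])
  exact hgap X0 (Cal.of_tendsto h.lo hζ (fun x => (hlimζ x).mono_left hF) (hlimx.mono_left hF) hX0
    (Eventually.of_forall hcal'))

end Region

lemma Subgrad.of_le {η ζ : ℝ → ℝ} {x y b : ℝ} (h : Subgrad η x y) (hle : ∀ x', η x' ≤ ζ x' + b)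
    (he : η x = ζ x + b) : Subgrad ζ x y := by
  intro ε hε
  filter_upwards [h ε hε] with x' hx'
  linarith [hle x']

lemma Subgrad.add_flat {η m : ℝ → ℝ} {x y s : ℝ} (h : Subgrad (fun x => η x + s * m x) x y)
    (hm : HasDerivAt m 0 x) : Subgrad η x y := by
  intro ε hε
  have h1 : HasDerivAt (fun x => s * m x) 0 x := by simpa using hm.const_mul s
  filter_upwards [h (ε / 2) (by positivity), h1.both (ε / 2) (by positivity)] with x' h2 h3
  have := abs_le.1 h3
  linarith [this.2]

namespace Region
variable {φ : V2 → V2} {T : (ℝ → ℝ) → ℝ → ℝ} {um up : ℝ → ℝ} {U R : ℝ} {r : ℝ → ℝ}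
  (h : Region φ T um up U R r)
include h

lemma tendsto_iterate {l : Filter ℕ} [l.NeBot] {c : ℕ → ℝ} {η : ℕ → ℝ → ℝ} {θ : ℝ → ℝ}
    (hη : ∀ k, State um up r (c k) (η k)) (hlim : ∀ x, Tendsto (fun k => η k x) l (𝓝 (θ x)))
    (n : ℕ) : ∀ x, Tendsto (fun k => T^[n] (η k) x) l (𝓝 (T^[n] θ x)) := by
  induction n with
  | zero => exact hlim
  | succ n ih =>
    simp only [Function.iterate_succ_apply']
    exact h.lo.tendsto (fun k => h.state_lip (h.state_iterate (hη k) n)) ih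

lemma state_inf_iterate {I : Finset ℕ} (hI : I.Nonempty) {c : ℝ} {η : ℝ → ℝ}
    (hη : State um up r c η) (a : ℝ) :
    State um up r c fun x => I.inf' hI fun n => T^[n] η x - n * a := by
  simp only [sub_eq_add_neg]
  exact h.state_inf hI fun n => h.state_add_const (h.state_iterate hη n) _

/-- The raw data of a step from the class `c'` to the class `c''`. -/
theorem step {c : ℝ} (hc : c ∈ Set.Ioo (pot um 1) (pot up 1)) (L : ℕ) (K : ℝ) {κ : ℝ}
    (hκ : 0 < κ) : ∃ N : ℕ, ∃ δ > 0, ∀ c' c'', |c' - c| < δ → |c'' - c| < δ →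
      ∀ η, State um up r c' η → ∃ η', State um up r c'' η' ∧
        (∀ q : V2, HasDerivAt η' q.2 q.1 → ∃ n, 1 ≤ n ∧ n ≤ N ∧ ∃ p, φ^[n] p = q ∧
          ∀ j < n, HasDerivAt (T^[j] η) (φ^[j] p).2 (φ^[j] p).1) ∧
        ∃ ζ, Lip (U + 1) ζ ∧ (∀ x, ζ (x + 1) = ζ x + c'') ∧ η' = T ζ ∧
          ∃ (I : Finset ℕ) (hI : I.Nonempty), (∀ n ∈ I, L ≤ n) ∧ ∃ a : ℝ, ∀ x, |x| ≤ K →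
            |ζ x - I.inf' hI fun n => T^[n] η x - n * a| ≤ κ := by
  by_contra! hcon
  have hpos : ∀ k : ℕ, (0 : ℝ) < 1 / (k + 1) := fun k => by positivity
  choose c' c'' hc' hc'' η hη hbad using fun k : ℕ => hcon k (1 / (k + 1)) (hpos k)
  set F := hyperfilter ℕ
  have hF : (F : Filter ℕ) ≤ atTop := Nat.hyperfilter_le_atTop
  have hlim1 : Tendsto c' F (𝓝 c) := by
    refine Tendsto.mono_left ?_ hF
    rw [tendsto_iff_norm_sub_tendsto_zero]
    exact squeeze_zero (fun k => norm_nonneg _) (fun k => (hc' k).le)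
      tendsto_one_div_add_atTop_nhds_zero_nat
  have hlim2 : Tendsto c'' F (𝓝 c) := by
    refine Tendsto.mono_left ?_ hF
    rw [tendsto_iff_norm_sub_tendsto_zero]
    exact squeeze_zero (fun k => norm_nonneg _) (fun k => (hc'' k).le)
      tendsto_one_div_add_atTop_nhds_zero_nat
  have hη0 : ∀ k, State um up r (c' k) fun x => η k x + -η k 0 := fun k =>
    h.state_add_const (hη k) _
  obtain ⟨θ₀, hθ₀⟩ := exists_ultralimit_fun F (C := 0) (fun k => h.state_lip (hη0 k))
    (fun k => by simp)
  have hθ₀s : State um up r c θ₀ := h.state_tendsto hη0 hlim1 hθ₀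
  obtain ⟨a, θ, hθ, hfix, hI⟩ := h.exists_fixed hθ₀s
  obtain ⟨x₀, hx₀⟩ := h.exists_gap hθ hfix hc.1.ne' hc.2.ne
  obtain ⟨ρ, hρ, κ', hκ', K', hgap⟩ := h.gap_stable hx₀
  obtain ⟨m, m', M, hm, hM, hmp, hm0⟩ := exists_bump x₀ hρ
  obtain ⟨I, hIne, hIL, hIθ⟩ := hI L (κ' / 3) (by positivity)
  set Θ : ℕ → ℝ → ℝ := fun k x => I.inf' hIne fun n => T^[n] (η k) x - n * a with hΘ
  have hΘs : ∀ k, State um up r (c' k) (Θ k) := fun k => h.state_inf_iterate hIne (hη k) a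
  set Θ₀ : ℕ → ℝ → ℝ := fun k x => Θ k x + -η k 0 with hΘ₀
  have hΘ₀s : ∀ k, State um up r (c' k) (Θ₀ k) := fun k => h.state_add_const (hΘs k) _
  have hΘ₀e : ∀ k x, Θ₀ k x = I.inf' hIne fun n => T^[n] (fun x => η k x + -η k 0) x - n * a := by
    intro k x
    have : (fun n : ℕ => T^[n] (fun x => η k x + -η k 0) x - n * a) =
        fun n => (T^[n] (η k) x - n * a) + -η k 0 := by
      funext n
      rw [h.lo.iterate_add_const (h.state_exLip (hη k))]
      ring
    rw [this]
    simp only [hΘ₀, hΘ]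
    refine le_antisymm ?_ ?_
    · refine Finset.le_inf' _ _ fun n hn => ?_
      have := Finset.inf'_le (fun n : ℕ => T^[n] (η k) x - n * a) hn
      linarith
    · obtain ⟨n, hn, he⟩ := Finset.exists_mem_eq_inf' hIne fun n : ℕ => T^[n] (η k) x - n * a
      rw [he]
      exact Finset.inf'_le (fun n : ℕ => T^[n] (η k) x - n * a + -η k 0) hn
  have hΘlim : ∀ x, Tendsto (fun k => Θ₀ k x) F
      (𝓝 (I.inf' hIne fun n => T^[n] θ₀ x - n * a)) := by
    intro x
    simp only [hΘ₀e]
    exact Tendsto.finset_inf'_nhds_apply hIne fun n _ =>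
      (h.tendsto_iterate hη0 hθ₀ n x).sub_const _
  set K₁ := max K (max K' 1) with hK₁
  have e1 := eventually_close (fun k => h.state_lip (hΘ₀s k))
    (h.state_lip (h.state_inf_iterate hIne hθ₀s a)) hΘlim K₁ (κ := κ' / 3) (by positivity)
  have hmL : Lip M m := lip_of_deriv hm hM
  have hM0 : 0 ≤ M := (abs_nonneg _).trans (hM 0)
  set Cm := |m 0| + M * K₁ with hCm
  have hmb : ∀ x, |x| ≤ K₁ → |m x| ≤ Cm := by
    intro x hx
    have := hmL 0 x
    rw [sub_zero] at this
    have h2 := abs_sub_abs_le_abs_sub (m x) (m 0)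
    have h3 := mul_le_mul_of_nonneg_left hx hM0
    linarith
  have hCm0 : 0 ≤ Cm := (abs_nonneg _).trans (hmb 0 (by simp [hK₁]))
  set s : ℕ → ℝ := fun k => c'' k - c' k with hs
  have hslim : Tendsto (fun k => |s k|) F (𝓝 0) := by
    have := (hlim2.sub hlim1).abs
    simpa using this
  have e2 : ∀ᶠ k in F, |s k| * M ≤ 1 := by
    have := hslim.mul_const M
    rw [zero_mul] at this
    exact (this.eventually_lt_const one_pos).mono fun k hk => hk.le
  have e3 : ∀ᶠ k in F, |s k| * Cm ≤ min κ (κ' / 3) := by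
    have := hslim.mul_const Cm
    rw [zero_mul] at this
    exact (this.eventually_lt_const (by positivity)).mono fun k hk => hk.le
  have e4 : ∀ᶠ k in F, I.sup id + 1 ≤ k := hF (eventually_ge_atTop _)
  obtain ⟨k, f1, f2, f3, f4⟩ := (e1.and (e2.and (e3.and e4))).exists
  set ζ : ℝ → ℝ := fun x => Θ k x + s k * m x with hζ
  have hζL : Lip (U + 1) ζ := by
    refine (h.state_lip (hΘs k)).add fun x x' => ?_
    rw [← mul_sub, abs_mul]
    calc |s k| * |m x' - m x| ≤ |s k| * (M * |x' - x|) := by gcongr; exact hmL x x'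
      _ = (|s k| * M) * |x' - x| := by ring
      _ ≤ 1 * |x' - x| := by gcongr
  have hζc : ∀ x, ζ (x + 1) = ζ x + c'' k := by
    intro x
    simp only [hζ, (hΘs k).1 x, hmp, hs]
    ring
  have hused : ∀ x y X, Cal T ζ x X → Subgrad ζ x y → Subgrad (Θ k) x y := by
    intro x y X hcal hsub
    refine Subgrad.add_flat hsub ?_
    have hcal' : Cal T (fun x => ζ x + -η k 0) x X := by
      intro ξ hξ
      have := hcal ξ hξ
      rw [h.lo.add_const ⟨_, hζL⟩]
      linarith
    have := hgap (fun x => ζ x + -η k 0) (c'' k) (hζL.add_const _)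
      (fun x => by rw [hζc]; ring) (fun x hx => ?_) x X hcal'
    · rw [← hm0 x this]; exact hm x
    · have hxK : |x| ≤ K₁ := hx.trans ((le_max_left _ _).trans (le_max_right _ _))
      have h1 := abs_le.1 (f1 x hxK)
      have h2 := abs_le.1 (hIθ x)
      have h3 : |s k * m x| ≤ κ' / 3 := by
        rw [abs_mul]
        exact (mul_le_mul_of_nonneg_left (hmb x hxK) (abs_nonneg _)).trans
          (f3.trans (min_le_right _ _))
      have h4 := abs_le.1 h3
      have h5 : Θ₀ k x = Θ k x + -η k 0 := rfl
      rw [h5] at h1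
      simp only [hζ]
      rw [abs_le]
      constructor <;> linarith [h1.1, h1.2, h2.1, h2.2, h4.1, h4.2]
  have hstate : State um up r (c'' k) (T ζ) := h.state_of_used hζL hζc fun x y X h1 h2 =>
    (h.state_subgrad (hΘs k) (hused x y X h1 h2)).1
  have hpath : ∀ q : V2, HasDerivAt (T ζ) q.2 q.1 → ∃ n, 1 ≤ n ∧ n ≤ k ∧ ∃ p, φ^[n] p = q ∧
      ∀ j < n, HasDerivAt (T^[j] (η k)) (φ^[j] p).2 (φ^[j] p).1 := by
    intro q hq
    obtain ⟨x, y, hcal, hxy, hsub⟩ := h.used hζL hq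
    have hsub' := hused x y _ hcal hsub
    obtain ⟨n, hn, he⟩ := Finset.exists_mem_eq_inf' hIne fun n : ℕ => T^[n] (η k) x - n * a
    have hsub2 : Subgrad (T^[n] (η k)) x y := by
      refine hsub'.of_le (b := -(n * a)) (fun x' => ?_) ?_
      · have := Finset.inf'_le (fun n : ℕ => T^[n] (η k) x' - n * a) hn
        simp only [hΘ]
        linarith
      · simp only [hΘ]
        rw [he]
        ring
    have hd := (h.state_subgrad (h.state_iterate (hη k) n) hsub2).2
    obtain ⟨p, hp, hj⟩ := h.graph_iterate (hη k) n (q := (x, y)) hd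
    refine ⟨n + 1, by omega, ?_, p, ?_, fun j hj' => hj j (by omega)⟩
    · have : n ≤ I.sup id := Finset.le_sup (f := id) hn
      omega
    · rw [Function.iterate_succ_apply', hp, hxy]
  obtain ⟨x, hxK, hx⟩ := hbad k (T ζ) hstate hpath ζ hζL hζc rfl I hIne hIL a
  refine absurd hx (not_lt.2 ?_)
  have : ζ x - (I.inf' hIne fun n => T^[n] (η k) x - n * a) = s k * m x := by
    simp only [hζ, hΘ]; ring
  rw [this, abs_mul]
  exact (mul_le_mul_of_nonneg_left (hmb x (hxK.trans (le_max_left _ _))) (abs_nonneg _)).trans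
    (f3.trans (min_le_left _ _))

end Region

lemma exists_mul_sub_mem {ω : ℝ} (hω : Irrational ω) {κ : ℝ} (hκ : 0 < κ) :
    ∃ (k : ℕ) (m : ℤ), 0 < k * ω - m ∧ k * ω - m ≤ κ := by
  obtain ⟨n, hn⟩ := exists_nat_ge (1 / κ)
  have hn0 : 0 < n + 1 := n.succ_pos
  obtain ⟨k, hk, -, hkn⟩ := Real.exists_nat_abs_mul_sub_round_le ω hn0
  set m := round (k * ω) with hm
  have hne : (k : ℝ) * ω - m ≠ 0 := by
    have := (hω.natCast_mul hk.ne').sub_intCast m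
    exact this.ne_zero
  have hle : |k * ω - m| ≤ κ := by
    refine hkn.trans ?_
    rw [div_le_iff₀ (by positivity)]
    rw [div_le_iff₀ hκ] at hn
    push_cast
    nlinarith
  rcases lt_or_gt_of_ne hne with h | h
  · set α := -(k * ω - m) with hα
    have hα0 : 0 < α := by linarith
    have hακ : α ≤ κ := by rw [abs_of_neg h] at hle; exact hle
    refine ⟨⌊1 / α⌋₊ * k, ⌊1 / α⌋₊ * m - 1, ?_, ?_⟩
    · have h1 : (⌊1 / α⌋₊ : ℝ) ≤ 1 / α := Nat.floor_le (by positivity)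
      have h2 : (⌊1 / α⌋₊ : ℝ) * α ≤ 1 := by rwa [le_div_iff₀ hα0] at h1
      have h3 : (⌊1 / α⌋₊ : ℝ) * α ≠ 1 := by
        intro h4
        have hne2 : ⌊1 / α⌋₊ * k ≠ 0 := by
          intro h5
          rcases Nat.mul_eq_zero.1 h5 with h6 | h6
          · rw [h6] at h4; simp at h4
          · omega
        have h7 := ((hω.natCast_mul hne2).sub_intCast (⌊1 / α⌋₊ * m - 1)).ne_zero
        apply h7
        push_cast
        simp only [hα] at h4 ⊢
        linarith
      have h4 := lt_of_le_of_ne h2 h3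
      push_cast
      simp only [hα] at h4 ⊢
      linarith
    · have h1 : 1 / α < ⌊1 / α⌋₊ + 1 := Nat.lt_floor_add_one _
      rw [div_lt_iff₀ hα0] at h1
      push_cast
      simp only [hα] at h1 hακ ⊢
      linarith
  · exact ⟨k, m, h, (le_abs_self _).trans hle⟩

lemma iterate_sub_int {g : ℝ → ℝ} (hg1 : ∀ x, g (x + 1) = g x + 1) (n : ℕ) (x : ℝ) (m : ℤ) :
    g^[n] (x - m) = g^[n] x - m := by
  have h1 : ∀ x, g^[n] (x + 1) = g^[n] x + 1 := by
    intro x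
    exact ((show Function.Commute g (· + 1) from hg1).iterate_left n) x
  have := class_int (c := 1) h1 x (-m)
  push_cast at this
  simpa [sub_eq_add_neg] using this

lemma exists_rotation_approx {g : ℝ → ℝ} (hg : Monotone g) (hg1 : ∀ x, g (x + 1) = g x + 1)
    {ω : ℝ} (hω : Irrational ω) (hrot : Tendsto (fun n : ℕ => (g^[n] 0 - 0) / n) atTop (𝓝 ω))
    {κ₀ : ℝ} (hκ₀ : 0 < κ₀) : ∃ κ > 0, κ ≤ κ₀ ∧ ∃ (k : ℕ) (m : ℤ), (∀ x, x + m < g^[k] x) ∧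
      (∀ (J : ℕ) x, J * κ - 1 ≤ g^[k * J] x - J * m - x) ∧
      ∀ N x, ∃ n ≥ N, g^[n] (g^[k] x - m) - g^[n] x ≤ 2 * κ := by
  obtain ⟨k, m, h0, h1⟩ := exists_mul_sub_mem hω hκ₀
  let f : CircleDeg1Lift := ⟨⟨g, hg⟩, hg1⟩
  have hfg : ∀ n, ⇑(f ^ n) = g^[n] := f.coe_pow
  have hτ : f.translationNumber = ω := by
    refine tendsto_nhds_unique (f.tendsto_translationNumber 0) ?_
    simpa only [hfg] using hrot
  have hub : ∀ n x, g^[n] x < x + n * ω + 1 := by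
    intro n x
    have := (f ^ n).map_lt_add_translationNumber_add_one x
    rwa [CircleDeg1Lift.translationNumber_pow, hτ, hfg] at this
  have hlb : ∀ n x, x + n * ω - 1 ≤ g^[n] x := by
    intro n x
    have h2 : ((⌈n * ω⌉ - 1 : ℤ) : ℝ) < (f ^ n).translationNumber := by
      rw [CircleDeg1Lift.translationNumber_pow, hτ]
      push_cast
      linarith [Int.ceil_lt_add_one (n * ω)]
    have := (f ^ n).lt_map_of_int_lt_translationNumber h2 x
    rw [hfg] at this
    push_cast at this
    linarith [Int.le_ceil (n * ω)]
  refine ⟨k * ω - m, h0, h1, k, m, fun x => ?_, fun J x => ?_, fun N x => ?_⟩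
  · have h2 : (m : ℝ) < (f ^ k).translationNumber := by
      rw [CircleDeg1Lift.translationNumber_pow, hτ]
      linarith
    have := (f ^ k).lt_map_of_int_lt_translationNumber h2 x
    rwa [hfg] at this
  · have := hlb (k * J) x
    push_cast at this
    linarith
  · by_contra! hcon
    set κ := k * ω - m with hκ
    have hstep : ∀ j : ℕ, g^[N] x + j * (2 * κ) ≤ g^[N + k * j] x - j * m := by
      intro j
      induction j with
      | zero => simp
      | succ j ih =>
        have h2 := hcon (N + k * j) (by omega)
        rw [iterate_sub_int hg1, ← Function.iterate_add_apply,
          show N + k * j + k = N + k * (j + 1) by ring] at h2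
        push_cast
        linarith
    obtain ⟨J, hJ⟩ := exists_nat_ge (1 / κ)
    rw [div_le_iff₀ h0] at hJ
    have h2 := hstep J
    have h3 := hub (k * J) (g^[N] x)
    rw [← Function.iterate_add_apply, add_comm (k * J) N] at h3
    push_cast at h3
    have h4 : (J : ℝ) * κ = k * J * ω - J * m := by rw [hκ]; ring
    linarith

namespace Region
variable {φ : V2 → V2} {T : (ℝ → ℝ) → ℝ → ℝ} {um up : ℝ → ℝ} {U R : ℝ} {r : ℝ → ℝ}
  (h : Region φ T um up U R r)
include h

lemma iterate_pot {w : ℝ → ℝ} (hw : Bdry φ U w) {a : ℝ}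
    (ha : ∀ X, T (pot w) X = pot w X + a) (n : ℕ) : T^[n] (pot w) = fun X => pot w X + n * a := by
  induction n with
  | zero => simp
  | succ n ih =>
    rw [Function.iterate_succ_apply', ih, h.lo.add_const ⟨_, hw.lip_pot⟩]
    funext X
    rw [ha]
    push_cast
    ring

/-- In the class of an invariant circle with irrational rotation number, iterates converge to the
potential of that circle. -/
theorem exists_iterate_close {w : ℝ → ℝ} (hw : Bdry φ U w) {ω : ℝ} (hω : Irrational ω)
    (hrot : Tendsto (fun n : ℕ => ((proj φ w)^[n] 0 - 0) / n) atTop (𝓝 ω)) {η : ℝ → ℝ}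
    (hη : State um up r (pot w 1) η) {κ₀ : ℝ} (hκ₀ : 0 < κ₀) :
    ∃ n b, ∀ x, |T^[n] η x - (pot w x + b)| ≤ κ₀ := by
  set g := proj φ w with hg
  have hgm : StrictMono g := hw.proj_strictMono h.continuous h.injective h.equiv
  have hg1 : ∀ x, g (x + 1) = g x + 1 := hw.proj_add_one h.equiv
  have hgc : Continuous g := hw.proj_continuous h.continuous
  obtain ⟨a, ha⟩ := hw.exists_T_pot h.full
  have hwc := hw.uc.continuous
  have hpot1 := pot_add_one hwc hw.per
  set D : ℕ → ℝ → ℝ := fun n x => T^[n] η x - pot w x - n * a with hD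
  have hDp : ∀ n x, D n (x + 1) = D n x := by
    intro n x
    simp only [hD, hpot1, (h.state_iterate hη n).1 x]
    ring
  have hDc : ∀ n, Continuous (D n) := fun n =>
    ((h.state_lip (h.state_iterate hη n)).continuous.sub hw.lip_pot.continuous).sub
      continuous_const
  obtain ⟨ξ₀, -, hξ₀'⟩ := isCompact_Icc.exists_isMinOn (s := Set.Icc (0 : ℝ) 1) ⟨0, by simp⟩
    (hDc 0).continuousOn
  have hξ₀ : ∀ x, D 0 ξ₀ ≤ D 0 x := by
    intro x
    have h1 : D 0 ξ₀ ≤ D 0 (Int.fract x) :=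
      hξ₀' ⟨Int.fract_nonneg x, (Int.fract_lt_one x).le⟩
    have h2 := periodic_of_class hη.1 hpot1 x
    simp only [hD, Function.iterate_zero, id_eq] at h1 ⊢
    linarith
  set m := D 0 ξ₀ with hm
  have hlow : ∀ n x, m ≤ D n x := by
    intro n x
    have := h.lo.iterate_le_add (h.state_exLip hη) ⟨_, hw.lip_pot⟩ (κ := -m) (fun x => by
      have := hξ₀ x
      simp only [hD, Function.iterate_zero, id_eq, Nat.cast_zero, zero_mul, sub_zero] at this
      linarith) n x
    rw [h.iterate_pot hw ha] at this
    simp only [hD]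
    linarith
  have hup : ∀ ε > 0, ∃ ρ > 0, ∀ n x X', |X' - g x| ≤ ρ →
      D (n + 1) X' ≤ D n x + 2 * ε * |X' - g x| := by
    intro ε hε
    obtain ⟨δ, hδ, hexp⟩ := uniform_expansion (pot_hasDerivAt hwc) hw.uc hε
    refine ⟨min δ (r ε), lt_min hδ (h.rpos hε), fun n x X' hX' => ?_⟩
    have h1 := hw.upper h.full h.injective ha (h.state_exLip (h.state_iterate hη n)) x hε
      (hX'.trans (min_le_right _ _))
    have h2 := (abs_le.1 (hexp (g x) X' (hX'.trans (min_le_left _ _)))).1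
    simp only [hD]
    rw [Function.iterate_succ_apply']
    push_cast
    linarith
  set f : ℕ → ℝ → ℝ := fun n ξ => D n (g^[n] ξ) with hf
  have hfanti : ∀ ξ, Antitone fun n => f n ξ := by
    intro ξ
    refine antitone_nat_of_succ_le fun n => ?_
    obtain ⟨ρ, hρ, hh⟩ := hup 1 one_pos
    have := hh n (g^[n] ξ) (g (g^[n] ξ)) (by simpa using hρ.le)
    simp only [hf, Function.iterate_succ_apply']
    simpa using this
  have hf0 : ∀ n, f n ξ₀ ≤ m := fun n => hfanti ξ₀ (Nat.zero_le n)
  set ε := κ₀ / 20 with hε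
  have hε0 : 0 < ε := by positivity
  obtain ⟨ρ, hρ, hstep⟩ := hup ε hε0
  obtain ⟨κ, hκ, hκρ, k, m', hk1, hk2, hk3⟩ := exists_rotation_approx hgm.monotone hg1 hω hrot
    (κ₀ := min (ρ / 2) 1) (by positivity)
  have hκρ' : 2 * κ ≤ ρ := by linarith [hκρ.trans (min_le_left _ _)]
  have hκ1 : κ ≤ 1 := hκρ.trans (min_le_right _ _)
  have harc : ∀ v ξ Ξ, (∀ e > 0, ∃ n, f n ξ ≤ v + e) → ξ ≤ Ξ → Ξ ≤ g^[k] ξ - m' →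
      ∀ e > 0, ∃ n, f n Ξ ≤ v + 4 * ε * κ + e := by
    intro v ξ Ξ hv hΞ1 hΞ2 e he
    obtain ⟨n₀, hn₀⟩ := hv e he
    obtain ⟨n, hn, hn2⟩ := hk3 (n₀ + 1) ξ
    obtain ⟨n, rfl⟩ := Nat.exists_eq_succ_of_ne_zero (show n ≠ 0 by omega)
    have hmn : StrictMono g^[n + 1] := hgm.iterate _
    have h1 := hmn.monotone hΞ1
    have h2 := hmn.monotone hΞ2
    have h3 : |g^[n + 1] Ξ - g^[n + 1] ξ| ≤ 2 * κ := by
      rw [abs_of_nonneg (by linarith)]; linarith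
    refine ⟨n + 1, ?_⟩
    have h4 := hstep n (g^[n] ξ) (g^[n + 1] Ξ)
    rw [← Function.iterate_succ_apply' g n ξ] at h4
    have h5 := h4 (h3.trans hκρ')
    have h6 : f n ξ ≤ f n₀ ξ := hfanti ξ (by omega)
    have h7 := mul_le_mul_of_nonneg_left h3 hε0.le
    simp only [hf] at hn₀ h6 ⊢
    linarith
  set ξ : ℕ → ℝ := fun j => g^[k * j] ξ₀ - j * m' with hξ
  have hξs : ∀ j, ξ (j + 1) = g^[k] (ξ j) - m' := by
    intro j
    have := iterate_sub_int hg1 k (g^[k * j] ξ₀) (j * m')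
    push_cast at this
    simp only [hξ]
    rw [this, ← Function.iterate_add_apply, show k + k * j = k * (j + 1) by ring]
    push_cast
    ring
  have hξlt : ∀ j, ξ j ≤ ξ (j + 1) := by
    intro j
    rw [hξs]
    linarith [hk1 (ξ j)]
  have hξv : ∀ j, ∀ e > 0, ∃ n, f n (ξ j) ≤ m + 4 * ε * κ * j + e := by
    intro j
    induction j with
    | zero =>
      intro e he
      refine ⟨0, ?_⟩
      have := hf0 0
      simp only [hξ, mul_zero, Function.iterate_zero, id_eq, Nat.cast_zero, zero_mul, sub_zero,
        add_zero]
      linarith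
    | succ j ih =>
      intro e he
      obtain ⟨n, hn⟩ := harc _ _ (ξ (j + 1)) ih (hξlt j) (hξs j).le e he
      refine ⟨n, hn.trans_eq ?_⟩
      push_cast
      ring
  have hξ0 : ξ 0 = ξ₀ := by simp [hξ]
  have hloc : ∀ (J : ℕ) x, ξ₀ ≤ x → x ≤ ξ J → ∃ j ≤ J, ξ j ≤ x ∧ x ≤ ξ (j + 1) := by
    intro J x hx
    induction J with
    | zero => exact fun h1 => ⟨0, le_rfl, by rw [hξ0]; exact hx, h1.trans (hξlt 0)⟩
    | succ J ih =>
      intro h1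
      rcases le_total x (ξ J) with h2 | h2
      · obtain ⟨j, hj, hh⟩ := ih h2
        exact ⟨j, by omega, hh⟩
      · exact ⟨J, by omega, h2, h1⟩
  have hpt : ∀ x ∈ Set.Icc ξ₀ (ξ₀ + 1), ∃ n, f n x < m + κ₀ := by
    intro x hx
    set J := ⌈2 / κ⌉₊ with hJ
    have hJ1 : 2 ≤ J * κ := by
      have := Nat.le_ceil (2 / κ)
      rwa [div_le_iff₀ hκ] at this
    have hJ2 : J * κ ≤ 2 + κ := by
      have := Nat.ceil_lt_add_one (show 0 ≤ 2 / κ by positivity)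
      have h2 : (2 / κ) * κ = 2 := div_mul_cancel₀ _ hκ.ne'
      nlinarith
    have hJ3 : x ≤ ξ J := by
      have := hk2 J ξ₀
      simp only [hξ]
      linarith [hx.2]
    obtain ⟨j, hj, hj1, hj2⟩ := hloc J x hx.1 hJ3
    rw [hξs] at hj2
    obtain ⟨n, hn⟩ := harc _ _ x (hξv j) hj1 hj2 ε hε0
    refine ⟨n, hn.trans_lt ?_⟩
    have hj' : (j : ℝ) ≤ J := by exact_mod_cast hj
    have h1 : κ * j ≤ 2 + κ := by nlinarith
    have h2 : ε * (κ * j) ≤ ε * 3 := by gcongr; linarith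
    have h3 : ε * κ ≤ ε * 1 := by gcongr
    have h4 : κ₀ = 20 * ε := by rw [hε]; ring
    nlinarith
  have hfc : ∀ n, Continuous (f n) := fun n => (hDc n).comp (hgc.iterate n)
  obtain ⟨n, hn⟩ := (isCompact_Icc (a := ξ₀) (b := ξ₀ + 1)).elim_directed_cover
    (fun n => {x | f n x < m + κ₀}) (fun n => isOpen_lt (hfc n) continuous_const)
    (fun x hx => Set.mem_iUnion.2 (hpt x hx)) (directed_of_isDirected_le
      fun i j hij x (hx : f i x < _) => (hfanti x hij).trans_lt hx)
  refine ⟨n, m + n * a, fun x => ?_⟩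
  obtain ⟨ξ', hξ'⟩ := (hw.proj_surjective.iterate n) x
  have hfp : Function.Periodic (f n) 1 := by
    intro y
    have := iterate_sub_int hg1 n y (-1)
    push_cast at this
    simp only [sub_neg_eq_add] at this
    simp only [hf, this, hDp]
  obtain ⟨y, hy, hye⟩ := hfp.exists_mem_Ico one_pos ξ' ξ₀
  have h1 : f n y < m + κ₀ := hn ⟨hy.1, hy.2.le⟩
  rw [← hye] at h1
  have h2 : f n ξ' = D n x := by simp only [hf, hg, hξ']
  rw [h2] at h1
  have h3 := hlow n x
  simp only [hD] at h1 h3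
  rw [abs_le]
  constructor <;> linarith

end Region

namespace Region
variable {φ : V2 → V2} {T : (ℝ → ℝ) → ℝ → ℝ} {um up : ℝ → ℝ} {U R : ℝ} {r : ℝ → ℝ}
  (h : Region φ T um up U R r)
include h

lemma iterate_close {w : ℝ → ℝ} (hw : Bdry φ U w) {η : ℝ → ℝ} (hη : ∃ Λ, Lip Λ η) {κ b : ℝ}
    (hb : ∀ x, |η x - (pot w x + b)| ≤ κ) (n : ℕ) :
    ∃ b, ∀ x, |T^[n] η x - (pot w x + b)| ≤ κ := by
  obtain ⟨a, ha⟩ := hw.exists_T_pot h.full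
  have hp : ∃ Λ, Lip Λ fun x => pot w x + b := ⟨_, hw.lip_pot.add_const b⟩
  refine ⟨n * a + b, fun x => ?_⟩
  have h1 := h.lo.iterate_le_add hη hp (κ := κ) (fun x => by linarith [(abs_le.1 (hb x)).1]) n x
  have h2 := h.lo.iterate_le_add hp hη (κ := κ) (fun x => by linarith [(abs_le.1 (hb x)).2]) n x
  rw [h.lo.iterate_add_const ⟨_, hw.lip_pot⟩, h.iterate_pot hw ha] at h1 h2
  rw [abs_le]
  constructor <;> linarith

lemma exists_limit {F : Ultrafilter ℕ} {c : ℕ → ℝ} {c₀ : ℝ} {η : ℕ → ℝ → ℝ}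
    (hη : ∀ k, State um up r (c k) (η k)) (hc : Tendsto c F (𝓝 c₀)) :
    ∃ θ, State um up r c₀ θ ∧ ∀ (n : ℕ) (K : ℝ), ∀ κ > 0, ∀ᶠ k in (F : Filter ℕ),
      ∀ x, |x| ≤ K → |T^[n] (η k) x - η k 0 - T^[n] θ x| ≤ κ := by
  have hη0 : ∀ k, State um up r (c k) fun x => η k x + -η k 0 := fun k =>
    h.state_add_const (hη k) _
  obtain ⟨θ, hθ⟩ := exists_ultralimit_fun F (C := 0) (fun k => h.state_lip (hη0 k))
    (fun k => by simp)
  have hθs : State um up r c₀ θ := h.state_tendsto hη0 hc hθ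
  refine ⟨θ, hθs, fun n K κ hκ => ?_⟩
  have := eventually_close (fun k => h.state_lip (h.state_iterate (hη0 k) n))
    (h.state_lip (h.state_iterate hθs n)) (h.tendsto_iterate hη0 hθ n) K hκ
  filter_upwards [this] with k hk x hx
  have h1 := hk x hx
  rw [h.lo.iterate_add_const (h.state_exLip (hη k))] at h1
  simpa [sub_eq_add_neg] using h1

/-- The convergence of iterates to the potential of the boundary circle is uniform. -/
lemma exists_uniform_iterate_close {w : ℝ → ℝ} (hw : Bdry φ U w) {ω : ℝ} (hω : Irrational ω)
    (hrot : Tendsto (fun n : ℕ => ((proj φ w)^[n] 0 - 0) / n) atTop (𝓝 ω)) {κ : ℝ} (hκ : 0 < κ) :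
    ∃ L, ∀ η, State um up r (pot w 1) η → ∃ b, ∀ x, |T^[L] η x - (pot w x + b)| ≤ κ := by
  by_contra! hcon
  choose η hη hbad using hcon
  set F := hyperfilter ℕ
  have hF : (F : Filter ℕ) ≤ atTop := Nat.hyperfilter_le_atTop
  obtain ⟨θ, hθ, hlim⟩ := h.exists_limit (F := F) hη tendsto_const_nhds
  obtain ⟨n, b, hb⟩ := h.exists_iterate_close hw hω hrot hθ (half_pos hκ)
  obtain ⟨k, hk, hkn⟩ := ((hlim n 1 (κ / 2) (half_pos hκ)).and (hF (eventually_ge_atTop n))).exists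
  have hclose := close_of_class (η := fun x => T^[n] (η k) x - η k 0) le_rfl
    (fun x => by rw [(h.state_iterate (hη k) n).1]; ring) (h.state_iterate hθ n).1 hk
  have h1 : ∀ x, |T^[n] (η k) x - (pot w x + (b + η k 0))| ≤ κ := by
    intro x
    have h2 := abs_le.1 (hclose x)
    have h3 := abs_le.1 (hb x)
    rw [abs_le]
    constructor <;> linarith [h2.1, h2.2, h3.1, h3.2]
  obtain ⟨b', hb'⟩ := h.iterate_close hw (h.state_exLip (h.state_iterate (hη k) n)) h1 (k - n)
  rw [← Function.iterate_add_apply, Nat.sub_add_cancel hkn] at hb'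
  obtain ⟨x, hx⟩ := hbad k b'
  exact absurd hx (not_lt.2 (hb' x))

lemma exists_near_iterate_close {w : ℝ → ℝ} (hw : Bdry φ U w) {ω : ℝ} (hω : Irrational ω)
    (hrot : Tendsto (fun n : ℕ => ((proj φ w)^[n] 0 - 0) / n) atTop (𝓝 ω)) (K : ℝ) {κ : ℝ}
    (hκ : 0 < κ) : ∃ δ > 0, ∃ L, ∀ c η, |c - pot w 1| < δ → State um up r c η → ∀ n ≥ L,
      ∃ b, ∀ x, |x| ≤ K → |T^[n] η x - (pot w x + b)| ≤ κ := by
  obtain ⟨L, hL⟩ := h.exists_uniform_iterate_close hw hω hrot (half_pos hκ)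
  by_contra! hcon
  have hpos : ∀ k : ℕ, (0 : ℝ) < 1 / (k + 1) := fun k => by positivity
  choose c η hc hη n hn hbad using fun k : ℕ => hcon (1 / (k + 1)) (hpos k) L
  set F := hyperfilter ℕ
  have hF : (F : Filter ℕ) ≤ atTop := Nat.hyperfilter_le_atTop
  have hlim1 : Tendsto c F (𝓝 (pot w 1)) := by
    refine Tendsto.mono_left ?_ hF
    rw [tendsto_iff_norm_sub_tendsto_zero]
    exact squeeze_zero (fun k => norm_nonneg _) (fun k => (hc k).le)
      tendsto_one_div_add_atTop_nhds_zero_nat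
  obtain ⟨θ, hθ, hlim⟩ := h.exists_limit (F := F) (η := fun k => T^[n k - L] (η k))
    (fun k => h.state_iterate (hη k) _) hlim1
  obtain ⟨b, hb⟩ := hL θ hθ
  obtain ⟨k, hk⟩ := (hlim L K (κ / 2) (half_pos hκ)).exists
  obtain ⟨x, hxK, hx⟩ := hbad k (b + T^[n k - L] (η k) 0)
  refine absurd hx (not_lt.2 ?_)
  have h1 := hk x hxK
  rw [← Function.iterate_add_apply, Nat.add_sub_cancel' (hn k)] at h1
  have h2 := abs_le.1 h1
  have h3 := abs_le.1 (hb x)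
  rw [abs_le]
  constructor <;> linarith [h2.1, h2.2, h3.1, h3.2]

/-- A state close to the potential of a boundary circle has its graph close to that circle. -/
lemma exists_graph_close {w : ℝ → ℝ} (hw : Bdry φ U w) {ε : ℝ} (hε : 0 < ε) :
    ∃ κ > 0, ∀ c η b, State um up r c η → (∀ x, |x| ≤ 2 → |η x - (pot w x + b)| ≤ κ) →
      ∀ p : V2, HasDerivAt η p.2 p.1 → |p.2 - w p.1| ≤ ε := by
  have hε4 : 0 < ε / 4 := by positivity
  have hwc := hw.uc.continuous
  obtain ⟨δ, hδ, hexp⟩ := uniform_expansion (pot_hasDerivAt hwc) hw.uc hε4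
  set s := min (min δ (r (ε / 4))) 1 with hs
  have hs0 : 0 < s := lt_min (lt_min hδ (h.rpos hε4)) one_pos
  have hsδ : s ≤ δ := (min_le_left _ _).trans (min_le_left _ _)
  have hsr : s ≤ r (ε / 4) := (min_le_left _ _).trans (min_le_right _ _)
  have hs1 : s ≤ 1 := min_le_right _ _
  refine ⟨ε * s / 4, by positivity, fun c η b hη hclose p hp => ?_⟩
  obtain ⟨X, Y⟩ := p
  simp only at hp ⊢
  set x := Int.fract X with hx
  have hxX : X = x + ⌊X⌋ := (Int.fract_add_floor X).symm
  have hwx : w X = w x := by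
    have hper : Function.Periodic w 1 := hw.per
    have := hper.sub_int_mul_eq (x := X) ⌊X⌋
    rw [mul_one, Int.self_sub_floor] at this
    exact this.symm
  have hpx : HasDerivAt η Y x := by
    have h1 : HasDerivAt (fun t => η (t + ⌊X⌋)) Y x := by
      rw [hxX] at hp
      exact hp.comp_add_const x _
    have h2 : (fun t => η (t + ⌊X⌋)) = fun t => η t + ⌊X⌋ * c :=
      funext fun t => class_int hη.1 t _
    rw [h2] at h1
    simpa using h1.sub_const (⌊X⌋ * c)
  have hsup := (h.state_deriv hη hpx).2 (ε / 4) hε4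
  have hx0 : 0 ≤ x := Int.fract_nonneg X
  have hx1 : x < 1 := Int.fract_lt_one X
  have key : ∀ t : ℝ, |t| = s → (w x - Y) * t ≤ ε * s := by
    intro t ht
    have ht1 := abs_le.1 (ht.trans_le hs1)
    have e1 : |x + t - x| = s := by rw [add_sub_cancel_left]; exact ht
    have h1 := hsup (x + t) (by rw [e1]; exact hsr)
    have h2 := (abs_le.1 (hexp x (x + t) (by rw [e1]; exact hsδ))).1
    have h3 := (abs_le.1 (hclose (x + t) (abs_le.2 ⟨by linarith [ht1.1], by linarith [ht1.2]⟩))).1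
    have h4 := (abs_le.1 (hclose x (abs_le.2 ⟨by linarith, by linarith⟩))).2
    rw [e1, add_sub_cancel_left] at h1 h2
    linarith
  rw [hwx, abs_le]
  have k1 := key s (abs_of_pos hs0)
  have k2 := key (-s) (by rw [abs_neg]; exact abs_of_pos hs0)
  constructor
  · have : (w x - Y) * s ≤ ε * s := k1
    have := le_of_mul_le_mul_right this hs0
    linarith
  · have : (Y - w x) * s ≤ ε * s := by linarith
    have := le_of_mul_le_mul_right this hs0
    linarith

/-- Closeness to the boundary circle propagates along finitely many steps. -/
lemma iterate_local_close {w : ℝ → ℝ} (hw : Bdry φ U w) (K : ℝ) (N : ℕ) : ∃ K', ∀ c ζ κ b,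
    Lip (U + 1) ζ → State um up r c (T ζ) → (∀ x, |x| ≤ K' → |ζ x - (pot w x + b)| ≤ κ) →
    ∀ n ≤ N, ∃ b, ∀ x, |x| ≤ K → |T^[n] ζ x - (pot w x + b)| ≤ κ := by
  obtain ⟨R₀, hR₀⟩ := h.lo.local_le (U + 1)
  obtain ⟨a, ha⟩ := hw.exists_T_pot h.full
  set R₁ := max R₀ 0 with hR₁
  have hR₁0 : 0 ≤ R₁ := le_max_right _ _
  refine ⟨K + N * R₁, fun c ζ κ b hζ hT hclose n hn => ?_⟩
  have hL : ∀ j, Lip (U + 1) (T^[j] ζ) := by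
    intro j
    cases j with
    | zero => exact hζ
    | succ j =>
      rw [Function.iterate_succ_apply]
      exact h.state_lip1 (h.state_iterate hT j)
  have hmain : ∀ j ≤ n, ∀ x, |x| ≤ K + (N - j : ℝ) * R₁ →
      |T^[j] ζ x - (pot w x + (j * a + b))| ≤ κ := by
    intro j
    induction j with
    | zero =>
      intro _ x hx
      simpa using hclose x (by simpa using hx)
    | succ j ih =>
      intro hj x hx
      have hpL : ∀ b', Lip (U + 1) fun x => pot w x + b' := fun b' =>
        (hw.lip_pot.mono (by linarith)).add_const b'
      have hnear : ∀ y, |y - x| ≤ R₀ → |T^[j] ζ y - (pot w y + (j * a + b))| ≤ κ := by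
        intro y hy
        refine ih (by omega) y ?_
        have h1 := abs_sub_abs_le_abs_sub y x
        have h2 : R₀ ≤ R₁ := le_max_left _ _
        push_cast at hx
        nlinarith
      have hTp : T (fun x => pot w x + (j * a + b)) x = pot w x + ((j + 1 : ℕ) * a + b) := by
        rw [h.lo.add_const ⟨_, hw.lip_pot⟩]
        simp only [ha]
        push_cast
        ring
      have h1 := hR₀ _ (hpL (j * a + b)) (T^[j] ζ) ⟨_, hL j⟩ x κ
        fun y hy => by linarith [(abs_le.1 (hnear y hy)).2]
      have h2 := hR₀ _ (hL j) _ ⟨_, hpL (j * a + b)⟩ x κ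
        fun y hy => by linarith [(abs_le.1 (hnear y hy)).1]
      rw [hTp] at h1 h2
      rw [Function.iterate_succ_apply', abs_le]
      constructor <;> linarith
  refine ⟨n * a + b, fun x hx => hmain n le_rfl x (hx.trans ?_)⟩
  have : (n : ℝ) ≤ N := by exact_mod_cast hn
  nlinarith

/-- Near a boundary circle, the states produced by a step have their whole forward graphs close to
that circle. -/
theorem exists_step_close {w : ℝ → ℝ} (hw : Bdry φ U w) {ω : ℝ} (hω : Irrational ω)
    (hrot : Tendsto (fun n : ℕ => ((proj φ w)^[n] 0 - 0) / n) atTop (𝓝 ω)) {ε : ℝ} (hε : 0 < ε) :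
    ∃ δ > 0, ∃ (L : ℕ) (K : ℝ), ∃ κ > 0,
      (∀ c η, |c - pot w 1| < δ → State um up r c η → ∀ j ≥ L, ∀ p : V2,
        HasDerivAt (T^[j] η) p.2 p.1 → |p.2 - w p.1| ≤ ε) ∧
      ∀ c' c'' η ζ, |c' - pot w 1| < δ → |c'' - pot w 1| < δ → State um up r c' η →
        Lip (U + 1) ζ → State um up r c'' (T ζ) →
        (∃ (I : Finset ℕ) (hI : I.Nonempty), (∀ n ∈ I, L ≤ n) ∧ ∃ a : ℝ, ∀ x, |x| ≤ K →
          |ζ x - I.inf' hI fun n => T^[n] η x - n * a| ≤ κ) →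
        ∀ j, ∀ p : V2, HasDerivAt (T^[j] (T ζ)) p.2 p.1 → |p.2 - w p.1| ≤ ε := by
  obtain ⟨κ, hκ, hgraph⟩ := h.exists_graph_close hw hε
  obtain ⟨δ₁, hδ₁, L₁, h₁⟩ := h.exists_near_iterate_close hw hω hrot 2 hκ
  obtain ⟨K, hK⟩ := h.iterate_local_close hw 2 (L₁ + 1)
  obtain ⟨δ₂, hδ₂, L₂, h₂⟩ := h.exists_near_iterate_close hw hω hrot K (half_pos hκ)
  have hfar : ∀ c η, |c - pot w 1| < δ₁ → State um up r c η → ∀ j ≥ L₁, ∀ p : V2,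
      HasDerivAt (T^[j] η) p.2 p.1 → |p.2 - w p.1| ≤ ε := by
    intro c η hc hη j hj
    obtain ⟨b, hb⟩ := h₁ c η hc hη j hj
    exact hgraph c _ b (h.state_iterate hη j) hb
  refine ⟨min δ₁ δ₂, lt_min hδ₁ hδ₂, max L₁ L₂, K, κ / 2, half_pos hκ, ?_, ?_⟩
  · exact fun c η hc hη j hj => hfar c η (hc.trans_le (min_le_left _ _)) hη j
      ((le_max_left _ _).trans hj)
  · rintro c' c'' η ζ hc' hc'' hη hζ hT ⟨I, hI, hIL, a, hclose⟩ j
    rcases le_or_gt L₁ j with hj | hj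
    · exact hfar c'' _ (hc''.trans_le (min_le_left _ _)) hT j hj
    · choose! b hb using fun n hn => h₂ c' η (hc'.trans_le (min_le_right _ _)) hη n hn
      have hbI : ∀ n ∈ I, ∀ x, |x| ≤ K → |T^[n] η x - (pot w x + b n)| ≤ κ / 2 := fun n hn =>
        hb n ((le_max_right _ _).trans (hIL n hn))
      have hζ' : ∀ x, |x| ≤ K → |ζ x - (pot w x + I.inf' hI fun n => b n - n * a)| ≤ κ := by
        intro x hx
        have h3 := abs_le.1 (hclose x hx)
        obtain ⟨n, hn, he⟩ := Finset.exists_mem_eq_inf' hI fun n : ℕ => T^[n] η x - n * a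
        obtain ⟨n', hn', he'⟩ := Finset.exists_mem_eq_inf' hI fun n : ℕ => b n - n * a
        have h4 := Finset.inf'_le (fun n : ℕ => T^[n] η x - n * a) hn'
        have h5 := Finset.inf'_le (fun n : ℕ => b n - n * a) hn
        have h6 := abs_le.1 (hbI n hn x hx)
        have h7 := abs_le.1 (hbI n' hn' x hx)
        rw [abs_le]
        constructor <;> linarith [h3.1, h3.2, h6.1, h6.2, h7.1, h7.2]
      obtain ⟨b', hb'⟩ := hK c'' ζ κ _ hζ hT hζ' (j + 1) (by omega)
      rw [Function.iterate_succ_apply] at hb'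
      exact hgraph c'' _ b' (h.state_iterate hT j) hb'

end Region

/-! ### Chains of graphs -/

/-- Every point of `A'` is reached from `A` in a bounded number of steps, inside `V`. -/
def Link {α : Type*} (f : α → α) (V : Set α) (N : ℕ) (A A' : Set α) : Prop :=
  ∀ q ∈ A', ∃ n, 1 ≤ n ∧ n ≤ N ∧ ∃ p ∈ A, f^[n] p = q ∧ ∀ j ≤ n, f^[j] p ∈ V

lemma Link.trans {α : Type*} {f : α → α} {V : Set α} {N M : ℕ} {A A' A'' : Set α}
    (h : Link f V N A A') (h' : Link f V M A' A'') : Link f V (N + M) A A'' := by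
  intro q hq
  obtain ⟨m, hm1, hmM, p', hp', hpq', hV'⟩ := h' q hq
  obtain ⟨n, hn1, hnN, p, hp, hpq, hV⟩ := h p' hp'
  refine ⟨m + n, by omega, by omega, p, hp, by rw [Function.iterate_add_apply, hpq, hpq'], ?_⟩
  intro j hj
  rcases le_total j n with hjn | hjn
  · exact hV j hjn
  · obtain ⟨k, rfl⟩ := Nat.exists_eq_add_of_le' hjn
    rw [Function.iterate_add_apply, hpq]
    exact hV' k (by omega)

/-- The number of steps allowed for the first `i` links. -/
def stepSum (N : ℕ → ℕ) (i : ℕ) : ℕ :=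
  ∑ k ∈ Finset.range i, (N k + 1)

lemma stepSum_succ (N : ℕ → ℕ) (i : ℕ) : stepSum N (i + 1) = stepSum N i + (N i + 1) :=
  Finset.sum_range_succ _ _

lemma stepSum_strictMono (N : ℕ → ℕ) : StrictMono (stepSum N) :=
  strictMono_nat_of_lt_succ fun i => by rw [stepSum_succ]; omega

theorem forward_chain {α : Type*} {f : α → α} {V : ℕ → Set α} (hV : Antitone V)
    (hV0 : V 0 = Set.univ) {N : ℕ → ℕ} {S : ℕ → Set (Set α)}
    (hlink : ∀ i, ∀ A ∈ S i, ∃ A' ∈ S (i + 1), Link f (V i) (N i) A A') {A : Set α}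
    (hA : A ∈ S 0) (M : ℕ) : ∃ A' ∈ S M, ∀ q ∈ A', ∃ p ∈ A, ∃ τ, M ≤ τ ∧ τ ≤ stepSum N M ∧
      f^[τ] p = q ∧ ∀ t ≤ τ, ∀ i, stepSum N i ≤ t → f^[t] p ∈ V i := by
  induction M with
  | zero =>
    refine ⟨A, hA, fun q hq => ⟨q, hq, 0, le_rfl, Nat.zero_le _, rfl, fun t ht i hi => ?_⟩⟩
    have : i ≤ stepSum N i := (stepSum_strictMono N).le_apply
    obtain rfl : i = 0 := by omega
    rw [hV0]; trivial
  | succ M ih =>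
    obtain ⟨A', hA', h'⟩ := ih
    obtain ⟨A'', hA'', hl⟩ := hlink M A' hA'
    refine ⟨A'', hA'', fun q hq => ?_⟩
    obtain ⟨n, hn1, hnN, p', hp', hpq', hV'⟩ := hl q hq
    obtain ⟨p, hp, τ, hτ, hτ', hpq, hVp⟩ := h' p' hp'
    refine ⟨p, hp, n + τ, by omega, by rw [stepSum_succ]; omega,
      by rw [Function.iterate_add_apply, hpq, hpq'], fun t ht i hi => ?_⟩
    rcases le_total t τ with htτ | htτ
    · exact hVp t htτ i hi
    · obtain ⟨k, rfl⟩ := Nat.exists_eq_add_of_le' htτ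
      rw [Function.iterate_add_apply, hpq]
      have hiM : i < M + 1 := (stepSum_strictMono N).lt_iff_lt.1 (by rw [stepSum_succ]; omega)
      exact hV (Nat.lt_succ_iff.1 hiM) (hV' k (by omega))

theorem backward_chain {α : Type*} {f : α → α} {V : ℕ → Set α} (hV : Antitone V)
    (hV0 : V 0 = Set.univ) {N : ℕ → ℕ} {S : ℕ → Set (Set α)}
    (hlink : ∀ i, ∀ A ∈ S (i + 1), ∃ A' ∈ S i, Link f (V i) (N i) A A') (M : ℕ) :
    ∀ A ∈ S M, ∃ A' ∈ S 0, ∀ q ∈ A', ∃ p ∈ A, ∃ τ, M ≤ τ ∧ τ ≤ stepSum N M ∧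
      f^[τ] p = q ∧ ∀ t ≤ τ, ∀ i, stepSum N i ≤ t → f^[τ - t] p ∈ V i := by
  induction M with
  | zero =>
    refine fun A hA => ⟨A, hA, fun q hq => ⟨q, hq, 0, le_rfl, Nat.zero_le _, rfl,
      fun t ht i hi => ?_⟩⟩
    have : i ≤ stepSum N i := (stepSum_strictMono N).le_apply
    obtain rfl : i = 0 := by omega
    rw [hV0]; trivial
  | succ M ih =>
    intro A hA
    obtain ⟨A₁, hA₁, hl⟩ := hlink M A hA
    obtain ⟨A', hA', h'⟩ := ih A₁ hA₁
    refine ⟨A', hA', fun q hq => ?_⟩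
    obtain ⟨p', hp', τ, hτ, hτ', hpq', hVp⟩ := h' q hq
    obtain ⟨n, hn1, hnN, p, hp, hpq, hV'⟩ := hl p' hp'
    refine ⟨p, hp, τ + n, by omega, by rw [stepSum_succ]; omega,
      by rw [Function.iterate_add_apply, hpq, hpq'], fun t ht i hi => ?_⟩
    rcases le_total t τ with htτ | htτ
    · rw [show τ + n - t = (τ - t) + n by omega, Function.iterate_add_apply, hpq]
      exact hVp t htτ i hi
    · have hiM : i < M + 1 := (stepSum_strictMono N).lt_iff_lt.1 (by rw [stepSum_succ]; omega)
      exact hV (Nat.lt_succ_iff.1 hiM) (hV' _ (by omega))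

/-- The set of pairs `(x, η' x)`. -/
def derivGraph (η : ℝ → ℝ) : Set V2 := {p | HasDerivAt η p.2 p.1}

/-- All forward images of `η` have their derivative graph in `V`. -/
def Adm (T : (ℝ → ℝ) → ℝ → ℝ) (V : Set V2) (η : ℝ → ℝ) : Prop :=
  ∀ j, derivGraph (T^[j] η) ⊆ V

lemma Adm.iterate {T : (ℝ → ℝ) → ℝ → ℝ} {V : Set V2} {η : ℝ → ℝ} (h : Adm T V η) (n : ℕ) :
    Adm T V (T^[n] η) := fun j => by
  rw [← Function.iterate_add_apply]; exact h _

/-- The closed `1 / i`-neighbourhood of the graph of `w`. -/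
def nearGraph (w : ℝ → ℝ) (i : ℕ) : Set V2 := {p | i * |p.2 - w p.1| ≤ 1}

lemma nearGraph_antitone (w : ℝ → ℝ) : Antitone (nearGraph w) := fun _ _ hij p hp =>
  le_trans (mul_le_mul_of_nonneg_right (Nat.cast_le.2 hij) (abs_nonneg (p.2 - w p.1))) hp

lemma nearGraph_zero (w : ℝ → ℝ) : nearGraph w 0 = Set.univ :=
  Set.eq_univ_of_forall fun p => by simp [nearGraph]

lemma isClosed_nearGraph {w : ℝ → ℝ} (hw : Continuous w) (i : ℕ) : IsClosed (nearGraph w i) :=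
  isClosed_le (by fun_prop) continuous_const

namespace Region
variable {φ : V2 → V2} {T : (ℝ → ℝ) → ℝ → ℝ} {um up : ℝ → ℝ} {U R : ℝ} {r : ℝ → ℝ}
  (h : Region φ T um up U R r)
include h

lemma derivGraph_nonempty {c : ℝ} {η : ℝ → ℝ} (hη : State um up r c η) :
    (derivGraph η).Nonempty := by
  obtain ⟨-, hcal, hsub⟩ := h.full.2 η (h.state_lip1 hη)
  obtain ⟨x, hx⟩ := hcal 0
  obtain ⟨-, y, Y, -, hy, -⟩ := hsub x 0 hx
  exact ⟨(x, y), (h.state_subgrad hη hy).2⟩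

lemma link_iterate {c : ℝ} {η : ℝ → ℝ} (hη : State um up r c η) {V : Set V2} (hV : Adm T V η)
    {n : ℕ} (hn : 1 ≤ n) : Link φ V n (derivGraph η) (derivGraph (T^[n] η)) := by
  intro q hq
  obtain ⟨p, hpq, hp⟩ := h.graph_iterate hη n hq
  exact ⟨n, hn, le_rfl, p, hp 0 (Nat.zero_le _), hpq, fun j hj => hV j (hp j hj)⟩

theorem exists_link {V : Set V2} {D : Set ℝ} (hD : IsPreconnected D)
    (hDI : D ⊆ Set.Ioo (pot um 1) (pot up 1))
    (hDV : ∃ (L : ℕ) (K : ℝ), ∃ κ > 0, ∀ c' ∈ D, ∀ c'' ∈ D, ∀ η ζ, State um up r c' η →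
      Lip (U + 1) ζ → State um up r c'' (T ζ) →
      (∃ (I : Finset ℕ) (hI : I.Nonempty), (∀ n ∈ I, L ≤ n) ∧ ∃ a : ℝ, ∀ x, |x| ≤ K →
        |ζ x - I.inf' hI fun n => T^[n] η x - n * a| ≤ κ) → Adm T V (T ζ))
    {c c' : ℝ} (hc : c ∈ D) (hc' : c' ∈ D) : ∃ N, ∀ η, State um up r c η → Adm T V η →
      ∃ η', State um up r c' η' ∧ Adm T V η' ∧ Link φ V N (derivGraph η) (derivGraph η') := by
  obtain ⟨L, K, κ, hκ, hV⟩ := hDV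
  refine hD.induction₂' (fun c c' => ∃ N, ∀ η, State um up r c η → Adm T V η →
      ∃ η', State um up r c' η' ∧ Adm T V η' ∧ Link φ V N (derivGraph η) (derivGraph η'))
    ?_ ?_ hc hc'
  · intro x hx
    obtain ⟨N, δ, hδ, hstep⟩ := h.step (hDI hx) L K hκ
    have key : ∀ c' ∈ D, ∀ c'' ∈ D, |c' - x| < δ → |c'' - x| < δ →
        ∃ N, ∀ η, State um up r c' η → Adm T V η → ∃ η', State um up r c'' η' ∧ Adm T V η' ∧
          Link φ V N (derivGraph η) (derivGraph η') := by
      intro c' hc' c'' hc'' h' h''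
      refine ⟨N, fun η hη hadm => ?_⟩
      obtain ⟨η', hη', hq, ζ, hζ, -, rfl, hI⟩ := hstep c' c'' h' h'' η hη
      have hadm' := hV c' hc' c'' hc'' η ζ hη hζ hη' hI
      refine ⟨T ζ, hη', hadm', fun q hqm => ?_⟩
      obtain ⟨n, hn1, hnN, p, hpq, hp⟩ := hq q hqm
      refine ⟨n, hn1, hnN, p, hp 0 hn1, hpq, fun j hj => ?_⟩
      rcases hj.lt_or_eq with hj | rfl
      · exact hadm j (hp j hj)
      · rw [hpq]; exact hadm' 0 hqm
    have hx0 : |x - x| < δ := by simpa using hδ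
    filter_upwards [self_mem_nhdsWithin,
      mem_nhdsWithin_of_mem_nhds (Metric.ball_mem_nhds x hδ)] with y hy hyx
    rw [Metric.mem_ball, Real.dist_eq] at hyx
    exact ⟨key x hx y hy hx0 hyx, key y hy x hx hyx hx0⟩
  · rintro x y z - - - ⟨N, hN⟩ ⟨M, hM⟩
    refine ⟨N + M, fun η hη hadm => ?_⟩
    obtain ⟨η', hη', hadm', hl⟩ := hN η hη hadm
    obtain ⟨η'', hη'', hadm'', hl'⟩ := hM η' hη' hadm'
    exact ⟨η'', hη'', hadm'', hl.trans hl'⟩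

lemma exists_level {w : ℝ → ℝ} (hw : Bdry φ U w) {ω : ℝ} (hω : Irrational ω)
    (hrot : Tendsto (fun n : ℕ => ((proj φ w)^[n] 0 - 0) / n) atTop (𝓝 ω)) (c₀ : ℝ) (i : ℕ) :
    ∃ δ > 0, (i = 0 → |c₀ - pot w 1| < δ) ∧ ∃ (L : ℕ),
      (∀ c η, |c - pot w 1| < δ → State um up r c η → Adm T (nearGraph w i) (T^[L] η)) ∧
      ∃ (K : ℝ), ∃ κ > 0,
      ∀ c' c'' η ζ, |c' - pot w 1| < δ → |c'' - pot w 1| < δ → State um up r c' η →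
        Lip (U + 1) ζ → State um up r c'' (T ζ) →
        (∃ (I : Finset ℕ) (hI : I.Nonempty), (∀ n ∈ I, L ≤ n) ∧ ∃ a : ℝ, ∀ x, |x| ≤ K →
          |ζ x - I.inf' hI fun n => T^[n] η x - n * a| ≤ κ) →
        Adm T (nearGraph w i) (T ζ) := by
  rcases Nat.eq_zero_or_pos i with rfl | hi
  · refine ⟨|c₀ - pot w 1| + 1, by positivity, fun _ => by linarith, 0, ?_, 0, 1, one_pos, ?_⟩
    · intro c η _ _ j
      rw [nearGraph_zero]; exact Set.subset_univ _
    · intro c' c'' η ζ _ _ _ _ _ _ j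
      rw [nearGraph_zero]; exact Set.subset_univ _
  · have hi' : (0 : ℝ) < i := by exact_mod_cast hi
    have hmem : ∀ p : V2, |p.2 - w p.1| ≤ 1 / i → p ∈ nearGraph w i := by
      intro p hp
      rw [le_div_iff₀ hi', mul_comm] at hp
      exact hp
    obtain ⟨δ, hδ, L, K, κ, hκ, h1, h2⟩ :=
      h.exists_step_close hw hω hrot (ε := 1 / i) (by positivity)
    refine ⟨δ, hδ, fun h0 => absurd h0 hi.ne', L, ?_, K, κ, hκ, ?_⟩
    · intro c η hc hη j p hp
      rw [← Function.iterate_add_apply] at hp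
      exact hmem p (h1 c η hc hη (j + L) (by omega) p hp)
    · intro c' c'' η ζ hc' hc'' hη hζ hζ' hI j p hp
      exact hmem p (h2 c' c'' η ζ hc' hc'' hη hζ hζ' hI j p hp)

theorem exists_levels {w : ℝ → ℝ} (hw : Bdry φ U w) {ω : ℝ} (hω : Irrational ω)
    (hrot : Tendsto (fun n : ℕ => ((proj φ w)^[n] 0 - 0) / n) atTop (𝓝 ω))
    (hw1 : pot w 1 ∈ Set.Icc (pot um 1) (pot up 1)) {c₀ : ℝ}
    (hc₀ : c₀ ∈ Set.Ioo (pot um 1) (pot up 1)) :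
    ∃ (S : ℕ → Set (Set V2)) (N : ℕ → ℕ),
      S 0 = {A | ∃ η, State um up r c₀ η ∧ A = derivGraph η} ∧
      (∀ i, (S i).Nonempty) ∧ (∀ i, ∀ A ∈ S i, A.Nonempty) ∧
      (∀ i, ∀ A ∈ S i, ∃ A' ∈ S (i + 1), Link φ (nearGraph w i) (N i) A A') ∧
      ∀ i, ∀ A ∈ S (i + 1), ∃ A' ∈ S i, Link φ (nearGraph w i) (N i) A A' := by
  choose δ hδ hδ0 L hL K κ hκ hV using h.exists_level hw hω hrot c₀
  let D : ℕ → Set ℝ := fun i =>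
    Set.Ioo (pot um 1) (pot up 1) ∩ Set.Ioo (pot w 1 - δ i) (pot w 1 + δ i)
  have hDabs : ∀ {i c}, c ∈ D i → |c - pot w 1| < δ i := fun hc =>
    abs_lt.2 ⟨by linarith [hc.2.1], by linarith [hc.2.2]⟩
  have hDmem : ∀ {i c}, c ∈ Set.Ioo (pot um 1) (pot up 1) → |c - pot w 1| < δ i → c ∈ D i :=
    fun hc hc' => ⟨hc, by linarith [(abs_lt.1 hc').1], by linarith [(abs_lt.1 hc').2]⟩
  have hDpre : ∀ i, IsPreconnected (D i) := fun i =>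
    (Set.ordConnected_Ioo.inter Set.ordConnected_Ioo).isPreconnected
  have hex : ∀ i, ∃ c ∈ Set.Ioo (pot um 1) (pot up 1),
      |c - pot w 1| < min (δ i) (δ (i + 1)) := by
    intro i
    rw [← closure_Ioo (hc₀.1.trans hc₀.2).ne, Metric.mem_closure_iff] at hw1
    obtain ⟨c, hc, hd⟩ := hw1 _ (lt_min (hδ i) (hδ (i + 1)))
    exact ⟨c, hc, by rwa [dist_comm, Real.dist_eq] at hd⟩
  choose c' hc'I hc' using hex
  obtain ⟨c, hc0, hcD, hcD'⟩ : ∃ c : ℕ → ℝ, c 0 = c₀ ∧ (∀ i, c i ∈ D i) ∧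
      ∀ i, c (i + 1) ∈ D i := by
    refine ⟨fun i => Nat.casesOn i c₀ c', rfl, fun i => ?_, fun i => ?_⟩
    · cases i with
      | zero => exact hDmem hc₀ (hδ0 0 rfl)
      | succ i => exact hDmem (hc'I i) ((hc' i).trans_le (min_le_right _ _))
    · exact hDmem (hc'I i) ((hc' i).trans_le (min_le_left _ _))
  have hlink : ∀ i {a b}, a ∈ D i → b ∈ D i → ∃ N, ∀ η, State um up r a η →
      Adm T (nearGraph w i) η → ∃ η', State um up r b η' ∧ Adm T (nearGraph w i) η' ∧
        Link φ (nearGraph w i) N (derivGraph η) (derivGraph η') := fun i a b ha hb =>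
    h.exists_link (hDpre i) Set.inter_subset_left ⟨L i, K i, κ i, hκ i,
      fun a ha b hb η ζ => hV i a b η ζ (hDabs ha) (hDabs hb)⟩ ha hb
  choose N₁ hN₁ using fun i => hlink i (hcD i) (hcD' i)
  choose N₂ hN₂ using fun i => hlink i (hcD' i) (hcD i)
  have hmono : ∀ {V : Set V2} {N M : ℕ} {A A' : Set V2}, N ≤ M → Link φ V N A A' →
      Link φ V M A A' := fun hNM hl q hq => by
    obtain ⟨n, hn1, hnN, hp⟩ := hl q hq
    exact ⟨n, hn1, hnN.trans hNM, hp⟩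
  refine ⟨fun i => {A | ∃ η, State um up r (c i) η ∧ Adm T (nearGraph w i) η ∧
    A = derivGraph η}, fun i => max (N₁ i + (L (i + 1) + 1)) (N₂ i), ?_, ?_, ?_, ?_, ?_⟩
  · ext A
    constructor
    · rintro ⟨η, hη, -, rfl⟩
      exact ⟨η, hc0 ▸ hη, rfl⟩
    · rintro ⟨η, hη, rfl⟩
      refine ⟨η, hc0.symm ▸ hη, fun j => ?_, rfl⟩
      rw [nearGraph_zero]; exact Set.subset_univ _
  · intro i
    obtain ⟨η, hη⟩ := h.exists_state (Set.Ioo_subset_Icc_self (hcD i).1)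
    exact ⟨_, T^[L i] η, h.state_iterate hη _, hL i _ η (hDabs (hcD i)) hη, rfl⟩
  · rintro i A ⟨η, hη, -, rfl⟩
    exact h.derivGraph_nonempty hη
  · rintro i A ⟨η, hη, hadm, rfl⟩
    obtain ⟨η', hη', hadm', hl⟩ := hN₁ i η hη hadm
    refine ⟨_, ⟨T^[L (i + 1) + 1] η', h.state_iterate hη' _, ?_, rfl⟩, ?_⟩
    · rw [add_comm (L (i + 1)) 1, Function.iterate_add_apply]
      exact (hL (i + 1) _ η' (hDabs (hcD (i + 1))) hη').iterate 1
    · exact hmono (le_max_left _ _) (hl.trans (h.link_iterate hη' hadm' (by omega)))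
  · rintro i A ⟨η, hη, hadm, rfl⟩
    obtain ⟨η', hη', hadm', hl⟩ := hN₂ i η hη
      fun j => (hadm j).trans (nearGraph_antitone w (Nat.le_succ i))
    exact ⟨_, ⟨η', hη', hadm', rfl⟩, hmono (le_max_right _ _) hl⟩

end Region

/-! ### The connecting orbit -/

/-- Horizontal translation by an integer. -/
def hshift (k : ℤ) (p : V2) : V2 := (p.1 + k, p.2)

lemma commute_hshift {φ : V2 → V2} (hφ : ∀ p, φ (Tmap p) = Tmap (φ p)) (k : ℤ) :
    Function.Commute φ (hshift k) := by
  rintro ⟨x, y⟩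
  have h1 := class_int (η := fun x => (φ (x, y)).1) (c := 1)
    (fun x => congrArg Prod.fst (hφ (x, y))) x k
  have h2 := class_int (η := fun x => (φ (x, y)).2) (c := 0)
    (fun x => (congrArg Prod.snd (hφ (x, y))).trans (add_zero _).symm) x k
  simp only [mul_one, mul_zero, add_zero] at h1 h2
  exact Prod.ext h1 h2

lemma hshift_mem_nearGraph {w : ℝ → ℝ} (hw : ∀ x, w (x + 1) = w x) {k : ℤ} {i : ℕ} {p : V2}
    (hp : p ∈ nearGraph w i) : hshift k p ∈ nearGraph w i := by
  have : w (p.1 + k) = w p.1 := by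
    simpa using class_int (η := w) (c := 0) (fun x => by rw [hw, add_zero]) p.1 k
  show i * |p.2 - w (p.1 + k)| ≤ 1
  rw [this]; exact hp

namespace Region
variable {φ : V2 → V2} {T : (ℝ → ℝ) → ℝ → ℝ} {um up : ℝ → ℝ} {U R : ℝ} {r : ℝ → ℝ}
  (h : Region φ T um up U R r)
include h

lemma pot_lt : pot um 1 < pot up 1 := by
  have hs : StrictMono fun x => pot up x - pot um x :=
    strictMono_of_hasDerivAt_pos (f' := fun x => up x - um x)
      (fun x => (pot_hasDerivAt h.bp.uc.continuous x).sub (pot_hasDerivAt h.bm.uc.continuous x))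
      fun x => sub_pos.2 (h.lt x)
  have h0 : ∀ w : ℝ → ℝ, pot w 0 = 0 := fun w => by simp [pot]
  have := hs zero_lt_one
  simp only [h0] at this
  linarith

theorem exists_finite_connecting {ωm ωp : ℝ} (hωm : Irrational ωm) (hωp : Irrational ωp)
    (hrotm : Tendsto (fun n : ℕ => ((proj φ um)^[n] 0 - 0) / n) atTop (𝓝 ωm))
    (hrotp : Tendsto (fun n : ℕ => ((proj φ up)^[n] 0 - 0) / n) atTop (𝓝 ωp))
    {g : V2 → V2} (hg : Function.LeftInverse g φ) :
    ∃ sm sp : ℕ → ℕ, ∀ M : ℕ, ∃ p : V2, p.2 ∈ Set.Icc (um p.1) (up p.1) ∧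
      (∀ t ≤ M, ∀ i, sp i ≤ t → φ^[t] p ∈ nearGraph up i) ∧
      ∀ t ≤ M, ∀ i, sm i ≤ t → g^[t] p ∈ nearGraph um i := by
  obtain ⟨c₀, hc₀⟩ := exists_between h.pot_lt
  obtain ⟨Sm, Nm, hSm0, hSmne, -, -, hSm⟩ :=
    h.exists_levels h.bm hωm hrotm ⟨le_rfl, h.pot_lt.le⟩ hc₀
  obtain ⟨Sp, Np, hSp0, -, hSpne, hSp, -⟩ :=
    h.exists_levels h.bp hωp hrotp ⟨h.pot_lt.le, le_rfl⟩ hc₀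
  refine ⟨stepSum Nm, stepSum Np, fun M => ?_⟩
  obtain ⟨A₀, hA₀⟩ := hSmne M
  obtain ⟨A, hA, hback⟩ := backward_chain (nearGraph_antitone um) (nearGraph_zero um) hSm M A₀ hA₀
  obtain ⟨A', hA', hforw⟩ := forward_chain (nearGraph_antitone up) (nearGraph_zero up) hSp
    (A := A) (by rw [hSp0, ← hSm0]; exact hA) M
  obtain ⟨q, hq⟩ := hSpne M A' hA'
  obtain ⟨p, hp, τ, hτ, -, -, hpτ⟩ := hforw q hq
  obtain ⟨p₀, -, σ, hσ, -, hpσ, hp₀⟩ := hback p hp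
  rw [hSm0] at hA
  obtain ⟨η, hη, rfl⟩ := hA
  refine ⟨p, (h.state_deriv hη hp).1, fun t ht => hpτ t (ht.trans hτ), fun t ht i hi => ?_⟩
  have hback := hp₀ t (ht.trans hσ) i hi
  have ht' : g^[t] p = φ^[σ - t] p₀ := by
    rw [← hpσ]
    conv_lhs => rw [show σ = t + (σ - t) by omega, Function.iterate_add_apply]
    exact hg.iterate t _
  rwa [ht']

theorem exists_connecting {ωm ωp : ℝ} (hωm : Irrational ωm) (hωp : Irrational ωp)
    (hrotm : Tendsto (fun n : ℕ => ((proj φ um)^[n] 0 - 0) / n) atTop (𝓝 ωm))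
    (hrotp : Tendsto (fun n : ℕ => ((proj φ up)^[n] 0 - 0) / n) atTop (𝓝 ωp)) :
    ∃ p : V2, p.2 ∈ Set.Icc (um p.1) (up p.1) ∧
      (∀ i, ∀ᶠ t in atTop, φ^[t] p ∈ nearGraph up i) ∧
      ∀ i, ∀ᶠ t in atTop, (Function.invFun φ)^[t] p ∈ nearGraph um i := by
  obtain ⟨e, he⟩ := h.homeo
  have hinv : Function.invFun φ = e.symm := by
    funext p
    apply h.injective
    have hex : ∃ a, φ a = p := ⟨e.symm p, by rw [he, e.apply_symm_apply]⟩
    rw [Function.invFun_eq hex, he, e.apply_symm_apply]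
  rw [hinv]
  have hleft : Function.LeftInverse e.symm φ := by rw [he]; exact e.symm_apply_apply
  have hright : Function.RightInverse e.symm φ := by rw [he]; exact e.apply_symm_apply
  have hcomm : ∀ k, Function.Commute e.symm (hshift k) := fun k p => h.injective <| by
    rw [hright, (commute_hshift h.equiv k).eq, hright]
  obtain ⟨sm, sp, hfin⟩ := h.exists_finite_connecting hωm hωp hrotm hrotp hleft
  have hfin' : ∀ M : ℕ, ∃ p : V2, p.1 ∈ Set.Icc (0 : ℝ) 1 ∧ p.2 ∈ Set.Icc (um p.1) (up p.1) ∧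
      (∀ t ≤ M, ∀ i, sp i ≤ t → φ^[t] p ∈ nearGraph up i) ∧
      ∀ t ≤ M, ∀ i, sm i ≤ t → e.symm^[t] p ∈ nearGraph um i := by
    intro M
    obtain ⟨p, hp, hf, hb⟩ := hfin M
    have hw : ∀ {w : ℝ → ℝ}, Bdry φ U w → w (p.1 + (-⌊p.1⌋ : ℤ)) = w p.1 := fun {w} hw => by
      simpa using class_int (η := w) (c := 0) (fun x => by rw [hw.per, add_zero]) p.1 (-⌊p.1⌋)
    refine ⟨hshift (-⌊p.1⌋) p, ?_, ?_, fun t ht i hi => ?_, fun t ht i hi => ?_⟩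
    · simp only [hshift, Int.cast_neg, Set.mem_Icc]
      constructor <;> linarith [Int.floor_le p.1, Int.lt_floor_add_one p.1]
    · show p.2 ∈ Set.Icc (um (p.1 + (-⌊p.1⌋ : ℤ))) (up (p.1 + (-⌊p.1⌋ : ℤ)))
      rw [hw h.bm, hw h.bp]; exact hp
    · rw [((commute_hshift h.equiv _).iterate_left t).eq]
      exact hshift_mem_nearGraph h.bp.per (hf t ht i hi)
    · rw [((hcomm _).iterate_left t).eq]
      exact hshift_mem_nearGraph h.bm.per (hb t ht i hi)
  choose P hP1 hP2 hPf hPb using hfin'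
  let F : Ultrafilter ℕ := hyperfilter ℕ
  have hF : ∀ t : ℕ, ∀ᶠ M in (F : Filter ℕ), t ≤ M := fun t =>
    Nat.hyperfilter_le_atTop (eventually_ge_atTop t)
  obtain ⟨x, -, hx⟩ := exists_ultralimit F (Eventually.of_forall hP1)
  obtain ⟨y, -, hy⟩ := exists_ultralimit F (a := fun M => (P M).2) (lo := -U) (hi := U)
    (Eventually.of_forall fun M => abs_le.1 (h.abs_le_of_mem (hP2 M)))
  have hlim : Tendsto P F (𝓝 (x, y)) := hx.prodMk_nhds hy
  have hcm := h.bm.uc.continuous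
  have hcp := h.bp.uc.continuous
  refine ⟨(x, y), ⟨?_, ?_⟩, fun i => ?_, fun i => ?_⟩
  · exact le_of_tendsto_of_tendsto' ((hcm.tendsto x).comp hx) hy fun M => (hP2 M).1
  · exact le_of_tendsto_of_tendsto' hy ((hcp.tendsto x).comp hx) fun M => (hP2 M).2
  · filter_upwards [eventually_ge_atTop (sp i)] with t ht
    refine (isClosed_nearGraph hcp i).mem_of_tendsto
      (((h.continuous.iterate t).tendsto _).comp hlim) ?_
    filter_upwards [hF t] with M hM using hPf M t hM i ht
  · filter_upwards [eventually_ge_atTop (sm i)] with t ht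
    refine (isClosed_nearGraph hcm i).mem_of_tendsto
      (((e.symm.continuous.iterate t).tendsto _).comp hlim) ?_
    filter_upwards [hF t] with M hM using hPb M t hM i ht

end Region

lemma tendsto_infDist_graph {w : ℝ → ℝ} {q : ℕ → V2}
    (hq : ∀ i, ∀ᶠ t in atTop, q t ∈ nearGraph w i) :
    Tendsto (fun n => Metric.infDist (q n) {p : V2 | p.2 = w p.1}) atTop (𝓝 0) := by
  rw [Metric.tendsto_atTop']
  intro ε hε
  obtain ⟨i, hi⟩ := exists_nat_gt (1 / ε)
  obtain ⟨N, hN⟩ := eventually_atTop.1 (hq i)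
  refine ⟨N, fun n hn => ?_⟩
  rw [Real.dist_0_eq_abs, abs_of_nonneg Metric.infDist_nonneg]
  have hmem : ((q n).1, w (q n).1) ∈ {p : V2 | p.2 = w p.1} := rfl
  refine (Metric.infDist_le_dist_of_mem hmem).trans_lt ?_
  rw [Prod.dist_eq, dist_self, Real.dist_eq, max_eq_right (abs_nonneg _)]
  have h1 : i * |(q n).2 - w (q n).1| ≤ 1 := hN n hn.le
  have h0 : 0 < (i : ℝ) := (by positivity : 0 < 1 / ε).trans hi
  rw [div_lt_iff₀ hε] at hi
  by_contra! hle
  nlinarith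

lemma Bdry.iterate_apply {φ : V2 → V2} {U : ℝ} {w : ℝ → ℝ} (hw : Bdry φ U w) (n : ℕ) (x : ℝ) :
    φ^[n] (x, w x) = ((proj φ w)^[n] x, w ((proj φ w)^[n] x)) := by
  induction n with
  | zero => rfl
  | succ n ih => rw [Function.iterate_succ_apply', ih, hw.apply_eq, Function.iterate_succ_apply']

lemma exists_abs_le_of_periodic {w : ℝ → ℝ} (hc : Continuous w) (hper : ∀ x, w (x + 1) = w x) :
    ∃ C, ∀ x, |w x| ≤ C := by
  obtain ⟨C, hC⟩ := periodic_bdd (F := fun p => w p.1) (by fun_prop) (fun p => hper p.1) 0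
  exact ⟨C, fun x => hC x 0 (by simp)⟩

/-- Mather's connecting theorem: given a Birkhoff region of instability `B`
for `φ ∈ 𝒫¹` bounded by invariant Lipschitz graphs `Γ₋, Γ₊` with irrational rotation
numbers `ω₋ < ω₊`, there is an orbit α-asymptotic to `Γ₋` and ω-asymptotic to `Γ₊`. -/
theorem mather_connecting_orbit
    (φ : V2 → V2) (hφ : MemP1 φ)
    (um up : ℝ → ℝ)
    (hum : ∃ K : NNReal, LipschitzWith K um) (hup : ∃ K : NNReal, LipschitzWith K up)
    (humper : ∀ x, um (x + 1) = um x) (hupper : ∀ x, up (x + 1) = up x)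
    (hlt : ∀ x, um x < up x)
    (Γm Γp B : Set V2)
    (hΓm : Γm = {p : V2 | p.2 = um p.1}) (hΓp : Γp = {p : V2 | p.2 = up p.1})
    (hΓminv : φ '' Γm = Γm) (hΓpinv : φ '' Γp = Γp)
    (hB : B = {p : V2 | um p.1 ≤ p.2 ∧ p.2 ≤ up p.1})
    (hBinv : φ '' B = B)
    (hBirkhoff : ∀ w : ℝ → ℝ, Continuous w → (∀ x, w (x + 1) = w x) →
      φ '' {p : V2 | p.2 = w p.1} = {p : V2 | p.2 = w p.1} →
      {p : V2 | p.2 = w p.1} ⊆ B →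
      {p : V2 | p.2 = w p.1} = Γm ∨ {p : V2 | p.2 = w p.1} = Γp)
    (ωm ωp : ℝ) (hωm : Irrational ωm) (hωp : Irrational ωp) (hω : ωm < ωp)
    (hrotm : ∀ p ∈ Γm, Tendsto (fun n : ℕ => ((φ^[n] p).1 - p.1) / n) atTop (𝓝 ωm))
    (hrotp : ∀ p ∈ Γp, Tendsto (fun n : ℕ => ((φ^[n] p).1 - p.1) / n) atTop (𝓝 ωp)) :
    ∃ p ∈ B,
      Tendsto (fun n : ℕ => Metric.infDist (φ^[n] p) Γp) atTop (𝓝 0) ∧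
      Tendsto (fun n : ℕ => Metric.infDist ((Function.invFun φ)^[n] p) Γm) atTop (𝓝 0) := by
  obtain ⟨⟨T, hT⟩, homeo, equiv⟩ := hφ.exists_isLaxOleinik
  obtain ⟨Km, hKm⟩ := hum
  obtain ⟨Kp, hKp⟩ := hup
  subst hΓm hΓp hB
  obtain ⟨Cm, hCm⟩ := exists_abs_le_of_periodic hKm.continuous humper
  obtain ⟨Cp, hCp⟩ := exists_abs_le_of_periodic hKp.continuous hupper
  obtain ⟨R, r, hfull⟩ := hT.full (max Cm Cp + 1)
  have bm : Bdry φ (max Cm Cp) um :=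
    ⟨hKm.uniformContinuous, humper, fun x => (hCm x).trans (le_max_left _ _), hΓminv⟩
  have bp : Bdry φ (max Cm Cp) up :=
    ⟨hKp.uniformContinuous, hupper, fun x => (hCp x).trans (le_max_right _ _), hΓpinv⟩
  have heq : ∀ {w v : ℝ → ℝ}, {p : V2 | p.2 = w p.1} = {p : V2 | p.2 = v p.1} → w = v := by
    intro w v hwv
    funext x
    have hmem : ((x, w x) : V2) ∈ {p : V2 | p.2 = w p.1} := rfl
    rw [hwv] at hmem
    exact hmem
  have h : Region φ T um up (max Cm Cp) R r :=
    { lo := hT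
      full := hfull
      homeo := homeo
      equiv := equiv
      bm := bm
      bp := bp
      lt := hlt
      inv := fun x y X Y hxy hy => by
        have hmem := Set.mem_image_of_mem φ
          (show ((x, y) : V2) ∈ {p : V2 | um p.1 ≤ p.2 ∧ p.2 ≤ up p.1} from hy)
        rw [hBinv, hxy] at hmem
        exact hmem
      birkhoff := fun w hwc hwper hwinv hw =>
        (hBirkhoff w hwc hwper hwinv fun p hp => by
          rw [Set.mem_ofPred_eq] at hp ⊢
          rw [hp]; exact hw p.1).imp heq heq }
  have hrot : ∀ {w : ℝ → ℝ} {ω : ℝ}, Bdry φ (max Cm Cp) w →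
      (∀ p ∈ {p : V2 | p.2 = w p.1},
        Tendsto (fun n : ℕ => ((φ^[n] p).1 - p.1) / n) atTop (𝓝 ω)) →
      Tendsto (fun n : ℕ => ((proj φ w)^[n] 0 - 0) / n) atTop (𝓝 ω) := by
    intro w ω hw hlim
    have h0 := hlim (0, w 0) rfl
    simpa only [hw.iterate_apply] using h0
  obtain ⟨p, hp, hfor, hback⟩ := h.exists_connecting hωm hωp (hrot bm hrotm) (hrot bp hrotp)
  exact ⟨p, hp, tendsto_infDist_graph hfor, tendsto_infDist_graph hback⟩
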